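/- arXiv:1211.1247 — 5 statements merged into one kernel-verified Lean document; each statement's English description precedes it below -/
import Mathlib

section
/- Let G be a finite, connected graph and let 0 < α < 1. Then there exists a point v = v(G,α) ∈ Δ all of whose coordinates are strictly positive such that x(n) converges to v almost surely. -/
open MeasureTheory Filter Topology

open MeasureTheory Filter Topology

/-- A generalized Pólya urn process with graph based interactions on a finite graph `G`
with vertex set `Fin m` and reinforcement exponent `α`, as in Benaïm–Benjamini–Chen–Lima.
`B n i` is the number of balls in bin `i` after step `n`; at each step, for each edge
`{i,j}` of `G` one ball is added to `i` or to `j`, with conditional probability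
`B_i(n)^α / (B_i(n)^α + B_j(n)^α)` for `i`, independently over distinct edges. -/
structure GraphUrn (m : ℕ) (G : SimpleGraph (Fin m)) [DecidableRel G.Adj] (α : ℝ) where
  /-- the underlying sample space -/
  Ω : Type
  /-- the ambient measurable structure -/
  [mΩ : MeasurableSpace Ω]
  /-- the underlying probability measure -/
  μ : Measure Ω
  isProb : IsProbabilityMeasure μ
  /-- `ℱ n` is the sigma-algebra generated by the process up to step `n` -/
  ℱ : Filtration ℕ mΩ
  /-- `B n i ω` is the number of balls in the bin at vertex `i` after step `n` -/
  B : ℕ → Fin m → Ω → ℕ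
  /-- `δ n i j ω = 1` iff at step `n` the ball of the edge `{i,j}` is added to bin `i` -/
  δ : ℕ → Fin m → Fin m → Ω → ℕ
  /-- each bin contains at least one ball initially -/
  B0_pos : ∀ i ω, 1 ≤ B 0 i ω
  /-- the initial configuration is deterministic -/
  B0_det : ∀ i ω ω', B 0 i ω = B 0 i ω'
  /-- on each edge, exactly one of the two endpoints receives the ball -/
  δ_sum : ∀ n i j, G.Adj i j → ∀ ω, δ n i j ω + δ n j i ω = 1
  /-- the evolution of the number of balls in each bin -/
  B_succ : ∀ n i ω, B (n + 1) i ω = B n i ω + ∑ j ∈ G.neighborFinset i, δ (n + 1) i j ω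
  /-- the number of balls after step `n` is measurable with respect to `ℱ n` -/
  B_adapted : ∀ n i, Measurable[ℱ n] (B n i)
  /-- the choices at step `n` are measurable with respect to `ℱ n` -/
  δ_adapted : ∀ n i j, Measurable[ℱ n] (δ n i j)
  /-- conditionally on the past, the ball of the edge `{i,j}` at step `n+1` goes to bin `i`
  with probability `B_i(n)^α / (B_i(n)^α + B_j(n)^α)` -/
  cond_law : ∀ n i j, G.Adj i j →
    μ[fun ω => (δ (n + 1) i j ω : ℝ) | ℱ n] =ᵐ[μ]
      fun ω => (B n i ω : ℝ) ^ α / ((B n i ω : ℝ) ^ α + (B n j ω : ℝ) ^ α)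
  /-- conditionally on the past, the choices on distinct edges are independent -/
  cond_indep : ∀ n (s : Finset (Fin m × Fin m)), (∀ p ∈ s, G.Adj p.1 p.2) →
    (∀ p ∈ s, ∀ q ∈ s, p ≠ q → (s(p.1, p.2) : Sym2 (Fin m)) ≠ s(q.1, q.2)) →
    μ[fun ω => ∏ p ∈ s, (δ (n + 1) p.1 p.2 ω : ℝ) | ℱ n] =ᵐ[μ]
      fun ω => ∏ p ∈ s, (μ[fun ω' => (δ (n + 1) p.1 p.2 ω' : ℝ) | ℱ n]) ω

namespace GraphUrn

variable {m : ℕ} {G : SimpleGraph (Fin m)} [DecidableRel G.Adj] {α : ℝ}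

/-- `x P n ω` is the vector of proportions of balls after step `n`:
`x_i(n) = B_i(n) / (N_0 + n N)` where `N_0` is the initial total number of balls and
`N` is the number of edges of `G`. -/
noncomputable def x (P : GraphUrn m G α) (n : ℕ) (ω : P.Ω) : Fin m → ℝ :=
  fun i => (P.B n i ω : ℝ) / (((∑ j, P.B 0 j ω) + n * G.edgeFinset.card : ℕ) : ℝ)

end GraphUrn


section aux

variable {m : ℕ} (G : SimpleGraph (Fin m)) [DecidableRel G.Adj]

def urnPairs : Finset (Fin m × Fin m) := Finset.univ.filter (fun p => G.Adj p.1 p.2)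

lemma sum_urnPairs {M : Type*} [AddCommMonoid M] (f : Fin m → Fin m → M) :
    ∑ i, ∑ j ∈ G.neighborFinset i, f i j = ∑ p ∈ urnPairs G, f p.1 p.2 := by
  unfold urnPairs
  rw [Finset.sum_filter, Fintype.sum_prod_type]
  refine Finset.sum_congr rfl fun i _ => ?_
  rw [← Finset.sum_filter]
  refine Finset.sum_congr ?_ fun _ _ => rfl
  ext j; simp

lemma swap_urnPairs {M : Type*} [AddCommMonoid M] (f : Fin m → Fin m → M) :
    ∑ p ∈ urnPairs G, f p.1 p.2 = ∑ p ∈ urnPairs G, f p.2 p.1 := by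
  refine Finset.sum_nbij' Prod.swap Prod.swap ?_ ?_ ?_ ?_ ?_ <;> simp [urnPairs, G.adj_comm]

lemma card_urnPairs : (urnPairs G).card = 2 * G.edgeFinset.card := by
  rw [← G.sum_degrees_eq_twice_card_edges, Finset.card_eq_sum_ones,
    ← sum_urnPairs G (fun _ _ => 1)]
  simp

/-- the function `h`, drift of the Lyapunov function -/
noncomputable def urnH (α : ℝ) (v x : Fin m → ℝ) : ℝ :=
  ∑ i, v i / x i * ∑ j ∈ G.neighborFinset i, x i ^ α / (x i ^ α + x j ^ α)
    - G.edgeFinset.card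

noncomputable def urnPhi (α : ℝ) (x : Fin m → ℝ) : ℝ :=
  ∏ p ∈ urnPairs G, (x p.1 ^ α + x p.2 ^ α)

variable {G}
set_option linter.unusedSectionVars false

lemma urn_exists_nbr (hconn : G.Connected) {i k : Fin m} (h : i ≠ k) : ∃ j, G.Adj i j := by
  obtain ⟨w⟩ := hconn.preconnected i k
  cases w with
  | nil => exact absurd rfl h
  | cons h' _ => exact ⟨_, h'⟩

lemma urn_exists_t (α : ℝ) (hα1 : α < 1) (K : ℝ) (c : ℝ) (hc : 0 < c) :
    ∃ t : ℝ, 0 < t ∧ t < 1 ∧ K * t ≤ 1 / 2 ∧ 2 * K * t < c * t ^ α := by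
  have h1 : ∀ᶠ t : ℝ in 𝓝[>] 0, K * t ≤ 1/2 := by
    have : Tendsto (fun t : ℝ => K * t) (𝓝[>] 0) (𝓝 0) := by
      have : Continuous (fun t : ℝ => K * t) := by fun_prop
      simpa using (this.tendsto 0).mono_left nhdsWithin_le_nhds
    exact this.eventually_le_const (by norm_num)
  have h2 : ∀ᶠ t : ℝ in 𝓝[>] 0, 2 * K * t ^ (1 - α) < c := by
    have : Tendsto (fun t : ℝ => 2 * K * t ^ (1 - α)) (𝓝[>] 0) (𝓝 0) := by
      have : Continuous (fun t : ℝ => 2 * K * t ^ (1 - α)) :=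
        continuous_const.mul (Real.continuous_rpow_const (by linarith))
      have := (this.tendsto 0).mono_left (nhdsWithin_le_nhds (s := Set.Ioi 0))
      rwa [Real.zero_rpow (by linarith), mul_zero] at this
    exact this.eventually_lt_const hc
  have h3 : ∀ᶠ t : ℝ in 𝓝[>] 0, t < 1 :=
    (tendsto_id.mono_left nhdsWithin_le_nhds : Tendsto id (𝓝[>] (0:ℝ)) (𝓝 0)).eventually_lt_const
      one_pos
  obtain ⟨t, ht1, ht2, ht3, ht4⟩ := (h1.and (h2.and (h3.and self_mem_nhdsWithin))).exists
  have ht4 : 0 < t := ht4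
  refine ⟨t, ht4, ht3, ht1, ?_⟩
  have : t = t ^ (1 - α) * t ^ α := by
    rw [← Real.rpow_add ht4]; simp
  have hp : 0 < t ^ α := Real.rpow_pos_of_pos ht4 α
  calc 2 * K * t = 2 * K * t ^ (1 - α) * t ^ α := by rw [mul_assoc (2*K), ← this]
    _ < _ := by gcongr

lemma urn_exists_v (hconn : G.Connected) {α : ℝ} (hα0 : 0 < α) (hα1 : α < 1) :
    ∃ v : Fin m → ℝ, (∀ i, 0 < v i) ∧ (∑ i, v i) = 1 ∧
      ∀ x : Fin m → ℝ, (∀ i, 0 ≤ x i) → ∑ i, x i = 1 → urnPhi G α x ≤ urnPhi G α v := by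
  obtain ⟨i0⟩ := hconn.nonempty
  have hm : 0 < m := i0.pos
  have hmR : (0:ℝ) < m := by exact_mod_cast hm
  have hcont : Continuous (urnPhi G α) := by
    unfold urnPhi
    refine continuous_finsetProd _ fun p _ => ?_
    exact ((Real.continuous_rpow_const hα0.le).comp (continuous_apply _)).add
      ((Real.continuous_rpow_const hα0.le).comp (continuous_apply _))
  obtain ⟨v, ⟨hv0, hv1⟩, hvmax⟩ := (isCompact_stdSimplex ℝ (Fin m)).exists_isMaxOn
    ⟨_, single_mem_stdSimplex ℝ i0⟩ hcont.continuousOn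
  have hmax : ∀ x : Fin m → ℝ, (∀ i, 0 ≤ x i) → ∑ i, x i = 1 → urnPhi G α x ≤ urnPhi G α v :=
    fun x h0 h1 => hvmax ⟨h0, h1⟩
  refine ⟨v, ?_, hv1, hmax⟩
  have hΦ : 0 < urnPhi G α v := by
    refine lt_of_lt_of_le ?_ (hmax (fun _ => 1 / m) (fun _ => by positivity)
      (by simp; field_simp))
    unfold urnPhi
    exact Finset.prod_pos fun p _ => by positivity
  intro i
  by_contra hi
  have hvi : v i = 0 := le_antisymm (not_lt.1 hi) (hv0 i)
  have hle1 : ∀ k, v k ≤ 1 := fun k => by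
    rw [← hv1]; exact Finset.single_le_sum (fun j _ => hv0 j) (Finset.mem_univ k)
  obtain ⟨k, hk⟩ : ∃ k, i ≠ k := by
    by_contra! h
    have : ∑ i, v i = 0 := Finset.sum_eq_zero fun k _ => by rw [← h k, hvi]
    linarith
  obtain ⟨j, hj⟩ := urn_exists_nbr hconn hk
  set K := (urnPairs G).card
  obtain ⟨t, ht0, ht1, ht2, ht3⟩ := urn_exists_t α hα1 K ((1 / (m:ℝ)) ^ α) (by positivity)
  set q := (t / m) ^ α
  have hq : 2 * K * t < q := by
    have : q = (1 / (m:ℝ)) ^ α * t ^ α := by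
      rw [← Real.mul_rpow (by positivity) ht0.le, one_div_mul_eq_div]
    rw [this]; exact ht3
  have hq0 : 0 < q := by positivity
  let w : Fin m → ℝ := fun a => (1 - t) * v a + t / m
  have hw := hmax w (fun a => by have := hv0 a; have : 0 < 1 - t := by linarith
                                 positivity) (by
    simp only [w, Finset.sum_add_distrib, ← Finset.mul_sum, hv1]
    simp; field_simp; ring)
  have h1t : 0 < 1 - t := by linarith
  have hpow : ∀ a, (1 - t) * v a ^ α ≤ w a ^ α := fun a => by
    calc (1 - t) * v a ^ α ≤ (1 - t) ^ α * v a ^ α := by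
          have := Real.rpow_nonneg (hv0 a) α
          gcongr
          have := Real.rpow_le_rpow_of_exponent_ge h1t (by linarith) hα1.le
          simpa using this
      _ = ((1 - t) * v a) ^ α := by rw [Real.mul_rpow h1t.le (hv0 a)]
      _ ≤ w a ^ α := by
          have := hv0 a
          apply Real.rpow_le_rpow (by positivity) _ hα0.le
          simp only [w]; have : 0 < t / m := by positivity
          linarith
  have hbig : (1 - t) ^ K * (1 + q) * urnPhi G α v ≤ urnPhi G α w := by
    have e : (1 - t) ^ K * (1 + q) * urnPhi G α v =
        ∏ p ∈ urnPairs G, ((1 - t) * (v p.1 ^ α + v p.2 ^ α) * (if p = (i, j) then 1 + q else 1)) := by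
      rw [Finset.prod_mul_distrib, Finset.prod_mul_distrib, Finset.prod_const,
        Finset.prod_ite_eq', if_pos (by simp [urnPairs, hj])]
      simp only [urnPhi, K]; ring
    rw [e]; unfold urnPhi
    refine Finset.prod_le_prod (fun p _ => ?_) (fun p _ => ?_)
    · have := Real.rpow_nonneg (hv0 p.1) α
      have := Real.rpow_nonneg (hv0 p.2) α
      split_ifs <;> positivity
    · split_ifs with hp
      · subst hp
        simp only [hvi, Real.zero_rpow hα0.ne']
        have h1 := hpow j
        have h2 : w i ^ α = q := by simp [w, hvi, q]
        rw [h2]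
        have h3 : v j ^ α ≤ 1 := Real.rpow_le_one (hv0 j) (hle1 j) hα0.le
        have h4 := Real.rpow_nonneg (hv0 j) α
        have h5 : (1 - t) * v j ^ α ≤ 1 := by nlinarith
        nlinarith
      · have := hpow p.1
        have := hpow p.2
        linarith
  have hb : 1 - K * t ≤ (1 - t) ^ K := by
    have := one_add_mul_le_pow (a := -t) (by linarith) K
    have e : (1 + -t) = 1 - t := by ring
    rw [e] at this; linarith
  have h1 : 1 < (1 - t) ^ K * (1 + q) := by
    have : (1 - K * t) * (1 + q) ≤ (1 - t) ^ K * (1 + q) := by gcongr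
    nlinarith
  nlinarith

lemma urn_bern {α : ℝ} (hα0 : 0 < α) (hα1 : α < 1) {a b : ℝ} (ha : 0 < a) (hb : 0 < b) :
    b ^ α - (1 - α) * a ^ α ≤ α * (b * a ^ α / a) ∧
      (a ≠ b → b ^ α - (1 - α) * a ^ α < α * (b * a ^ α / a)) := by
  have ha' : 0 < a ^ α := Real.rpow_pos_of_pos ha α
  have e : b ^ α = a ^ α * (1 + (b / a - 1)) ^ α := by
    rw [add_sub_cancel, Real.div_rpow hb.le ha.le]; field_simp
  have hs : -1 ≤ b / a - 1 := by have : 0 < b / a := by positivity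
                                 linarith
  have e2 : α * (b * a ^ α / a) = a ^ α * (1 + α * (b / a - 1)) - (1 - α) * a ^ α := by
    field_simp; ring
  rw [e2, e]
  constructor
  · have := rpow_one_add_le_one_add_mul_self hs hα0.le hα1.le
    gcongr
  · intro hne
    have := rpow_one_add_lt_one_add_mul_self hs (by
      intro h; apply hne; field_simp at h; linarith) hα0 hα1
    gcongr

lemma urnH_eq (α : ℝ) (v x : Fin m → ℝ) :
    2 * urnH G α v x = ∑ p ∈ urnPairs G,
      ((v p.1 * x p.1 ^ α / x p.1 + v p.2 * x p.2 ^ α / x p.2) / (x p.1 ^ α + x p.2 ^ α) - 1) := by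
  rw [Finset.sum_sub_distrib]
  simp only [add_div, Finset.sum_add_distrib]
  rw [swap_urnPairs G (fun i j => v j * x j ^ α / x j / (x i ^ α + x j ^ α))]
  unfold urnH
  simp only [Finset.mul_sum, Finset.sum_const, card_urnPairs]
  rw [sum_urnPairs G (fun i j => v i / x i * (x i ^ α / (x i ^ α + x j ^ α))), mul_sub,
    two_mul (Finset.sum _ _)]
  congr 1
  · congr 1
    · refine Finset.sum_congr rfl fun p _ => by ring
    · refine Finset.sum_congr rfl fun p _ => by rw [add_comm (x p.2 ^ α)]; ring
  · simp

lemma urnH_pos (hconn : G.Connected) {α : ℝ} (hα0 : 0 < α) (hα1 : α < 1) {v : Fin m → ℝ}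
    (hv0 : ∀ i, 0 < v i)
    (hmax : ∀ x : Fin m → ℝ, (∀ i, 0 ≤ x i) → ∑ i, x i = 1 → urnPhi G α x ≤ urnPhi G α v)
    (hv1 : ∑ i, v i = 1)
    {x : Fin m → ℝ} (hx0 : ∀ i, 0 < x i) (hx1 : ∑ i, x i = 1) :
    0 ≤ urnH G α v x ∧ (x ≠ v → 0 < urnH G α v x) := by
  have hx' : ∀ i, 0 < x i ^ α := fun i => Real.rpow_pos_of_pos (hx0 i) α
  have hv' : ∀ i, 0 < v i ^ α := fun i => Real.rpow_pos_of_pos (hv0 i) α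
  have hlog : 0 ≤ ∑ p ∈ urnPairs G, ((v p.1 ^ α + v p.2 ^ α) / (x p.1 ^ α + x p.2 ^ α) - 1) := by
    have h1 : ∑ p ∈ urnPairs G, Real.log ((v p.1 ^ α + v p.2 ^ α) / (x p.1 ^ α + x p.2 ^ α)) ≤
        ∑ p ∈ urnPairs G, ((v p.1 ^ α + v p.2 ^ α) / (x p.1 ^ α + x p.2 ^ α) - 1) := by
      refine Finset.sum_le_sum fun p _ => Real.log_le_sub_one_of_pos ?_
      have := hx' p.1; have := hx' p.2; have := hv' p.1; have := hv' p.2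
      positivity
    refine le_trans ?_ h1
    rw [← Real.log_prod (fun p _ => by
      have := hx' p.1; have := hx' p.2; have := hv' p.1; have := hv' p.2
      positivity), Finset.prod_div_distrib]
    apply Real.log_nonneg
    rw [one_le_div (Finset.prod_pos fun p _ => add_pos (hx' _) (hx' _))]
    exact hmax x (fun i => (hx0 i).le) hx1
  have hterm : ∀ p : Fin m × Fin m,
      ((v p.1 ^ α + v p.2 ^ α) / (x p.1 ^ α + x p.2 ^ α) - 1) ≤ α *
      ((v p.1 * x p.1 ^ α / x p.1 + v p.2 * x p.2 ^ α / x p.2) / (x p.1 ^ α + x p.2 ^ α) - 1) ∧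
      (x p.1 ≠ v p.1 → ((v p.1 ^ α + v p.2 ^ α) / (x p.1 ^ α + x p.2 ^ α) - 1) < α *
      ((v p.1 * x p.1 ^ α / x p.1 + v p.2 * x p.2 ^ α / x p.2) / (x p.1 ^ α + x p.2 ^ α) - 1)) := by
    intro p
    have hs := add_pos (hx' p.1) (hx' p.2)
    have b1 := urn_bern hα0 hα1 (hx0 p.1) (hv0 p.1)
    have b2 := urn_bern hα0 hα1 (hx0 p.2) (hv0 p.2)
    set A := v p.1 * x p.1 ^ α / x p.1
    set B := v p.2 * x p.2 ^ α / x p.2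
    set s := x p.1 ^ α + x p.2 ^ α with hsdef
    have e : α * ((A + B) / s - 1) = (α * A + α * B - α * s) / s := by field_simp
    have e2 : (v p.1 ^ α + v p.2 ^ α) / s - 1 = (v p.1 ^ α + v p.2 ^ α - s) / s := by field_simp
    rw [e, e2]
    constructor
    · gcongr ?_ / s
      have := b1.1; have := b2.1
      rw [hsdef]; linarith
    · intro hne
      gcongr ?_ / s
      have := b1.2 hne; have := b2.1
      rw [hsdef]; linarith
  have hmain : α * (2 * urnH G α v x) = ∑ p ∈ urnPairs G, α *
      ((v p.1 * x p.1 ^ α / x p.1 + v p.2 * x p.2 ^ α / x p.2) / (x p.1 ^ α + x p.2 ^ α) - 1) := by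
    rw [urnH_eq, Finset.mul_sum]
  constructor
  · have := Finset.sum_le_sum fun p (_ : p ∈ urnPairs G) => (hterm p).1
    rw [← hmain] at this
    have : 0 ≤ α * (2 * urnH G α v x) := hlog.trans this
    have := nonneg_of_mul_nonneg_right this hα0
    linarith
  · intro hne
    obtain ⟨i, hi⟩ := Function.ne_iff.1 hne
    obtain ⟨k, hk⟩ : ∃ k, i ≠ k := by
      by_contra! h
      have e1 : ∀ f : Fin m → ℝ, ∑ k, f k = f i := fun f =>
        Finset.sum_eq_single i (fun b _ hb => absurd (h b).symm hb) (by simp)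
      rw [e1] at hx1 hv1
      exact hi (hx1.trans hv1.symm)
    obtain ⟨j, hj⟩ := urn_exists_nbr hconn hk
    have := Finset.sum_lt_sum (fun p (_ : p ∈ urnPairs G) => (hterm p).1)
      ⟨(i, j), by simp [urnPairs, hj], (hterm (i, j)).2 hi⟩
    rw [← hmain] at this
    have : 0 < α * (2 * urnH G α v x) := hlog.trans_lt this
    have := pos_of_mul_pos_right this hα0.le
    linarith


lemma urn_errsum (b d : ℕ → ℝ) (D : ℝ) (hb0 : 1 ≤ b 0) (hd0 : ∀ n, 0 ≤ d n) (hdD : ∀ n, d n ≤ D)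
    (hs : ∀ n, b (n + 1) = b n + d n) (n : ℕ) :
    ∑ k ∈ Finset.range n, (d k / b k) ^ 2 ≤ D * (1 + D) := by
  have hD : 0 ≤ D := (hd0 0).trans (hdD 0)
  have hb : ∀ n, 1 ≤ b n := by
    intro n
    induction n with
    | zero => exact hb0
    | succ n ih => rw [hs]; linarith [hd0 n]
  have key : ∑ k ∈ Finset.range n, (d k / b k) ^ 2 ≤ D * (1 + D) * (1 / b 0 - 1 / b n) := by
    induction n with
    | zero => simp
    | succ n ih =>
      rw [Finset.sum_range_succ]
      have : (d n / b n) ^ 2 ≤ D * (1 + D) * (1 / b n - 1 / b (n + 1)) := by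
        have h1 := hb n
        have h2 := hb (n + 1)
        have e : D * (1 + D) * (1 / b n - 1 / b (n + 1)) =
            (D * (1 + D) * b n * d n) / (b n ^ 2 * b (n + 1)) := by
          rw [hs] at h2 ⊢; field_simp; ring
        have e2 : (d n / b n) ^ 2 = (d n * b (n+1) * d n) / (b n ^ 2 * b (n + 1)) := by
          field_simp
        rw [e, e2]
        have h3 := hd0 n
        have h4 : b (n + 1) ≤ (1 + D) * b n := by rw [hs]; nlinarith [hdD n]
        have h5 : d n * b (n + 1) ≤ D * (1 + D) * b n := by
          rw [mul_assoc]; exact mul_le_mul (hdD n) h4 (by linarith) hD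
        gcongr
      linarith
  refine key.trans ?_
  have h1 : 1 / b 0 ≤ 1 := by rw [div_le_one (by linarith)]; exact hb0
  have h2 : 0 ≤ 1 / b n := by have := hb n; positivity
  have : 0 ≤ D * (1 + D) := by positivity
  nlinarith

lemma urn_log {u : ℝ} (hu : 0 ≤ u) : 0 ≤ u - Real.log (1 + u) ∧ u - Real.log (1 + u) ≤ u ^ 2 := by
  have hp : 0 < 1 + u := by linarith
  have h1 := Real.log_le_sub_one_of_pos hp
  have h2 := Real.one_sub_inv_le_log_of_pos hp
  refine ⟨by linarith, ?_⟩
  have : u - (1 - (1 + u)⁻¹) ≤ u ^ 2 := by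
    have e : u - (1 - (1 + u)⁻¹) = u ^ 2 / (1 + u) := by field_simp; ring
    rw [e]; exact div_le_self (by positivity) (by linarith)
  linarith

lemma urn_V_lt {v : Fin m → ℝ} (hv0 : ∀ i, 0 < v i) (hv1 : ∑ i, v i = 1)
    {x : Fin m → ℝ} (hx0 : ∀ i, 0 < x i) (hx1 : ∑ i, x i = 1) (hne : x ≠ v) :
    ∑ i, v i * Real.log (x i) < ∑ i, v i * Real.log (v i) := by
  have h : ∑ i, (v i * Real.log (x i) - v i * Real.log (v i)) < ∑ i, (x i - v i) := by
    have ht : ∀ i, v i * Real.log (x i) - v i * Real.log (v i) = v i * Real.log (x i / v i) :=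
      fun i => by rw [Real.log_div (hx0 i).ne' (hv0 i).ne']; ring
    have ht2 : ∀ i, x i - v i = v i * (x i / v i - 1) := fun i => by
      have := hv0 i
      field_simp
    obtain ⟨i, hi⟩ := Function.ne_iff.1 hne
    refine Finset.sum_lt_sum (fun i _ => ?_) ⟨i, Finset.mem_univ i, ?_⟩
    · rw [ht, ht2]
      exact mul_le_mul_of_nonneg_left
        (Real.log_le_sub_one_of_pos (div_pos (hx0 i) (hv0 i))) (hv0 i).le
    · rw [ht, ht2]
      refine mul_lt_mul_of_pos_left
        (Real.log_lt_sub_one_of_pos (div_pos (hx0 i) (hv0 i)) ?_) (hv0 i)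
      intro h
      rw [div_eq_one_iff_eq (hv0 i).ne'] at h
      exact hi h
  rw [Finset.sum_sub_distrib, Finset.sum_sub_distrib, hx1, hv1] at h
  linarith

lemma urn_det (hconn : G.Connected) {α : ℝ} (hα0 : 0 < α) (hα1 : α < 1) {v : Fin m → ℝ}
    (hv0 : ∀ i, 0 < v i)
    (hmax : ∀ x : Fin m → ℝ, (∀ i, 0 ≤ x i) → ∑ i, x i = 1 → urnPhi G α x ≤ urnPhi G α v)
    (hv1 : ∑ i, v i = 1)
    {x : ℕ → Fin m → ℝ} (hx0 : ∀ n i, 0 < x n i) (hx1 : ∀ n, ∑ i, x n i = 1)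
    {T : ℕ → ℝ} (hT0 : ∀ n, 0 < T n) (hT : ¬ Summable (fun n => 1 / T n))
    (ha : Summable (fun n => urnH G α v (x n) / T n))
    {l : ℝ} (hV : Tendsto (fun n => ∑ i, v i * Real.log (x n i)) atTop (𝓝 l)) :
    Tendsto x atTop (𝓝 v) := by
  have hle1 : ∀ n i, x n i ≤ 1 := fun n i => by
    rw [← hx1 n]; exact Finset.single_le_sum (fun j _ => (hx0 n j).le) (Finset.mem_univ i)
  obtain ⟨C, hC⟩ := hV.bddBelow_range
  have hC' : ∀ n, C ≤ ∑ i, v i * Real.log (x n i) := fun n => hC ⟨n, rfl⟩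
  have hlow : ∀ n i, Real.exp (C / v i) ≤ x n i := by
    intro n i
    rw [← Real.le_log_iff_exp_le (hx0 n i), div_le_iff₀' (hv0 i)]
    refine (hC' n).trans ?_
    rw [← Finset.add_sum_erase _ _ (Finset.mem_univ i)]
    have : ∑ j ∈ Finset.univ.erase i, v j * Real.log (x n j) ≤ 0 :=
      Finset.sum_nonpos fun j _ =>
        mul_nonpos_of_nonneg_of_nonpos (hv0 j).le (Real.log_nonpos (hx0 n j).le (hle1 n j))
    linarith
  set K : Set (Fin m → ℝ) := stdSimplex ℝ (Fin m) ∩ {y | ∀ i, Real.exp (C / v i) ≤ y i} with hK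
  have hKc : IsCompact K := by
    refine (isCompact_stdSimplex ℝ (Fin m)).inter_right ?_
    simp only [Set.ofPred_forall]
    exact isClosed_iInter fun i => isClosed_le continuous_const (continuous_apply i)
  have hxK : ∀ n, x n ∈ K := fun n => ⟨⟨fun i => (hx0 n i).le, hx1 n⟩, hlow n⟩
  have hKpos : ∀ y ∈ K, ∀ i, 0 < y i := fun y hy i => (Real.exp_pos _).trans_le (hy.2 i)
  have hHc : ContinuousOn (urnH G α v) K := by
    unfold urnH
    refine ContinuousOn.sub (continuousOn_finsetSum _ fun i _ => ?_) continuousOn_const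
    have hci : ∀ i, ContinuousOn (fun y : Fin m → ℝ => y i) K :=
      fun i => (continuous_apply i).continuousOn
    have hcp : ∀ i, ContinuousOn (fun y : Fin m → ℝ => y i ^ α) K :=
      fun i => ((Real.continuous_rpow_const hα0.le).comp (continuous_apply i)).continuousOn
    refine ContinuousOn.mul (continuousOn_const.div (hci i) fun y hy => (hKpos y hy i).ne') ?_
    refine continuousOn_finsetSum _ fun j _ => ?_
    refine (hcp i).div ((hcp i).add (hcp j)) fun y hy => ?_
    have := Real.rpow_pos_of_pos (hKpos y hy i) α
    have := Real.rpow_pos_of_pos (hKpos y hy j) α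
    positivity
  have hVc : ContinuousOn (fun y : Fin m → ℝ => ∑ i, v i * Real.log (y i)) {y | ∀ i, 0 < y i} := by
    refine continuousOn_finsetSum _ fun i _ => continuousOn_const.mul ?_
    exact ContinuousOn.log (continuous_apply i).continuousOn fun y hy => (hy i).ne'
  -- `v` is a cluster point
  have hclus : ∀ U : Set (Fin m → ℝ), IsOpen U → v ∈ U → ∃ᶠ n in atTop, x n ∈ U := by
    intro U hU hvU hcon
    rw [eventually_atTop] at hcon
    obtain ⟨n0, hn0⟩ := hcon
    have hKU : IsCompact (K \ U) := hKc.diff hU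
    obtain ⟨y, hy, hymin⟩ := hKU.exists_isMinOn ⟨x n0, hxK n0, hn0 n0 le_rfl⟩
      (hHc.mono Set.sdiff_subset)
    have hyp : 0 < urnH G α v y :=
      (urnH_pos hconn hα0 hα1 hv0 hmax hv1 (hKpos y hy.1) hy.1.1.2).2
        (fun h => hy.2 (h ▸ hvU))
    apply hT
    have hsum : Summable (fun n => urnH G α v (x (n + n0)) / T (n + n0) / urnH G α v y) :=
      ((summable_nat_add_iff n0).2 ha).div_const _
    rw [← summable_nat_add_iff n0]
    refine Summable.of_nonneg_of_le (fun n => ?_) (fun n => ?_) hsum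
    · have := hT0 (n + n0); positivity
    · have h1 : urnH G α v y ≤ urnH G α v (x (n + n0)) :=
        hymin ⟨hxK _, hn0 _ (by omega)⟩
      have := hT0 (n + n0)
      rw [le_div_iff₀ hyp, div_mul_eq_mul_div, one_mul]
      gcongr
  have hVv : ContinuousAt (fun y : Fin m → ℝ => ∑ i, v i * Real.log (y i)) v := by
    refine hVc.continuousAt (IsOpen.mem_nhds ?_ hv0)
    simp only [Set.ofPred_forall]
    exact isOpen_iInter_of_finite fun i => isOpen_lt continuous_const (continuous_apply i)
  have hl : l = ∑ i, v i * Real.log (v i) := by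
    have hcl : MapClusterPt v atTop x := by
      rw [mapClusterPt_iff_frequently]
      intro s hs
      obtain ⟨U, hUs, hU, hvU⟩ := mem_nhds_iff.1 hs
      exact (hclus U hU hvU).mono fun n hn => hUs hn
    have h2 : MapClusterPt (∑ i, v i * Real.log (v i)) atTop
        (fun n => ∑ i, v i * Real.log (x n i)) :=
      MapClusterPt.continuousAt_comp (f := fun y : Fin m → ℝ => ∑ i, v i * Real.log (y i)) hVv hcl
    obtain ⟨φ, hφ, hφt⟩ := h2.tendsto_subseq
    exact tendsto_nhds_unique (hV.comp hφ.tendsto_atTop) hφt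
  rw [tendsto_def]
  intro s hs
  obtain ⟨U, hUs, hU, hvU⟩ := mem_nhds_iff.1 hs
  suffices ∀ᶠ n in atTop, x n ∈ U from this.mono fun n hn => hUs hn
  rcases Set.eq_empty_or_nonempty (K \ U) with hemp | hne
  · refine Eventually.of_forall fun n => ?_
    by_contra h
    have : x n ∈ K \ U := ⟨hxK n, h⟩
    rw [hemp] at this
    exact this
  obtain ⟨y, hy, hymax⟩ := (hKc.diff hU).exists_isMaxOn hne
    (hVc.mono fun y hy => hKpos y hy.1)
  have hylt := urn_V_lt hv0 hv1 (hKpos y hy.1) hy.1.1.2 (fun h => hy.2 (h ▸ hvU))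
  rw [← hl] at hylt
  filter_upwards [hV.eventually_const_lt hylt] with n hn
  by_contra h
  have : ∑ i, v i * Real.log (x n i) ≤ ∑ i, v i * Real.log (y i) := hymax ⟨hxK n, h⟩
  linarith

lemma urn_not_summable (a N : ℝ) (ha : 0 < a) (hN : 0 ≤ N) :
    ¬ Summable (fun n : ℕ => 1 / (a + n * N)) := by
  intro h
  have h2 := h.mul_left (a + N)
  have h3 : Summable (fun n : ℕ => 1 / ((n + 1 : ℕ) : ℝ)) := by
    refine Summable.of_nonneg_of_le (fun n => by positivity) (fun n => ?_) h2
    push_cast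
    rw [mul_one_div, div_le_div_iff₀ (by positivity) (by positivity)]
    have : (0:ℝ) ≤ n := by positivity
    nlinarith
  exact Real.not_summable_one_div_natCast ((summable_nat_add_iff 1).1 h3)

lemma urn_path (hconn : G.Connected) {α : ℝ} (hα0 : 0 < α) (hα1 : α < 1) {v : Fin m → ℝ}
    (hv0 : ∀ i, 0 < v i)
    (hmax : ∀ x : Fin m → ℝ, (∀ i, 0 ≤ x i) → ∑ i, x i = 1 → urnPhi G α x ≤ urnPhi G α v)
    (hv1 : ∑ i, v i = 1) (b d : ℕ → Fin m → ℝ) (D : ℝ) (T : ℕ → ℝ)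
    (hb0 : ∀ i, 1 ≤ b 0 i) (hd0 : ∀ n i, 0 ≤ d n i) (hdD : ∀ n i, d n i ≤ D)
    (hs : ∀ n i, b (n + 1) i = b n i + d n i)
    (hT1 : 1 ≤ T 0) (hT : ∀ n, T n = T 0 + n * G.edgeFinset.card)
    (hsum : ∀ n, ∑ i, b n i = T n) (M : ℕ → ℝ)
    (hM : ∀ n, M n = ∑ k ∈ Finset.range n,
      ∑ i, v i / b k i * (d k i - ∑ j ∈ G.neighborFinset i, b k i ^ α / (b k i ^ α + b k j ^ α))) :
    (∀ n, M n ≤ D * (1 + D) + G.edgeFinset.card * (1 + G.edgeFinset.card)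
      - ∑ i, v i * Real.log (b 0 i / T 0)) ∧
    ((∃ c, Tendsto M atTop (𝓝 c)) → Tendsto (fun n i => b n i / T n) atTop (𝓝 v)) := by
  set N : ℝ := (G.edgeFinset.card : ℝ) with hN
  have hN0 : 0 ≤ N := Nat.cast_nonneg _
  have hb : ∀ n i, 1 ≤ b n i := by
    intro n i
    induction n with
    | zero => exact hb0 i
    | succ n ih => rw [hs]; linarith [hd0 n i]
  have hTs : ∀ n, T (n + 1) = T n + N := fun n => by rw [hT (n+1), hT n]; push_cast; ring
  have hTpos : ∀ n, 0 < T n := fun n => by 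
    rw [hT n]; have := mul_nonneg (Nat.cast_nonneg (α := ℝ) n) hN0; linarith
  have hx0 : ∀ n i, 0 < b n i / T n := fun n i =>
    div_pos (by linarith [hb n i]) (hTpos n)
  have hx1 : ∀ n, ∑ i, b n i / T n = 1 := fun n => by
    rw [← Finset.sum_div, hsum, div_self (hTpos n).ne']
  set x : ℕ → Fin m → ℝ := fun n i => b n i / T n with hx
  set Y : ℕ → ℝ := fun n => ∑ i, v i * Real.log (x n i) with hY
  set A : ℕ → ℝ := fun n => urnH G α v (x n) / T n with hA
  set e : ℕ → ℝ := fun n => ∑ i, v i * (d n i / b n i - Real.log (1 + d n i / b n i))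
    - (N / T n - Real.log (1 + N / T n)) with he
  set f : ℕ → ℝ := fun n => ∑ i, v i * (d n i / b n i) ^ 2 + (N / T n) ^ 2 with hf
  have hA0 : ∀ n, 0 ≤ A n := fun n =>
    div_nonneg (urnH_pos hconn hα0 hα1 hv0 hmax hv1 (hx0 n) (hx1 n)).1 (hTpos n).le
  have hef : ∀ n, |e n| ≤ f n := by
    intro n
    have h1 := urn_log (div_nonneg hN0 (hTpos n).le)
    have h2 : ∀ i, _ := fun i => urn_log (div_nonneg (hd0 n i) (zero_le_one.trans (hb n i)))
    have h3 : 0 ≤ ∑ i, v i * (d n i / b n i - Real.log (1 + d n i / b n i)) :=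
      Finset.sum_nonneg fun i _ => mul_nonneg (hv0 i).le (h2 i).1
    have h4 : ∑ i, v i * (d n i / b n i - Real.log (1 + d n i / b n i)) ≤
        ∑ i, v i * (d n i / b n i) ^ 2 :=
      Finset.sum_le_sum fun i _ => mul_le_mul_of_nonneg_left (h2 i).2 (hv0 i).le
    rw [abs_le]
    simp only [he, hf]
    constructor <;> linarith [sq_nonneg (N / T n)]
  have hf0 : ∀ n, 0 ≤ f n := fun n => (abs_nonneg _).trans (hef n)
  have hfsum : ∀ n, ∑ k ∈ Finset.range n, f k ≤ D * (1 + D) + N * (1 + N) := by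
    intro n
    simp only [hf]
    rw [Finset.sum_add_distrib, Finset.sum_comm]
    refine add_le_add ?_ ?_
    · calc _ ≤ ∑ i, v i * (D * (1 + D)) := by
            refine Finset.sum_le_sum fun i _ => ?_
            rw [← Finset.mul_sum]
            exact mul_le_mul_of_nonneg_left (urn_errsum (fun n => b n i) (fun n => d n i) D (hb0 i)
              (fun n => hd0 n i) (fun n => hdD n i) (fun n => hs n i) n) (hv0 i).le
        _ = _ := by rw [← Finset.sum_mul, hv1, one_mul]
    · exact urn_errsum T (fun _ => N) N hT1 (fun _ => hN0) (fun _ => le_rfl) hTs n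
  have hstep : ∀ n, Y (n + 1) - Y n = (M (n + 1) - M n) + A n - e n := by
    intro n
    have hM' : M (n + 1) - M n = ∑ i, v i / b n i * (d n i -
        ∑ j ∈ G.neighborFinset i, b n i ^ α / (b n i ^ α + b n j ^ α)) := by
      rw [hM, hM]; simp [Finset.sum_range_succ]
    have hA' : A n = ∑ i, v i / b n i *
        (∑ j ∈ G.neighborFinset i, b n i ^ α / (b n i ^ α + b n j ^ α)) - N / T n := by
      simp only [hA, urnH, sub_div, ← hN]
      congr 1
      rw [Finset.sum_div]
      refine Finset.sum_congr rfl fun i _ => ?_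
      have : ∀ j, x n i ^ α / (x n i ^ α + x n j ^ α) = b n i ^ α / (b n i ^ α + b n j ^ α) := by
        intro j
        have h1 : 0 < T n ^ α := Real.rpow_pos_of_pos (hTpos n) α
        have h2 : 0 < b n i ^ α := Real.rpow_pos_of_pos (by linarith [hb n i]) α
        have h3 : 0 < b n j ^ α := Real.rpow_pos_of_pos (by linarith [hb n j]) α
        simp only [hx]
        rw [Real.div_rpow (by linarith [hb n i]) (hTpos n).le,
          Real.div_rpow (by linarith [hb n j]) (hTpos n).le]
        field_simp
      simp only [this]
      simp only [hx]
      have h1 := hTpos n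
      have h2 : 0 < b n i := by linarith [hb n i]
      field_simp
    have hY' : Y (n + 1) - Y n = ∑ i, v i * Real.log (1 + d n i / b n i)
        - Real.log (1 + N / T n) := by
      have : ∀ i, v i * Real.log (x (n+1) i) - v i * Real.log (x n i) =
          v i * Real.log (1 + d n i / b n i) - v i * Real.log (1 + N / T n) := by
        intro i
        have h1 := hTpos n
        have h1' := hTpos (n + 1)
        have h2 : 0 < b n i := by linarith [hb n i]
        have h2' : 0 < b (n+1) i := by linarith [hb (n+1) i]
        have e1 : 1 + d n i / b n i = b (n+1) i / b n i := by rw [hs]; field_simp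
        have e2 : 1 + N / T n = T (n+1) / T n := by rw [hTs]; field_simp
        rw [e1, e2]
        simp only [hx]
        rw [Real.log_div h2'.ne' h1'.ne', Real.log_div h2.ne' h1.ne', Real.log_div h2'.ne' h2.ne',
          Real.log_div h1'.ne' h1.ne']
        ring
      simp only [hY]
      rw [← Finset.sum_sub_distrib, Finset.sum_congr rfl fun i _ => this i,
        Finset.sum_sub_distrib, ← Finset.sum_mul, hv1, one_mul]
    rw [hM', hA', hY']
    simp only [he, mul_sub, Finset.sum_sub_distrib]
    have : ∑ i, v i / b n i * d n i = ∑ i, v i * (d n i / b n i) :=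
      Finset.sum_congr rfl fun i _ => by ring
    rw [this]; ring
  have hM0 : M 0 = 0 := by rw [hM]; simp
  have htot : ∀ n, Y n - Y 0 = M n + ∑ k ∈ Finset.range n, A k - ∑ k ∈ Finset.range n, e k := by
    intro n
    induction n with
    | zero => simp [hM0]
    | succ n ih =>
      rw [Finset.sum_range_succ, Finset.sum_range_succ]
      linarith [hstep n]
  have hYle : ∀ n, Y n ≤ 0 := fun n => Finset.sum_nonpos fun i _ => by
    refine mul_nonpos_of_nonneg_of_nonpos (hv0 i).le (Real.log_nonpos (hx0 n i).le ?_)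
    rw [← hx1 n]; exact Finset.single_le_sum (fun j _ => (hx0 n j).le) (Finset.mem_univ i)
  have hesum : ∀ n, ∑ k ∈ Finset.range n, e k ≤ D * (1 + D) + N * (1 + N) := fun n =>
    (Finset.sum_le_sum fun k _ => (le_abs_self _).trans (hef k)).trans (hfsum n)
  have hbound : ∀ n, M n + ∑ k ∈ Finset.range n, A k ≤ D * (1 + D) + N * (1 + N) - Y 0 := fun n => by
    linarith [htot n, hYle n, hesum n]
  refine ⟨fun n => ?_, ?_⟩
  · have : 0 ≤ ∑ k ∈ Finset.range n, A k := Finset.sum_nonneg fun k _ => hA0 k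
    have := hbound n
    change M n ≤ _ - Y 0
    linarith
  · rintro ⟨c, hc⟩
    obtain ⟨c', hc'⟩ := hc.bddBelow_range
    have hAs : Summable A := by
      refine summable_of_sum_range_le hA0 (c := D * (1 + D) + N * (1 + N) - Y 0 - c') fun n => ?_
      have : c' ≤ M n := hc' ⟨n, rfl⟩
      linarith [hbound n]
    have hes : Summable e :=
      Summable.of_norm_bounded (summable_of_sum_range_le hf0 hfsum) hef
    have hYlim : Tendsto Y atTop (𝓝 (Y 0 + c + ∑' k, A k - ∑' k, e k)) := by
      have := ((tendsto_const_nhds (x := Y 0)).add hc).add hAs.hasSum.tendsto_sum_nat |>.sub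
        hes.hasSum.tendsto_sum_nat
      refine this.congr fun n => ?_
      linarith [htot n]
    refine urn_det hconn hα0 hα1 hv0 hmax hv1 hx0 hx1 hTpos ?_ hAs hYlim
    have : (fun n => 1 / T n) = fun n : ℕ => 1 / (T 0 + n * N) := by
      funext n; rw [hT n]
    rw [this]
    exact urn_not_summable _ _ (hTpos 0) hN0

lemma urn_mart {Ω : Type*} {mΩ : MeasurableSpace Ω} {μ : Measure Ω} [IsProbabilityMeasure μ]
    (ℱ : Filtration ℕ mΩ) (M : ℕ → Ω → ℝ) (hM : Martingale M ℱ μ) (hM0 : ∀ ω, M 0 ω = 0)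
    (C : ℝ) (hC : ∀ n ω, M n ω ≤ C) :
    ∀ᵐ ω ∂μ, ∃ c, Tendsto (fun n => M n ω) atTop (𝓝 c) := by
  have hint : ∀ n, ∫ ω, M n ω ∂μ = 0 := fun n => by
    have := hM.setIntegral_eq (Nat.zero_le n) (MeasurableSet.univ)
    simp only [setIntegral_univ, hM0, integral_zero] at this
    exact this.symm
  have hb : ∀ n, eLpNorm (M n) 1 μ ≤ (Real.toNNReal (2 * |C|) : ENNReal) := by
    intro n
    have hi := hM.integrable n
    rw [eLpNorm_one_eq_lintegral_enorm, ← ofReal_integral_norm_eq_lintegral_enorm hi]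
    refine ENNReal.ofReal_le_ofReal ?_
    have : ∫ ω, ‖M n ω‖ ∂μ ≤ ∫ ω, (2 * |C| - M n ω) ∂μ := by
      refine integral_mono hi.norm ((integrable_const _).sub hi) fun ω => ?_
      have h1 := hC n ω
      have h2 := le_abs_self C
      have h3 := abs_nonneg C
      simp only [Real.norm_eq_abs]
      rw [abs_le]; constructor <;> linarith
    refine this.trans ?_
    rw [integral_sub (integrable_const _) hi, hint n]
    simp
  filter_upwards [hM.submartingale.ae_tendsto_limitProcess hb] with ω h
  exact ⟨_, h⟩

end aux

section conv

variable {m : ℕ} {G : SimpleGraph (Fin m)} [DecidableRel G.Adj] {α : ℝ}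

lemma urn_B_pos (P : GraphUrn m G α) (n : ℕ) (i : Fin m) (ω : P.Ω) : 1 ≤ P.B n i ω := by
  induction n with
  | zero => exact P.B0_pos i ω
  | succ n ih => rw [P.B_succ]; omega

lemma urn_total (P : GraphUrn m G α) (n : ℕ) (ω : P.Ω) :
    ∑ i, P.B n i ω = (∑ j, P.B 0 j ω) + n * G.edgeFinset.card := by
  induction n with
  | zero => simp
  | succ n ih =>
    simp only [P.B_succ, Finset.sum_add_distrib, ih]
    rw [sum_urnPairs G (fun i j => P.δ (n + 1) i j ω)]
    have h : 2 * ∑ p ∈ urnPairs G, P.δ (n + 1) p.1 p.2 ω = 2 * G.edgeFinset.card := by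
      rw [← card_urnPairs, two_mul]
      nth_rewrite 2 [swap_urnPairs G (fun i j => P.δ (n + 1) i j ω)]
      rw [← Finset.sum_add_distrib, Finset.card_eq_sum_ones]
      refine Finset.sum_congr rfl fun p hp => P.δ_sum _ _ _ ?_ ω
      simpa [urnPairs] using hp
    have : (n + 1) * G.edgeFinset.card = n * G.edgeFinset.card + G.edgeFinset.card := by ring
    omega

lemma urn_conv (hconn : G.Connected) (hα0 : 0 < α) (hα1 : α < 1) {v : Fin m → ℝ}
    (hv0 : ∀ i, 0 < v i)
    (hmax : ∀ x : Fin m → ℝ, (∀ i, 0 ≤ x i) → ∑ i, x i = 1 → urnPhi G α x ≤ urnPhi G α v)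
    (hv1 : ∑ i, v i = 1) (P : GraphUrn m G α) :
    ∀ᵐ ω ∂P.μ, Tendsto (fun n => P.x n ω) atTop (𝓝 v) := by
  let _ := P.mΩ
  have := P.isProb
  obtain ⟨i0⟩ := hconn.nonempty
  -- real-valued versions
  let b : ℕ → Fin m → P.Ω → ℝ := fun n i ω => P.B n i ω
  let δ : ℕ → Fin m → Fin m → P.Ω → ℝ := fun n i j ω => P.δ n i j ω
  let p : ℕ → Fin m → Fin m → P.Ω → ℝ := fun n i j ω =>
    b n i ω ^ α / (b n i ω ^ α + b n j ω ^ α)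
  have hb1 : ∀ n i ω, 1 ≤ b n i ω := fun n i ω => by
    have := urn_B_pos P n i ω
    simp only [b]; exact_mod_cast this
  have hδ0 : ∀ n i j ω, 0 ≤ δ n i j ω := fun n i j ω => Nat.cast_nonneg _
  have hδ1 : ∀ n i j ω, G.Adj i j → δ n i j ω ≤ 1 := fun n i j ω h => by
    have := P.δ_sum n i j h ω
    have : P.δ n i j ω ≤ 1 := by omega
    simp only [δ]; exact_mod_cast this
  have hp0 : ∀ n i j ω, 0 ≤ p n i j ω := fun n i j ω => by
    have := hb1 n i ω; have := hb1 n j ω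
    simp only [p]; positivity
  have hp1 : ∀ n i j ω, p n i j ω ≤ 1 := fun n i j ω => by
    have h1 := Real.rpow_pos_of_pos (zero_lt_one.trans_le (hb1 n i ω)) α
    have h2 := Real.rpow_pos_of_pos (zero_lt_one.trans_le (hb1 n j ω)) α
    simp only [p]; rw [div_le_one (by positivity)]; linarith
  have hbm : ∀ n i, Measurable[P.ℱ n] (b n i) := fun n i =>
    (measurable_from_top (f := fun k : ℕ => (k : ℝ))).comp (P.B_adapted n i)
  have hδm : ∀ n i j, Measurable[P.ℱ n] (δ n i j) := fun n i j =>
    (measurable_from_top (f := fun k : ℕ => (k : ℝ))).comp (P.δ_adapted n i j)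
  have hpm : ∀ n i j, Measurable[P.ℱ n] (p n i j) := fun n i j =>
    ((hbm n i).pow_const α).div (((hbm n i).pow_const α).add ((hbm n j).pow_const α))
  -- the martingale increments
  let E : ℕ → Fin m → Fin m → P.Ω → ℝ := fun n i j =>
    (fun ω => v i / b n i ω) * (fun ω => δ (n + 1) i j ω - p n i j ω)
  have hwm : ∀ n i, Measurable[P.ℱ n] (fun ω => v i / b n i ω) := fun n i =>
    measurable_const.div (hbm n i)
  have hgm : ∀ n i j, Measurable[P.ℱ (n + 1)] (fun ω => δ (n + 1) i j ω - p n i j ω) := fun n i j =>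
    (hδm (n + 1) i j).sub ((hpm n i j).mono (P.ℱ.mono (Nat.le_succ n)) le_rfl)
  have hEm : ∀ n i j, Measurable[P.ℱ (n + 1)] (E n i j) := fun n i j =>
    ((hwm n i).mono (P.ℱ.mono (Nat.le_succ n)) le_rfl).mul (hgm n i j)
  have hgb : ∀ n i j ω, G.Adj i j → |δ (n + 1) i j ω - p n i j ω| ≤ 1 := fun n i j ω h => by
    rw [abs_le]
    have h1 := hδ0 (n + 1) i j ω
    have h2 := hδ1 (n + 1) i j ω h
    have h3 := hp0 n i j ω
    have h4 := hp1 n i j ω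
    constructor <;> linarith
  have hgi : ∀ n i j, G.Adj i j → Integrable (fun ω => δ (n + 1) i j ω - p n i j ω) P.μ :=
    fun n i j h => Integrable.of_bound
      ((hgm n i j).mono (P.ℱ.le _) le_rfl).aestronglyMeasurable 1
      (Eventually.of_forall fun ω => hgb n i j ω h)
  have hpi : ∀ n i j, Integrable (p n i j) P.μ :=
    fun n i j => Integrable.of_bound
      ((hpm n i j).mono (P.ℱ.le _) le_rfl).aestronglyMeasurable 1
      (Eventually.of_forall fun ω => by
        rw [Real.norm_eq_abs, abs_of_nonneg (hp0 n i j ω)]; exact hp1 n i j ω)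
  have hδi : ∀ n i j, G.Adj i j → Integrable (δ n i j) P.μ :=
    fun n i j h => Integrable.of_bound
      ((hδm n i j).mono (P.ℱ.le _) le_rfl).aestronglyMeasurable 1
      (Eventually.of_forall fun ω => by
        rw [Real.norm_eq_abs, abs_of_nonneg (hδ0 n i j ω)]; exact hδ1 n i j ω h)
  have hEi : ∀ n i j, G.Adj i j → Integrable (E n i j) P.μ := fun n i j h => by
    refine Integrable.of_bound ((hEm n i j).mono (P.ℱ.le _) le_rfl).aestronglyMeasurable (v i)
      (Eventually.of_forall fun ω => ?_)
    simp only [E, Pi.mul_apply, norm_mul, Real.norm_eq_abs]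
    have h1 := hgb n i j ω h
    have h2 : |v i / b n i ω| ≤ v i := by
      rw [abs_of_nonneg (div_nonneg (hv0 i).le (zero_le_one.trans (hb1 n i ω)))]
      exact div_le_self (hv0 i).le (hb1 n i ω)
    calc _ ≤ v i * 1 := mul_le_mul h2 h1 (abs_nonneg _) (hv0 i).le
      _ = v i := mul_one _
  have hEc : ∀ n i j, G.Adj i j → P.μ[E n i j | P.ℱ n] =ᵐ[P.μ] 0 := fun n i j h => by
    have h1 := condExp_mul_of_stronglyMeasurable_left (hwm n i).stronglyMeasurable
      (hEi n i j h) (hgi n i j h)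
    have h2 : P.μ[fun ω => δ (n + 1) i j ω - p n i j ω | P.ℱ n] =ᵐ[P.μ]
        P.μ[δ (n + 1) i j | P.ℱ n] - P.μ[p n i j | P.ℱ n] :=
      condExp_sub (hδi (n + 1) i j h) (hpi n i j) (P.ℱ n)
    have h3 : P.μ[p n i j | P.ℱ n] = p n i j :=
      condExp_of_stronglyMeasurable (P.ℱ.le n) (hpm n i j).stronglyMeasurable (hpi n i j)
    have h4 : P.μ[δ (n + 1) i j | P.ℱ n] =ᵐ[P.μ] p n i j := P.cond_law n i j h
    filter_upwards [h1, h2, h4] with ω e1 e2 e4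
    change (P.μ[E n i j | P.ℱ n]) ω = 0
    rw [e1, Pi.mul_apply, e2, Pi.sub_apply, h3, e4, sub_self, mul_zero]
  let I : ℕ → P.Ω → ℝ := fun n => ∑ q ∈ urnPairs G, E n q.1 q.2
  have hadj : ∀ q ∈ urnPairs G, G.Adj q.1 q.2 := fun q hq => by simpa [urnPairs] using hq
  have hIm : ∀ n, Measurable[P.ℱ (n + 1)] (I n) := fun n => by
    have e : I n = fun ω => ∑ q ∈ urnPairs G, E n q.1 q.2 ω := by
      funext ω; simp [I]
    rw [e]
    exact Finset.measurable_sum (urnPairs G) fun q _ => hEm n q.1 q.2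
  have hIi : ∀ n, Integrable (I n) P.μ := fun n =>
    integrable_finsetSum' (f := fun q => E n q.1 q.2) (urnPairs G) fun q hq => hEi n q.1 q.2 (hadj q hq)
  have hIc : ∀ n, P.μ[I n | P.ℱ n] =ᵐ[P.μ] 0 := fun n => by
    refine (condExp_finsetSum (s := urnPairs G) (f := fun q => E n q.1 q.2)
      (fun q hq => hEi n q.1 q.2 (hadj q hq)) (P.ℱ n)).trans ?_
    have : ∀ᵐ ω ∂P.μ, ∀ q ∈ urnPairs G, (P.μ[E n q.1 q.2 | P.ℱ n]) ω = 0 :=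
      (Finset.eventually_all _).2 fun q hq => hEc n q.1 q.2 (hadj q hq)
    filter_upwards [this] with ω hω
    rw [Finset.sum_apply]
    exact Finset.sum_eq_zero hω
  let M : ℕ → P.Ω → ℝ := fun n => ∑ k ∈ Finset.range n, I k
  have hM : Martingale M P.ℱ P.μ := by
    refine martingale_of_condExp_sub_eq_zero_nat (fun n => ?_) (fun n => ?_) (fun n => ?_)
    · have e : M n = fun ω => ∑ k ∈ Finset.range n, I k ω := by
        funext ω; simp [M]
      rw [e]
      refine Measurable.stronglyMeasurable (Finset.measurable_sum _ fun k hk => ?_)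
      exact (hIm k).mono (P.ℱ.mono (Finset.mem_range.1 hk)) le_rfl
    · exact integrable_finsetSum' _ fun k _ => hIi k
    · have : M (n + 1) - M n = I n := by simp [M, Finset.sum_range_succ]
      rw [this]; exact hIc n
  let d : ℕ → Fin m → P.Ω → ℝ := fun n i ω => ∑ j ∈ G.neighborFinset i, δ (n + 1) i j ω
  let T : ℕ → P.Ω → ℝ := fun n ω => (((∑ j, P.B 0 j ω) + n * G.edgeFinset.card : ℕ) : ℝ)
  have hMω : ∀ ω n, M n ω = ∑ k ∈ Finset.range n, ∑ i, v i / b k i ω *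
      (d k i ω - ∑ j ∈ G.neighborFinset i, b k i ω ^ α / (b k i ω ^ α + b k j ω ^ α)) := by
    intro ω n
    simp only [M, I, Finset.sum_apply]
    refine Finset.sum_congr rfl fun k _ => ?_
    rw [← sum_urnPairs G (fun i j => E k i j ω)]
    refine Finset.sum_congr rfl fun i _ => ?_
    simp only [d, ← Finset.sum_sub_distrib, Finset.mul_sum]
    rfl
  have key := fun ω => urn_path hconn hα0 hα1 hv0 hmax hv1 (fun n i => b n i ω)
    (fun n i => d n i ω) (m : ℝ) (fun n => T n ω) (fun i => hb1 0 i ω)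
    (fun n i => Finset.sum_nonneg fun j _ => hδ0 _ _ _ _)
    (fun n i => by
      calc d n i ω ≤ ∑ j ∈ G.neighborFinset i, (1 : ℝ) :=
            Finset.sum_le_sum fun j hj => hδ1 _ _ _ _ (by simpa using hj)
        _ ≤ m := by
          simp only [Finset.sum_const, nsmul_eq_mul, mul_one]
          have := Finset.card_le_univ (G.neighborFinset i)
          rw [Fintype.card_fin] at this
          exact_mod_cast this)
    (fun n i => by simp only [b, d, δ, P.B_succ]; push_cast; rfl)
    (by
      have h1 := P.B0_pos i0 ω
      have h2 := Finset.single_le_sum (f := fun j => P.B 0 j ω) (fun j _ => Nat.zero_le _)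
        (Finset.mem_univ i0)
      have : 1 ≤ ∑ j, P.B 0 j ω := h1.trans h2
      simp only [T, zero_mul, add_zero]
      exact_mod_cast this)
    (fun n => by simp [T])
    (fun n => by simp only [b, T, ← urn_total P n ω]; push_cast; rfl)
    (fun n => M n ω) (hMω ω)
  obtain ⟨C, hC⟩ : ∃ C, ∀ n ω, M n ω ≤ C := by
    rcases isEmpty_or_nonempty P.Ω with h | ⟨⟨ω0⟩⟩
    · exact ⟨0, fun n ω => h.elim ω⟩
    · refine ⟨(m : ℝ) * (1 + m) + G.edgeFinset.card * (1 + G.edgeFinset.card)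
          - ∑ i, v i * Real.log (b 0 i ω0 / T 0 ω0), fun n ω => ((key ω).1 n).trans_eq ?_⟩
      · have : ∀ i, P.B 0 i ω = P.B 0 i ω0 := fun i => P.B0_det i ω ω0
        simp only [b, T, this]
  filter_upwards [urn_mart P.ℱ M hM (fun ω => by simp [M]) C hC] with ω hω
  exact (key ω).2 hω

end conv

/-- **Theorem 4.** For a finite connected graph `G` and `0 < α < 1`, there is a point
`v = v(G, α)` with strictly positive entries, lying in the simplex, such that `x(n)`
converges to `v` almost surely. -/
theorem polya_urn_alpha_lt_one_converges
    {m : ℕ} {G : SimpleGraph (Fin m)} [DecidableRel G.Adj] {α : ℝ}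
    (hconn : G.Connected) (hα0 : 0 < α) (hα1 : α < 1) :
    ∃ v : Fin m → ℝ, (∀ i, 0 < v i) ∧ (∑ i, v i) = 1 ∧
      ∀ P : GraphUrn m G α, ∀ᵐ ω ∂P.μ, Tendsto (fun n => P.x n ω) atTop (𝓝 v) := by
  obtain ⟨v, hv0, hv1, hmax⟩ := urn_exists_v hconn hα0 hα1
  exact ⟨v, hv0, hv1, fun P => urn_conv hconn hα0 hα1 hv0 hmax hv1 P⟩
end

section
/- Let G be the star graph with m ≥ 3 vertices, where vertices 1,…,m-1 are leaves each adjacent only to the center vertex m, and let 0 < α ≤ 1. Then x(n) converges almost surely to the point whose first m-1 coordinates all equal 1/(m-1+(m-1)^{1/(1-α)}) and whose last coordinate equals (m-1)^{1/(1-α)}/(m-1+(m-1)^{1/(1-α)}) (for α = 1 this point is interpreted as (0,…,0,1), the limit as α ↑ 1). -/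
open MeasureTheory Filter Topology

open MeasureTheory Filter Topology

/-- Pathwise comparison of `log B` with the sum of relative increments. -/
lemma urn_log_sum (B D : ℕ → ℝ) (d : ℝ) (hB0 : 1 ≤ B 0) (hB : ∀ n, B (n + 1) = B n + D n)
    (hD0 : ∀ n, 0 ≤ D n) (hDd : ∀ n, D n ≤ d) :
    (∀ n, 1 ≤ B n) ∧ (∀ n, ∑ s ∈ Finset.range n, (D s / B s) ^ 2 ≤ d * (d + 1)) ∧
    ∃ w, Tendsto (fun n => Real.log (B n) - ∑ s ∈ Finset.range n, D s / B s) atTop (𝓝 w) := by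
  have h1 : ∀ n, 1 ≤ B n := by
    intro n
    induction n with
    | zero => exact hB0
    | succ n ih => rw [hB]; linarith [hD0 n]
  have hd : 0 ≤ d := (hD0 0).trans (hDd 0)
  have hsq : ∀ s, (D s / B s) ^ 2 ≤ d * (d + 1) * (1 / B s - 1 / B (s + 1)) := by
    intro s
    have hb := h1 s
    have hb' := h1 (s + 1)
    have e : 1 / B s - 1 / B (s + 1) = D s / (B s * B (s + 1)) := by
      have := hB s
      field_simp
      linarith
    rw [e, div_pow, ← mul_div_assoc, div_le_div_iff₀ (by positivity) (by positivity)]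
    have hle : B (s + 1) ≤ (d + 1) * B s := by
      rw [hB]; nlinarith [hDd s]
    have := hD0 s
    have := hDd s
    calc D s ^ 2 * (B s * B (s + 1)) ≤ (d * D s) * (B s * ((d + 1) * B s)) := by
          gcongr
          nlinarith
      _ = d * (d + 1) * D s * B s ^ 2 := by ring
  have hsum : ∀ n, ∑ s ∈ Finset.range n, (D s / B s) ^ 2 ≤ d * (d + 1) := by
    intro n
    have h2 : ∑ s ∈ Finset.range n, (D s / B s) ^ 2 ≤
        d * (d + 1) * (1 / B 0 - 1 / B n) := by
      rw [← Finset.sum_range_sub' (fun s => 1 / B s), Finset.mul_sum]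
      exact Finset.sum_le_sum fun s _ => hsq s
    have h3 : 1 / B 0 ≤ 1 := by
      rw [div_le_one (by linarith)]; exact hB0
    have h4 : 0 ≤ 1 / B n := by have := h1 n; positivity
    have h5 : 0 ≤ d * (d + 1) := by positivity
    nlinarith
  refine ⟨h1, hsum, ?_⟩
  have hstep : ∀ n, D n / B n - (D n / B n) ^ 2 ≤ Real.log (B (n + 1)) - Real.log (B n) ∧
      Real.log (B (n + 1)) - Real.log (B n) ≤ D n / B n := by
    intro n
    have hb := h1 n
    have hb' := h1 (n + 1)
    have hx : 0 ≤ D n / B n := div_nonneg (hD0 n) (by linarith)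
    have e : Real.log (B (n + 1)) - Real.log (B n) = Real.log (1 + D n / B n) := by
      rw [← Real.log_div (by linarith) (by linarith), hB]
      congr 1
      field_simp
    rw [e]
    constructor
    · have := Real.one_sub_inv_le_log_of_pos (show 0 < 1 + D n / B n by linarith)
      refine le_trans ?_ this
      generalize D n / B n = x at *
      have : 1 - (1 + x)⁻¹ = x / (1 + x) := by field_simp; ring
      rw [this, le_div_iff₀ (by linarith)]
      nlinarith [pow_nonneg hx 3]
    · have := Real.log_le_sub_one_of_pos (show 0 < 1 + D n / B n by linarith)
      linarith
  have hanti : Antitone (fun n => Real.log (B n) - ∑ s ∈ Finset.range n, D s / B s) := by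
    refine antitone_nat_of_succ_le fun n => ?_
    rw [Finset.sum_range_succ]
    linarith [(hstep n).2]
  have hbdd : BddBelow (Set.range
      (fun n => Real.log (B n) - ∑ s ∈ Finset.range n, D s / B s)) := by
    refine ⟨Real.log (B 0) - d * (d + 1), ?_⟩
    rintro _ ⟨n, rfl⟩
    have : Real.log (B 0) - ∑ s ∈ Finset.range n, (D s / B s) ^ 2 ≤
        Real.log (B n) - ∑ s ∈ Finset.range n, D s / B s := by
      induction n with
      | zero => simp
      | succ n ih =>
        rw [Finset.sum_range_succ, Finset.sum_range_succ]
        linarith [(hstep n).1]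
    simp only
    linarith [hsum n]
  exact ⟨_, tendsto_atTop_ciInf hanti hbdd⟩

/-- Drift lemma: a sequence with convergent noise and positive drift below the level `Y`
is eventually above `Y - ε`. -/
lemma urn_drift (y f a b : ℕ → ℝ) (w Y ε : ℝ) (hε : 0 < ε)
    (hw : Tendsto (fun n => y n - ∑ s ∈ Finset.range n, f s) atTop (𝓝 w))
    (ha : Tendsto a atTop (𝓝 0)) (hfa : ∀ᶠ n in atTop, -a n ≤ f n)
    (hb : Tendsto (fun n => ∑ s ∈ Finset.range n, b s) atTop atTop) (hb0 : ∀ n, 0 ≤ b n)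
    (hfb : ∀ᶠ n in atTop, y n < Y → b n ≤ f n) :
    ∀ᶠ n in atTop, Y - ε ≤ y n := by
  set r : ℕ → ℝ := fun n => ∑ s ∈ Finset.range n, f s + w with hr
  have hrs : ∀ n, r (n + 1) = r n + f n := by
    intro n; simp only [hr, Finset.sum_range_succ]; ring
  have hclose : ∀ᶠ n in atTop, |y n - r n| < ε / 3 := by
    have := (Metric.tendsto_nhds.1 hw) (ε / 3) (by positivity)
    filter_upwards [this] with n hn
    rw [Real.dist_eq] at hn
    convert hn using 2
    simp only [hr]; ring
  have hasmall : ∀ᶠ n in atTop, a n < ε / 3 := ha.eventually_lt_const (by positivity)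
  obtain ⟨N, hN⟩ := eventually_atTop.1 (hclose.and (hasmall.and (hfa.and hfb)))
  have hup : ∀ n ≥ N, r n < Y - ε / 3 → r n + b n ≤ r (n + 1) := by
    intro n hn hlt
    obtain ⟨h1, h2, h3, h4⟩ := hN n hn
    rw [hrs]
    have := h4 (by linarith [(abs_lt.1 h1).2])
    linarith
  have hex : ∃ n1 ≥ N, Y - ε / 3 ≤ r n1 := by
    by_contra! hcon
    have hgrow : ∀ n ≥ N, r N + (∑ s ∈ Finset.range n, b s - ∑ s ∈ Finset.range N, b s) ≤ r n := by
      intro n hn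
      induction n, hn using Nat.le_induction with
      | base => simp
      | succ n hn ih =>
        rw [Finset.sum_range_succ]
        linarith [hup n hn (hcon n hn)]
    obtain ⟨n, hn1, hn2⟩ := ((hb.eventually_ge_atTop
      (Y - r N + ∑ s ∈ Finset.range N, b s)).and (eventually_ge_atTop N)).exists
    linarith [hgrow n hn2, hcon n hn2]
  obtain ⟨n1, hn1, hrn1⟩ := hex
  have hstay : ∀ n ≥ n1, Y - 2 * ε / 3 ≤ r n := by
    intro n hn
    induction n, hn using Nat.le_induction with
    | base => linarith
    | succ n hn ih =>
      by_cases h : r n < Y - ε / 3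
      · linarith [hup n (hn1.trans hn) h, hb0 n]
      · obtain ⟨h1, h2, h3, h4⟩ := hN n (hn1.trans hn)
        rw [hrs]
        push Not at h
        linarith
  filter_upwards [eventually_ge_atTop n1, hclose] with n hn hc
  linarith [hstay n hn, (abs_lt.1 hc).1]

/-- Convergence of a martingale with bounded increments and bounded quadratic variation. -/
lemma urn_martingale {Ω : Type} {mΩ : MeasurableSpace Ω} (μ : Measure Ω) [IsProbabilityMeasure μ]
    (ℱ : Filtration ℕ mΩ) (Y Z : ℕ → Ω → ℝ) (d R : ℝ)
    (hY : ∀ n, Measurable[ℱ (n + 1)] (Y n)) (hZ : ∀ n, Measurable[ℱ n] (Z n))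
    (hYd : ∀ n ω, |Y n ω| ≤ d) (hZd : ∀ n ω, |Z n ω| ≤ d)
    (hc : ∀ n, μ[Y n | ℱ n] =ᵐ[μ] Z n)
    (hR : ∀ n ω, ∑ s ∈ Finset.range n, (Y s ω) ^ 2 ≤ R) :
    ∀ᵐ ω ∂μ, ∃ w, Tendsto (fun n => ∑ s ∈ Finset.range n, (Y s ω - Z s ω)) atTop (𝓝 w) := by
  set M : ℕ → Ω → ℝ := fun n ω => ∑ s ∈ Finset.range n, (Y s ω - Z s ω) with hM
  have hMm : ∀ n, Measurable[ℱ n] (M n) := by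
    intro n
    simp only [hM]
    refine Finset.measurable_sum _ fun s hs => ?_
    have hs' : s + 1 ≤ n := Finset.mem_range.1 hs
    exact ((hY s).mono (ℱ.mono hs') le_rfl).sub
      ((hZ s).mono (ℱ.mono (by omega)) le_rfl)
  have hMb : ∀ n ω, |M n ω| ≤ n * (2 * d) := by
    intro n ω
    calc |M n ω| ≤ ∑ s ∈ Finset.range n, |Y s ω - Z s ω| := Finset.abs_sum_le_sum_abs _ _
      _ ≤ ∑ s ∈ Finset.range n, (2 * d) := by
          refine Finset.sum_le_sum fun s _ => ?_
          have := abs_sub (Y s ω) (Z s ω)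
          linarith [hYd s ω, hZd s ω]
      _ = n * (2 * d) := by simp
  have hbint : ∀ (f : Ω → ℝ) (c : ℝ), Measurable f → (∀ ω, |f ω| ≤ c) → Integrable f μ := by
    intro f c hf hfc
    exact Integrable.of_bound hf.aestronglyMeasurable c (Eventually.of_forall hfc)
  have hMm' : ∀ n, Measurable (M n) := fun n => (hMm n).mono (ℱ.le n) le_rfl
  have hYm' : ∀ n, Measurable (Y n) := fun n => (hY n).mono (ℱ.le _) le_rfl
  have hZm' : ∀ n, Measurable (Z n) := fun n => (hZ n).mono (ℱ.le _) le_rfl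
  have hMi : ∀ n, Integrable (M n) μ := fun n => hbint _ _ (hMm' n) (hMb n)
  have hYi : ∀ n, Integrable (Y n) μ := fun n => hbint _ _ (hYm' n) (hYd n)
  have hZi : ∀ n, Integrable (Z n) μ := fun n => hbint _ _ (hZm' n) (hZd n)
  have hMs : ∀ n ω, M (n + 1) ω = M n ω + (Y n ω - Z n ω) := by
    intro n ω; simp only [hM, Finset.sum_range_succ]
  have hmart : Martingale M ℱ μ := by
    refine martingale_of_condExp_sub_eq_zero_nat (fun n => (hMm n).stronglyMeasurable) hMi ?_
    intro n
    have e : M (n + 1) - M n = Y n - Z n := by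
      ext ω; simp [hMs]
    rw [e]
    filter_upwards [condExp_sub (hYi n) (hZi n) (ℱ n), hc n] with ω h1 h2
    rw [h1, Pi.sub_apply, h2, condExp_of_stronglyMeasurable (ℱ.le n) (hZ n).stronglyMeasurable (hZi n)]
    simp
  have hcross : ∀ n, ∫ ω, (M n ω - Z n ω) * Y n ω ∂μ = ∫ ω, (M n ω - Z n ω) * Z n ω ∂μ := by
    intro n
    have hsm : StronglyMeasurable[ℱ n] (fun ω => M n ω - Z n ω) :=
      ((hMm n).sub (hZ n)).stronglyMeasurable
    have h1 := condExp_stronglyMeasurable_mul_of_bound (ℱ.le n) hsm (hYi n) (n * (2 * d) + d)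
      (Eventually.of_forall fun ω => by
        have := abs_sub (M n ω) (Z n ω)
        rw [Real.norm_eq_abs]
        linarith [hMb n ω, hZd n ω])
    have h2 := integral_condExp (μ := μ) (ℱ.le n) (f := (fun ω => M n ω - Z n ω) * Y n)
    have h3 : ∫ ω, (μ[(fun ω => M n ω - Z n ω) * Y n | ℱ n]) ω ∂μ =
        ∫ ω, (M n ω - Z n ω) * Z n ω ∂μ := by
      refine integral_congr_ae ?_
      filter_upwards [h1, hc n] with ω h1 h2
      rw [h1, Pi.mul_apply, h2]
    rw [← h3, h2]
    rfl
  have hprodint : ∀ (f g : Ω → ℝ) (c e : ℝ), Measurable f → Measurable g → (∀ ω, |f ω| ≤ c) →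
      (∀ ω, |g ω| ≤ e) → Integrable (fun ω => f ω * g ω) μ := by
    intro f g c e hf hg hfc hge
    refine hbint _ (c * e) (hf.mul hg) fun ω => ?_
    rw [abs_mul]
    exact mul_le_mul (hfc ω) (hge ω) (abs_nonneg _) ((abs_nonneg _).trans (hfc ω))
  have hY2 : ∀ n, Integrable (fun ω => Y n ω ^ 2) μ := by
    intro n
    simp_rw [sq]
    exact hprodint _ _ _ _ (hYm' n) (hYm' n) (hYd n) (hYd n)
  have hM2 : ∀ n, Integrable (fun ω => M n ω ^ 2) μ := by
    intro n
    simp_rw [sq]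
    exact hprodint _ _ _ _ (hMm' n) (hMm' n) (hMb n) (hMb n)
  have hZ2 : ∀ n, Integrable (fun ω => Z n ω ^ 2) μ := by
    intro n
    simp_rw [sq]
    exact hprodint _ _ _ _ (hZm' n) (hZm' n) (hZd n) (hZd n)
  have hMZ : ∀ n ω, |M n ω - Z n ω| ≤ n * (2 * d) + d := by
    intro n ω
    have := abs_sub (M n ω) (Z n ω)
    linarith [hMb n ω, hZd n ω]
  have hL2 : ∀ n, ∫ ω, M n ω ^ 2 ∂μ ≤ ∫ ω, ∑ s ∈ Finset.range n, (Y s ω) ^ 2 ∂μ := by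
    intro n
    induction n with
    | zero => simp [hM]
    | succ n ih =>
      have i1 := hprodint _ _ _ _ ((hMm' n).sub (hZm' n)) (hYm' n) (hMZ n) (hYd n)
      have i2 := hprodint _ _ _ _ ((hMm' n).sub (hZm' n)) (hZm' n) (hMZ n) (hZd n)
      simp only [Pi.sub_apply] at i1 i2
      have e1 : ∀ ω, M (n + 1) ω ^ 2 = (M n ω ^ 2 - Z n ω ^ 2 + Y n ω ^ 2) +
          2 * ((M n ω - Z n ω) * Y n ω - (M n ω - Z n ω) * Z n ω) := by
        intro ω; rw [hMs]; ring
      simp_rw [e1, Finset.sum_range_succ]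
      have i3 : Integrable (fun ω => M n ω ^ 2 - Z n ω ^ 2) μ := (hM2 n).sub (hZ2 n)
      have i4 : Integrable (fun ω => M n ω ^ 2 - Z n ω ^ 2 + Y n ω ^ 2) μ := i3.add (hY2 n)
      have i5 : Integrable (fun ω => 2 * ((M n ω - Z n ω) * Y n ω -
          (M n ω - Z n ω) * Z n ω)) μ := (i1.sub i2).const_mul 2
      rw [integral_add i4 i5, integral_const_mul, integral_sub i1 i2, hcross,
        integral_add i3 (hY2 n), integral_sub (hM2 n) (hZ2 n),
        integral_add (integrable_finsetSum _ fun s _ => hY2 s) (hY2 n)]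
      have : 0 ≤ ∫ ω, Z n ω ^ 2 ∂μ := integral_nonneg fun ω => sq_nonneg _
      linarith
  have hL1 : ∀ n, ∫ ω, |M n ω| ∂μ ≤ R + 1 := by
    intro n
    have h1 : ∫ ω, |M n ω| ∂μ ≤ ∫ ω, (M n ω ^ 2 + 1) ∂μ := by
      refine integral_mono (hMi n).abs ((hM2 n).add (integrable_const 1)) fun ω => ?_
      simp only
      nlinarith [sq_abs (M n ω), sq_nonneg (|M n ω| - 1)]
    have h2 : ∫ ω, ∑ s ∈ Finset.range n, (Y s ω) ^ 2 ∂μ ≤ ∫ ω, R ∂μ :=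
      integral_mono (integrable_finsetSum _ fun s _ => hY2 s) (integrable_const R) (hR n)
    rw [integral_add (hM2 n) (integrable_const 1)] at h1
    simp at h1 h2
    linarith [hL2 n]
  refine hmart.submartingale.exists_ae_tendsto_of_bdd (R := (R + 1).toNNReal) fun n => ?_
  rw [eLpNorm_one_eq_lintegral_enorm, ← ofReal_integral_norm_eq_lintegral_enorm (hMi n)]
  exact ENNReal.ofReal_le_ofReal (hL1 n)

/-- The function governing the relative drift of the proportions. -/
noncomputable def urnQ (α x c : ℝ) : ℝ := x + x ^ (1 - α) * c ^ α

lemma urnQ_pos {α x c : ℝ} (hx : 0 < x) (hc : 0 ≤ c) : 0 < urnQ α x c := by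
  unfold urnQ
  have h1 : 0 ≤ x ^ (1 - α) := Real.rpow_nonneg hx.le _
  have h2 : 0 ≤ c ^ α := Real.rpow_nonneg hc _
  positivity

lemma urnQ_mono {α x c x' c' : ℝ} (hα0 : 0 < α) (hα1 : α ≤ 1) (hx : 0 ≤ x) (hxx : x ≤ x')
    (hc : 0 ≤ c) (hcc : c ≤ c') : urnQ α x c ≤ urnQ α x' c' := by
  unfold urnQ
  have h1 : x ^ (1 - α) ≤ x' ^ (1 - α) := Real.rpow_le_rpow hx hxx (by linarith)
  have h2 : c ^ α ≤ c' ^ α := Real.rpow_le_rpow hc hcc hα0.le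
  have h3 : 0 ≤ c ^ α := Real.rpow_nonneg hc _
  have h4 : 0 ≤ x' ^ (1 - α) := Real.rpow_nonneg (hx.trans hxx) _
  have := mul_le_mul h1 h2 h3 h4
  linarith

lemma urnQ_strict {α x x' c : ℝ} (hα1 : α ≤ 1) (hx : 0 ≤ x) (hxx : x < x')
    (hc : 0 ≤ c) : urnQ α x c < urnQ α x' c := by
  unfold urnQ
  have h1 : x ^ (1 - α) ≤ x' ^ (1 - α) := Real.rpow_le_rpow hx hxx.le (by linarith)
  have h3 : 0 ≤ c ^ α := Real.rpow_nonneg hc _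
  have := mul_le_mul_of_nonneg_right h1 h3
  linarith

lemma urnQ_contc {α x c : ℝ} (hα0 : 0 < α) : ContinuousAt (fun c => urnQ α x c) c := by
  unfold urnQ
  exact continuousAt_const.add (continuousAt_const.mul
    (Real.continuousAt_rpow_const _ _ (Or.inr hα0.le)))

lemma urnQ_contx {α x c : ℝ} (hα1 : α ≤ 1) : ContinuousAt (fun x => urnQ α x c) x := by
  unfold urnQ
  exact continuousAt_id.add
    ((Real.continuousAt_rpow_const _ _ (Or.inr (by linarith))).mul continuousAt_const)

/-- The pathwise data of the urn on a star graph used in the deterministic analysis. -/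
structure UrnPath (ι : Type) [Fintype ι] (α k T0 : ℝ) (x : ι → ℕ → ℝ) (c T : ℕ → ℝ) : Prop where
  hα0 : 0 < α
  hα1 : α ≤ 1
  hk : 2 ≤ k
  hcard : (Fintype.card ι : ℝ) = k
  hT0 : 1 ≤ T0
  hT : ∀ n : ℕ, T n = T0 + n * k
  hsum : ∀ n, c n + ∑ i, x i n = 1
  hTx : ∀ i n, 1 ≤ T n * x i n
  hTc : ∀ n, 1 ≤ T n * c n
  hxle : ∀ i n, T n * x i n ≤ n + T0
  hlx : ∀ i, ∃ w, Tendsto (fun n => Real.log (x i n) -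
    ∑ s ∈ Finset.range n, (1 / urnQ α (x i s) (c s) - k) / T s) atTop (𝓝 w)
  hlc : ∃ w, Tendsto (fun n => Real.log (c n) -
    ∑ s ∈ Finset.range n, (∑ i, 1 / urnQ α (c s) (x i s) - k) / T s) atTop (𝓝 w)

namespace UrnPath

variable {ι : Type} [Fintype ι] {α k T0 : ℝ} {x : ι → ℕ → ℝ} {c T : ℕ → ℝ}

lemma Tpos (h : UrnPath ι α k T0 x c T) (n : ℕ) : 0 < T n := by
  have := h.hT0
  have := h.hk
  rw [h.hT]; positivity

lemma xpos (h : UrnPath ι α k T0 x c T) (i : ι) (n : ℕ) : 0 < x i n := by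
  have := h.hTx i n
  exact pos_of_mul_pos_right (by linarith) (h.Tpos n).le

lemma cpos (h : UrnPath ι α k T0 x c T) (n : ℕ) : 0 < c n := by
  have := h.hTc n
  exact pos_of_mul_pos_right (by linarith) (h.Tpos n).le

lemma cle (h : UrnPath ι α k T0 x c T) (n : ℕ) : c n ≤ 1 := by
  have := h.hsum n
  have : 0 ≤ ∑ i, x i n := Finset.sum_nonneg fun i _ => (h.xpos i n).le
  linarith

lemma T_atTop (h : UrnPath ι α k T0 x c T) : Tendsto T atTop atTop := by
  have : T = fun n : ℕ => T0 + n * k := funext h.hT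
  rw [this]
  have hk := h.hk
  exact tendsto_atTop_add_const_left _ _
    (tendsto_natCast_atTop_atTop.atTop_mul_const (by linarith))

lemma kT_zero (h : UrnPath ι α k T0 x c T) : Tendsto (fun n => k / T n) atTop (𝓝 0) :=
  h.T_atTop.const_div_atTop k

lemma sum_atTop (h : UrnPath ι α k T0 x c T) {η : ℝ} (hη : 0 < η) :
    Tendsto (fun n => ∑ s ∈ Finset.range n, η / T s) atTop atTop := by
  have hk := h.hk
  obtain ⟨_, _, w, hw⟩ := urn_log_sum T (fun _ => k) k (by rw [h.hT]; simpa using h.hT0)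
    (fun n => by rw [h.hT, h.hT]; push_cast; ring) (fun _ => by linarith) (fun _ => le_rfl)
  have h1 := (Real.tendsto_log_atTop.comp h.T_atTop).atTop_add hw.neg
  have h2 := h1.const_mul_atTop (show 0 < η / k by positivity)
  refine h2.congr fun n => ?_
  simp only [Function.comp]
  rw [neg_sub, add_sub_cancel, Finset.mul_sum]
  refine Finset.sum_congr rfl fun s _ => ?_
  have := h.Tpos s
  field_simp

lemma leaf_lower (h : UrnPath ι α k T0 x c T) {X X' G : ℝ} (hX : 0 < X) (hX' : X' < X)
    (hq : urnQ α X G < 1 / k) (hc : ∀ᶠ n in atTop, c n ≤ G) (i : ι) :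
    ∀ᶠ n in atTop, X' ≤ x i n := by
  rcases le_or_gt X' 0 with h0 | h0
  · exact Eventually.of_forall fun n => h0.trans (h.xpos i n).le
  have hk := h.hk
  obtain ⟨w, hw⟩ := h.hlx i
  have hG : 0 < G := by
    obtain ⟨n, hn⟩ := hc.exists
    exact (h.cpos n).trans_le hn
  have hQ := urnQ_pos (α := α) hX hG.le
  have hη : 0 < 1 / urnQ α X G - k := by
    rw [sub_pos, lt_div_iff₀ hQ]
    rw [lt_div_iff₀ (by linarith)] at hq
    linarith
  have := urn_drift (fun n => Real.log (x i n)) _ (fun n => k / T n)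
    (fun n => (1 / urnQ α X G - k) / T n) w (Real.log X) (Real.log X - Real.log X')
    (sub_pos.2 (Real.log_lt_log h0 hX')) hw h.kT_zero
    (Eventually.of_forall fun n => by
      have := h.Tpos n
      have := urnQ_pos (α := α) (h.xpos i n) (h.cpos n).le
      rw [← neg_div]
      gcongr
      have : 0 ≤ 1 / urnQ α (x i n) (c n) := by positivity
      linarith)
    (h.sum_atTop hη) (fun n => div_nonneg hη.le (h.Tpos n).le)
    (by
      filter_upwards [hc] with n hn hlt
      have hlt' := (Real.log_lt_log_iff (h.xpos i n) hX).1 hlt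
      have := h.Tpos n
      have := urnQ_pos (α := α) (h.xpos i n) (h.cpos n).le
      have := urnQ_mono h.hα0 h.hα1 (h.xpos i n).le hlt'.le (h.cpos n).le hn
      gcongr)
  filter_upwards [this] with n hn
  rw [sub_sub_cancel] at hn
  exact (Real.log_le_log_iff h0 (h.xpos i n)).1 hn

lemma leaf_upper (h : UrnPath ι α k T0 x c T) {X X' g : ℝ} (hX : 0 < X) (hX' : X < X')
    (hg : 0 < g) (hq : 1 / k < urnQ α X g) (hc : ∀ᶠ n in atTop, g ≤ c n) (i : ι) :
    ∀ᶠ n in atTop, x i n ≤ X' := by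
  have hk := h.hk
  obtain ⟨w, hw⟩ := h.hlx i
  have hQ := urnQ_pos (α := α) hX hg.le
  have hη : 0 < k - 1 / urnQ α X g := by
    rw [sub_pos, div_lt_iff₀ hQ]
    rw [div_lt_iff₀ (by linarith)] at hq
    linarith
  have ha : Tendsto (fun n => 1 / (T n * g) ^ α) atTop (𝓝 0) :=
    ((tendsto_rpow_atTop h.hα0).comp (h.T_atTop.atTop_mul_const hg)).const_div_atTop 1
  have := urn_drift (fun n => -Real.log (x i n))
    (fun s => -((1 / urnQ α (x i s) (c s) - k) / T s)) (fun n => 1 / (T n * g) ^ α)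
    (fun n => (k - 1 / urnQ α X g) / T n) (-w) (-Real.log X) (Real.log X' - Real.log X)
    (sub_pos.2 (Real.log_lt_log hX hX'))
    (by
      refine hw.neg.congr fun n => ?_
      rw [Finset.sum_neg_distrib]; ring) ha
    (by
      filter_upwards [hc] with n hn
      have hT := h.Tpos n
      have hx := h.xpos i n
      have hQ' := urnQ_pos (α := α) hx (h.cpos n).le
      rw [neg_le_neg_iff]
      calc (1 / urnQ α (x i n) (c n) - k) / T n ≤ (1 / urnQ α (x i n) (c n)) / T n := by
            gcongr; linarith
        _ = 1 / (urnQ α (x i n) (c n) * T n) := by rw [div_div]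
        _ ≤ 1 / (T n * g) ^ α := by
            have : 0 < (T n * g) ^ α := Real.rpow_pos_of_pos (by positivity) _
            refine one_div_le_one_div_of_le this ?_
            have e1 : (T n * g) ^ α ≤ (T n * c n) ^ α :=
              Real.rpow_le_rpow (by positivity) (by gcongr) h.hα0.le
            have e2 : 1 ≤ (T n * x i n) ^ (1 - α) :=
              Real.one_le_rpow (h.hTx i n) (by linarith [h.hα1])
            have e3 : (T n * x i n) ^ (1 - α) * (T n * c n) ^ α =
                x i n ^ (1 - α) * c n ^ α * T n := by
              rw [Real.mul_rpow hT.le hx.le, Real.mul_rpow hT.le (h.cpos n).le]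
              have : T n ^ (1 - α) * T n ^ α = T n := by
                rw [← Real.rpow_add hT]; simp
              calc _ = (T n ^ (1 - α) * T n ^ α) * (x i n ^ (1 - α) * c n ^ α) := by ring
                _ = _ := by rw [this]; ring
            have e4 : 0 ≤ (T n * c n) ^ α := by linarith
            have e5 := mul_le_mul_of_nonneg_right e2 e4
            have e6 : 0 ≤ x i n * T n := by positivity
            unfold urnQ
            rw [add_mul]
            linarith)
    (h.sum_atTop hη) (fun n => div_nonneg hη.le (h.Tpos n).le)
    (by
      filter_upwards [hc] with n hn hlt
      have hlt' := (Real.log_lt_log_iff hX (h.xpos i n)).1 (by linarith)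
      have := h.Tpos n
      have := urnQ_mono h.hα0 h.hα1 hX.le hlt'.le hg.le hn
      rw [← neg_div]
      rw [neg_sub]
      gcongr)
  filter_upwards [this] with n hn
  exact (Real.log_le_log_iff (h.xpos i n) (hX.trans hX')).1 (by linarith)

lemma center_lower (h : UrnPath ι α k T0 x c T) : ∀ᶠ n in atTop, 1 / 8 ≤ c n := by
  have hk := h.hk
  have hα0 := h.hα0
  have hα1 := h.hα1
  have hT0 := h.hT0
  obtain ⟨w, hw⟩ := h.hlc
  have hx6 : ∀ᶠ n : ℕ in atTop, ∀ i, x i n ≤ 3 / 5 := by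
    filter_upwards [eventually_ge_atTop (⌈2 * T0⌉₊)] with n hn i
    have hn' : 2 * T0 ≤ n := Nat.ceil_le.1 hn
    have h1 := h.hxle i n
    have h2 := h.Tpos n
    have h3 := h.hT n
    by_contra! hcon
    have h4 : T n * (3 / 5) < T n * x i n := by gcongr
    nlinarith
  have hη : 0 < k * (20 / 17) - k := by linarith
  have := urn_drift (fun n => Real.log (c n)) _ (fun n => k / T n)
    (fun n => (k * (20 / 17) - k) / T n) w (Real.log (1 / 4)) (Real.log (1 / 4) - Real.log (1 / 8))
    (sub_pos.2 (Real.log_lt_log (by norm_num) (by norm_num))) hw h.kT_zero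
    (Eventually.of_forall fun n => by
      have := h.Tpos n
      rw [← neg_div]
      gcongr
      have : 0 ≤ ∑ i, 1 / urnQ α (c n) (x i n) := Finset.sum_nonneg fun i _ =>
        one_div_nonneg.2 (urnQ_pos (h.cpos n) (h.xpos i n).le).le
      linarith)
    (h.sum_atTop hη) (fun n => div_nonneg hη.le (h.Tpos n).le)
    (by
      filter_upwards [hx6] with n hn hlt
      have hlt' := (Real.log_lt_log_iff (h.cpos n) (by norm_num)).1 hlt
      have := h.Tpos n
      gcongr
      calc k * (20 / 17) = ∑ i : ι, (20 / 17 : ℝ) := by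
            rw [Finset.sum_const, Finset.card_univ, nsmul_eq_mul, h.hcard]
        _ ≤ _ := Finset.sum_le_sum fun i _ => by
            have h1 := urnQ_pos (α := α) (h.cpos n) (h.xpos i n).le
            rw [le_div_iff₀ h1]
            have h2 := urnQ_mono hα0 hα1 (h.cpos n).le hlt'.le (h.xpos i n).le (hn i)
            have h3 : urnQ α (1 / 4) (3 / 5) ≤ 17 / 20 := by
              unfold urnQ
              have e1 : ((1 : ℝ) / 4) ^ (1 - α) ≤ (3 / 5) ^ (1 - α) :=
                Real.rpow_le_rpow (by norm_num) (by norm_num) (by linarith)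
              have e2 : ((3 : ℝ) / 5) ^ (1 - α) * (3 / 5) ^ α = 3 / 5 := by
                rw [← Real.rpow_add (by norm_num)]; simp
              have e3 : (0 : ℝ) ≤ (3 / 5) ^ α := by positivity
              have e4 := mul_le_mul_of_nonneg_right e1 e3
              linarith
            linarith)
  filter_upwards [this] with n hn
  rw [sub_sub_cancel] at hn
  exact (Real.log_le_log_iff (by norm_num) (h.cpos n)).1 hn

lemma c_eq (h : UrnPath ι α k T0 x c T) (n : ℕ) : c n = 1 - ∑ i, x i n := by
  linarith [h.hsum n]

lemma bdd_ge (h : UrnPath ι α k T0 x c T) : IsBoundedUnder (· ≥ ·) atTop c :=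
  isBoundedUnder_of ⟨0, fun n => (h.cpos n).le⟩

lemma bdd_le (h : UrnPath ι α k T0 x c T) : IsBoundedUnder (· ≤ ·) atTop c :=
  isBoundedUnder_of ⟨1, h.cle⟩

lemma liminf_ge (h : UrnPath ι α k T0 x c T) {a : ℝ} (ha : ∀ᶠ n in atTop, a ≤ c n) :
    a ≤ liminf c atTop :=
  le_liminf_of_le h.bdd_le.isCoboundedUnder_ge ha

lemma limsup_le' (h : UrnPath ι α k T0 x c T) {a : ℝ} (ha : ∀ᶠ n in atTop, c n ≤ a) :
    limsup c atTop ≤ a :=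
  limsup_le_of_le h.bdd_ge.isCoboundedUnder_le ha

lemma liminf_key (h : UrnPath ι α k T0 x c T) (h1 : liminf c atTop < 1) :
    urnQ α ((1 - liminf c atTop) / k) (liminf c atTop) ≤ 1 / k := by
  have hk := h.hk
  set g := liminf c atTop with hg
  have hgpos : 0 < g := lt_of_lt_of_le (by norm_num) (h.liminf_ge h.center_lower)
  have hX0 : 0 < (1 - g) / k := div_pos (by linarith) (by linarith)
  by_contra! hcon
  obtain ⟨X, ⟨hXq, hXpos⟩, hXlt⟩ : ∃ X, (1 / k < urnQ α X g ∧ 0 < X) ∧ X < (1 - g) / k := by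
    have e1 := ((urnQ_contx (c := g) h.hα1).eventually (lt_mem_nhds hcon)).and (lt_mem_nhds hX0)
    exact ((e1.filter_mono nhdsWithin_le_nhds).and self_mem_nhdsWithin :
      ∀ᶠ X in 𝓝[<] ((1 - g) / k), _).exists
  obtain ⟨g', ⟨hgq, hgpos'⟩, hglt⟩ : ∃ g', (1 / k < urnQ α X g' ∧ 0 < g') ∧ g' < g := by
    have e1 := ((urnQ_contc (x := X) h.hα0).eventually (lt_mem_nhds hXq)).and (lt_mem_nhds hgpos)
    exact ((e1.filter_mono nhdsWithin_le_nhds).and self_mem_nhdsWithin :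
      ∀ᶠ X in 𝓝[<] g, _).exists
  obtain ⟨X', hX1, hX2⟩ := exists_between hXlt
  have hev := eventually_lt_of_lt_liminf hglt h.bdd_ge
  have hall := eventually_all.2 (fun i =>
    h.leaf_upper hXpos hX1 hgpos' hgq (hev.mono fun n hn => hn.le) i)
  have : 1 - k * X' ≤ g := by
    refine h.liminf_ge ?_
    filter_upwards [hall] with n hn
    rw [h.c_eq]
    have : ∑ i, x i n ≤ ∑ i : ι, X' := Finset.sum_le_sum fun i _ => hn i
    rw [Finset.sum_const, Finset.card_univ, nsmul_eq_mul, h.hcard] at this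
    linarith
  rw [lt_div_iff₀ (by linarith)] at hX2
  linarith

lemma limsup_key (h : UrnPath ι α k T0 x c T) :
    1 / k ≤ urnQ α ((1 - limsup c atTop) / k) (limsup c atTop) := by
  have hk := h.hk
  set g := limsup c atTop with hg
  have hg1 : g ≤ 1 := h.limsup_le' (Eventually.of_forall h.cle)
  have hX0 : 0 ≤ (1 - g) / k := div_nonneg (by linarith) (by linarith)
  by_contra! hcon
  obtain ⟨X, hXq, hXlt⟩ : ∃ X, urnQ α X g < 1 / k ∧ (1 - g) / k < X := by
    have e1 := (urnQ_contx (c := g) h.hα1).eventually (gt_mem_nhds hcon)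
    exact ((e1.filter_mono nhdsWithin_le_nhds).and self_mem_nhdsWithin :
      ∀ᶠ X in 𝓝[>] ((1 - g) / k), _).exists
  obtain ⟨g', hgq, hglt⟩ : ∃ g', urnQ α X g' < 1 / k ∧ g < g' := by
    have e1 := (urnQ_contc (x := X) h.hα0).eventually (gt_mem_nhds hXq)
    exact ((e1.filter_mono nhdsWithin_le_nhds).and self_mem_nhdsWithin :
      ∀ᶠ X in 𝓝[>] g, _).exists
  obtain ⟨X', hX1, hX2⟩ := exists_between hXlt
  have hev := eventually_lt_of_limsup_lt hglt h.bdd_le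
  have hall := eventually_all.2 (fun i =>
    h.leaf_lower (hX0.trans_lt hXlt) hX2 hgq (hev.mono fun n hn => hn.le) i)
  have : g ≤ 1 - k * X' := by
    refine h.limsup_le' ?_
    filter_upwards [hall] with n hn
    rw [h.c_eq]
    have : ∑ i : ι, X' ≤ ∑ i, x i n := Finset.sum_le_sum fun i _ => hn i
    rw [Finset.sum_const, Finset.card_univ, nsmul_eq_mul, h.hcard] at this
    linarith
  rw [div_lt_iff₀ (by linarith)] at hX1
  linarith

theorem limit_one (h : UrnPath ι α k T0 x c T) (hα : α = 1) :
    Tendsto c atTop (𝓝 1) ∧ ∀ i, Tendsto (x i) atTop (𝓝 0) := by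
  have hk := h.hk
  have hc : Tendsto c atTop (𝓝 1) := by
    have hg1 : 1 ≤ liminf c atTop := by
      by_contra! hlt
      have hgpos : 0 < liminf c atTop :=
        lt_of_lt_of_le (by norm_num) (h.liminf_ge h.center_lower)
      have := h.liminf_key hlt
      generalize liminf c atTop = g at *
      subst hα
      unfold urnQ at this
      simp only [sub_self, Real.rpow_zero, one_mul, Real.rpow_one] at this
      rw [le_div_iff₀ (by linarith), add_mul, div_mul_cancel₀ _ (by linarith)] at this
      nlinarith
    exact tendsto_of_le_liminf_of_limsup_le hg1 (h.limsup_le' (Eventually.of_forall h.cle))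
      h.bdd_le h.bdd_ge
  refine ⟨hc, fun i => ?_⟩
  have h1 : Tendsto (fun n => 1 - c n) atTop (𝓝 0) := by
    simpa using hc.const_sub 1
  refine squeeze_zero (fun n => (h.xpos i n).le) (fun n => ?_) h1
  have := Finset.single_le_sum (f := fun j => x j n) (fun j _ => (h.xpos j n).le)
    (Finset.mem_univ i)
  have h2 := h.hsum n
  linarith

theorem limit_lt (h : UrnPath ι α k T0 x c T) (hα : α < 1) :
    Tendsto c atTop (𝓝 (k ^ (1 / (1 - α)) / (k + k ^ (1 / (1 - α))))) ∧
    ∀ i, Tendsto (x i) atTop (𝓝 (1 / (k + k ^ (1 / (1 - α))))) := by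
  have hk := h.hk
  have hk0 : 0 < k := by linarith
  have hβ : 0 < 1 - α := by linarith
  set K := k ^ (1 / (1 - α)) with hK
  have hKpos : 0 < K := Real.rpow_pos_of_pos hk0 _
  have hKβ : K ^ (1 - α) = k := by
    rw [hK, ← Real.rpow_mul hk0.le, one_div_mul_cancel hβ.ne', Real.rpow_one]
  have hqform : ∀ g, 0 < g → g ≤ 1 → k * urnQ α ((1 - g) / k) g - 1 =
      ((K * ((1 - g) / k)) ^ (1 - α) - g ^ (1 - α)) * g ^ α := by
    intro g hg hg1
    have hX : 0 ≤ (1 - g) / k := div_nonneg (by linarith) hk0.le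
    rw [Real.mul_rpow hKpos.le hX, hKβ, sub_mul, ← Real.rpow_add hg]
    unfold urnQ
    simp only [sub_add_cancel, Real.rpow_one]
    have : k * ((1 - g) / k) = 1 - g := by field_simp
    rw [mul_add, this]
    ring
  have hcge : K / (k + K) ≤ liminf c atTop := by
    by_cases hlt : liminf c atTop < 1
    · have hgpos : 0 < liminf c atTop :=
        lt_of_lt_of_le (by norm_num) (h.liminf_ge h.center_lower)
      have hq := h.liminf_key hlt
      generalize liminf c atTop = g at *
      have hf := hqform g hgpos hlt.le
      rw [le_div_iff₀ hk0] at hq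
      have h2 : (K * ((1 - g) / k)) ^ (1 - α) ≤ g ^ (1 - α) := by
        by_contra! hcon
        have := mul_pos (sub_pos.2 hcon) (Real.rpow_pos_of_pos hgpos α)
        linarith
      have hX : 0 ≤ (1 - g) / k := div_nonneg (by linarith) hk0.le
      have h3 := (Real.rpow_le_rpow_iff (by positivity) hgpos.le hβ).1 h2
      rw [← mul_div_assoc, div_le_iff₀ hk0] at h3
      rw [div_le_iff₀ (by positivity)]
      linarith
    · have : K / (k + K) ≤ 1 := by
        rw [div_le_one (by positivity)]; linarith
      linarith
  have hcle : limsup c atTop ≤ K / (k + K) := by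
    have hgpos : 0 < limsup c atTop :=
      lt_of_lt_of_le (lt_of_lt_of_le (by norm_num) (h.liminf_ge h.center_lower))
        (liminf_le_limsup h.bdd_le h.bdd_ge)
    have hg1 : limsup c atTop ≤ 1 := h.limsup_le' (Eventually.of_forall h.cle)
    have hq := h.limsup_key
    generalize limsup c atTop = g at *
    have hf := hqform g hgpos hg1
    rw [div_le_iff₀ hk0] at hq
    have h2 : g ^ (1 - α) ≤ (K * ((1 - g) / k)) ^ (1 - α) := by
      by_contra! hcon
      have := mul_pos (sub_pos.2 hcon) (Real.rpow_pos_of_pos hgpos α)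
      linarith
    have hX : 0 ≤ (1 - g) / k := div_nonneg (by linarith) hk0.le
    have h3 := (Real.rpow_le_rpow_iff hgpos.le (by positivity) hβ).1 h2
    rw [← mul_div_assoc, le_div_iff₀ hk0] at h3
    rw [le_div_iff₀ (by positivity)]
    linarith
  have hc : Tendsto c atTop (𝓝 (K / (k + K))) :=
    tendsto_of_le_liminf_of_limsup_le hcge hcle h.bdd_le h.bdd_ge
  refine ⟨hc, fun i => ?_⟩
  have hcs : 0 < K / (k + K) := by positivity
  have hcs1 : K / (k + K) ≤ 1 := by
    rw [div_le_one (by positivity)]; linarith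
  have hxs : 0 < 1 / (k + K) := by positivity
  have hqs : urnQ α (1 / (k + K)) (K / (k + K)) = 1 / k := by
    have hf := hqform _ hcs hcs1
    have e1 : (1 - K / (k + K)) / k = 1 / (k + K) := by field_simp; ring
    have e2 : K * (1 / (k + K)) = K / (k + K) := by ring
    rw [e1, e2, sub_self, zero_mul] at hf
    rw [eq_div_iff hk0.ne']
    linarith
  rw [tendsto_order]
  constructor
  · intro a ha
    obtain ⟨a1, ha1, ha1'⟩ := exists_between (max_lt ha hxs)
    obtain ⟨a2, ha2, ha2'⟩ := exists_between ha1'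
    have ha1pos : 0 < a1 := (le_max_right _ _).trans_lt ha1
    have hq2 : urnQ α a2 (K / (k + K)) < 1 / k := by
      rw [← hqs]; exact urnQ_strict h.hα1 (ha1pos.trans ha2).le ha2' hcs.le
    obtain ⟨g', hgq, hglt⟩ : ∃ g', urnQ α a2 g' < 1 / k ∧ K / (k + K) < g' := by
      have e1 := (urnQ_contc (x := a2) h.hα0).eventually (gt_mem_nhds hq2)
      exact ((e1.filter_mono nhdsWithin_le_nhds).and self_mem_nhdsWithin :
        ∀ᶠ X in 𝓝[>] (K / (k + K)), _).exists
    have hev := h.leaf_lower (ha1pos.trans ha2) ha2 hgq (hc.eventually_le_const hglt) i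
    filter_upwards [hev] with n hn
    exact (le_max_left _ _).trans_lt (ha1.trans_le hn)
  · intro a ha
    obtain ⟨a1, ha1, ha1'⟩ := exists_between ha
    obtain ⟨a2, ha2, ha2'⟩ := exists_between ha1
    have hq2 : 1 / k < urnQ α a2 (K / (k + K)) := by
      rw [← hqs]; exact urnQ_strict h.hα1 hxs.le ha2 hcs.le
    obtain ⟨g', ⟨hgq, hgpos⟩, hglt⟩ :
        ∃ g', (1 / k < urnQ α a2 g' ∧ 0 < g') ∧ g' < K / (k + K) := by
      have e1 := ((urnQ_contc (x := a2) h.hα0).eventually (lt_mem_nhds hq2)).and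
        (lt_mem_nhds hcs)
      exact ((e1.filter_mono nhdsWithin_le_nhds).and self_mem_nhdsWithin :
        ∀ᶠ X in 𝓝[<] (K / (k + K)), _).exists
    have hev := h.leaf_upper (hxs.trans ha2) ha2' hgpos hgq (hc.eventually_const_le hglt) i
    filter_upwards [hev] with n hn
    exact hn.trans_lt ha1'

end UrnPath

/-- Rewriting the relative drift in terms of proportions. -/
lemma urn_drift_eq {α B C T : ℝ} (hB : 0 < B) (hC : 0 < C) (hT : 0 < T) :
    B ^ α / (B ^ α + C ^ α) / B = 1 / urnQ α (B / T) (C / T) / T := by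
  have hBα : 0 < B ^ α := Real.rpow_pos_of_pos hB _
  have hCα : 0 < C ^ α := Real.rpow_pos_of_pos hC _
  have hBβ : 0 < B ^ (1 - α) := Real.rpow_pos_of_pos hB _
  have e1 : B ^ α * B ^ (1 - α) = B := by
    rw [← Real.rpow_add hB]; simp
  have e2 : T ^ (1 - α) * T ^ α = T := by
    rw [← Real.rpow_add hT]; simp
  have hTα : 0 < T ^ α := Real.rpow_pos_of_pos hT _
  have hTβ : 0 < T ^ (1 - α) := Real.rpow_pos_of_pos hT _
  have e3 : urnQ α (B / T) (C / T) * T = B + B ^ (1 - α) * C ^ α := by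
    unfold urnQ
    rw [Real.div_rpow hB.le hT.le, Real.div_rpow hC.le hT.le, div_mul_div_comm, e2, add_mul,
      div_mul_cancel₀ _ hT.ne', div_mul_cancel₀ _ hT.ne']
  rw [div_div, div_div, e3, div_eq_div_iff (by positivity) (by positivity)]
  calc B ^ α * (B + B ^ (1 - α) * C ^ α) = B ^ α * B + (B ^ α * B ^ (1 - α)) * C ^ α := by ring
    _ = _ := by rw [e1]; ring

namespace GraphUrn

variable {m : ℕ} {G : SimpleGraph (Fin m)} [DecidableRel G.Adj] {α : ℝ}

/-- Almost surely, `log B_v(n)` is the sum of conditional relative drifts plus a convergent term. -/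
lemma vertex_conv (P : GraphUrn m G α) (v : Fin m) :
    ∀ᵐ ω ∂P.μ, ∃ w, Tendsto (fun n => Real.log (P.B n v ω) - ∑ s ∈ Finset.range n,
      (∑ j ∈ G.neighborFinset v, (P.B s v ω : ℝ) ^ α /
        ((P.B s v ω : ℝ) ^ α + (P.B s j ω : ℝ) ^ α)) / (P.B s v ω : ℝ)) atTop (𝓝 w) := by
  let := P.mΩ
  have := P.isProb
  set d : ℝ := ((G.neighborFinset v).card : ℝ) with hd
  set D : ℕ → P.Ω → ℝ := fun n ω => ∑ j ∈ G.neighborFinset v, (P.δ (n + 1) v j ω : ℝ) with hD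
  set π : ℕ → P.Ω → ℝ := fun n ω => ∑ j ∈ G.neighborFinset v, (P.B n v ω : ℝ) ^ α /
        ((P.B n v ω : ℝ) ^ α + (P.B n j ω : ℝ) ^ α) with hπ
  have hδ1 : ∀ n j, j ∈ G.neighborFinset v → ∀ ω, (P.δ n v j ω : ℝ) ≤ 1 := by
    intro n j hj ω
    have := P.δ_sum n v j ((G.mem_neighborFinset v j).1 hj) ω
    exact_mod_cast (show P.δ n v j ω ≤ 1 by omega)
  have hD0 : ∀ n ω, 0 ≤ D n ω := fun n ω => Finset.sum_nonneg fun j _ => Nat.cast_nonneg _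
  have hDd : ∀ n ω, D n ω ≤ d := by
    intro n ω
    have := Finset.sum_le_sum (fun j hj => hδ1 (n + 1) j hj ω)
    rwa [Finset.sum_const, nsmul_eq_mul, mul_one] at this
  have hπ0 : ∀ n ω, 0 ≤ π n ω := fun n ω => Finset.sum_nonneg fun j _ => by positivity
  have hπd : ∀ n ω, π n ω ≤ d := by
    intro n ω
    have : π n ω ≤ ∑ j ∈ G.neighborFinset v, (1 : ℝ) := Finset.sum_le_sum (fun j hj => by
      refine div_le_one_of_le₀ ?_ (by positivity)
      have : (0 : ℝ) ≤ (P.B n j ω : ℝ) ^ α := by positivity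
      linarith)
    rwa [Finset.sum_const, nsmul_eq_mul, mul_one] at this
  have hlog := fun ω => urn_log_sum (fun n => (P.B n v ω : ℝ)) (fun n => D n ω) d
    (by exact_mod_cast P.B0_pos v ω)
    (fun n => by simp only [hD, P.B_succ n v ω]; push_cast; rfl) (fun n => hD0 n ω)
    (fun n => hDd n ω)
  have hB1 : ∀ n ω, (1 : ℝ) ≤ P.B n v ω := fun n ω => (hlog ω).1 n
  have hBm : ∀ n j, Measurable[P.ℱ n] (fun ω => (P.B n j ω : ℝ)) := fun n j =>
    (measurable_from_top (f := fun a : ℕ => (a : ℝ))).comp (P.B_adapted n j)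
  have hδm : ∀ n j, Measurable[P.ℱ n] (fun ω => (P.δ n v j ω : ℝ)) := fun n j =>
    (measurable_from_top (f := fun a : ℕ => (a : ℝ))).comp (P.δ_adapted n v j)
  have hDm : ∀ n, Measurable[P.ℱ (n + 1)] (D n) := fun n =>
    Finset.measurable_sum _ fun j _ => hδm (n + 1) j
  have hπm : ∀ n, Measurable[P.ℱ n] (π n) := fun n =>
    Finset.measurable_sum _ fun j _ =>
      ((hBm n v).pow_const α).div (((hBm n v).pow_const α).add ((hBm n j).pow_const α))
  have hδi : ∀ n j, j ∈ G.neighborFinset v →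
      Integrable (fun ω => (P.δ n v j ω : ℝ)) P.μ := fun n j hj =>
    Integrable.of_bound ((hδm n j).mono (P.ℱ.le _) le_rfl).aestronglyMeasurable 1
      (Eventually.of_forall fun ω => by
        rw [Real.norm_eq_abs, abs_of_nonneg (Nat.cast_nonneg _)]
        exact hδ1 n j hj ω)
  have hquot : ∀ a n ω, 0 ≤ a → a ≤ d → |a / (P.B n v ω : ℝ)| ≤ d := by
    intro a n ω h0 h1
    have hb := hB1 n ω
    rw [abs_of_nonneg (div_nonneg h0 (by linarith))]
    exact (div_le_self h0 hb).trans h1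
  have hcond : ∀ n, (P.μ)[fun ω => D n ω / (P.B n v ω : ℝ) | P.ℱ n] =ᵐ[P.μ]
      fun ω => π n ω / (P.B n v ω : ℝ) := by
    intro n
    have hDi : Integrable (D n) P.μ := integrable_finsetSum _ fun j hj => hδi (n + 1) j hj
    have e : (fun ω => D n ω / (P.B n v ω : ℝ)) = (fun ω => (P.B n v ω : ℝ)⁻¹) * D n := by
      ext ω; simp [div_eq_mul_inv, mul_comm]
    have h1 := condExp_stronglyMeasurable_mul_of_bound (μ := P.μ) (P.ℱ.le n)
      (hBm n v).inv.stronglyMeasurable hDi 1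
      (Eventually.of_forall fun ω => by
        have hb := hB1 n ω
        have : (0 : ℝ) ≤ (P.B n v ω : ℝ)⁻¹ := by positivity
        rw [Pi.inv_apply, Real.norm_eq_abs, abs_of_nonneg this]
        exact inv_le_one_of_one_le₀ hb)
    have h2 : (P.μ)[D n | P.ℱ n] =ᵐ[P.μ] π n := by
      have e2 : D n = ∑ j ∈ G.neighborFinset v, (fun ω => (P.δ (n + 1) v j ω : ℝ)) := by
        ext ω; simp [hD]
      rw [e2]
      have h3 := condExp_finsetSum (μ := P.μ) (fun j hj => hδi (n + 1) j hj) (P.ℱ n)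
      have h4 : ∀ᵐ ω ∂P.μ, ∀ j, G.Adj v j →
          ((P.μ)[fun ω => (P.δ (n + 1) v j ω : ℝ) | P.ℱ n]) ω =
          (P.B n v ω : ℝ) ^ α / ((P.B n v ω : ℝ) ^ α + (P.B n j ω : ℝ) ^ α) := by
        rw [ae_all_iff]
        intro j
        by_cases hj : G.Adj v j
        · filter_upwards [P.cond_law n v j hj] with ω hω _
          exact hω
        · exact Eventually.of_forall fun ω h => absurd h hj
      filter_upwards [h3, h4] with ω h3 h4
      rw [h3, Finset.sum_apply]
      exact Finset.sum_congr rfl fun j hj => h4 j ((G.mem_neighborFinset v j).1 hj)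
    rw [e]
    filter_upwards [h1, h2] with ω h1 h2
    have h1' : ((P.μ)[(fun ω => (P.B n v ω : ℝ)⁻¹) * D n | P.ℱ n]) ω =
      (P.B n v ω : ℝ)⁻¹ * ((P.μ)[D n | P.ℱ n]) ω := h1
    rw [h1', h2]
    ring
  have hmain := urn_martingale P.μ P.ℱ (fun n ω => D n ω / (P.B n v ω : ℝ))
    (fun n ω => π n ω / (P.B n v ω : ℝ)) d (d * (d + 1))
    (fun n => (hDm n).div ((hBm n v).mono (P.ℱ.mono (Nat.le_succ n)) le_rfl))
    (fun n => (hπm n).div (hBm n v))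
    (fun n ω => hquot _ n ω (hD0 n ω) (hDd n ω)) (fun n ω => hquot _ n ω (hπ0 n ω) (hπd n ω))
    hcond (fun n ω => (hlog ω).2.1 n)
  filter_upwards [hmain] with ω hω
  obtain ⟨w1, h1⟩ := hω
  obtain ⟨w2, h2⟩ := (hlog ω).2.2
  refine ⟨w2 + w1, (h2.add h1).congr fun n => ?_⟩
  rw [Finset.sum_sub_distrib]
  ring

end GraphUrn

lemma star_edges {m : ℕ} {G : SimpleGraph (Fin m)} [DecidableRel G.Adj]
    (center : Fin m) (hstar : ∀ i j, G.Adj i j ↔ i ≠ j ∧ (i = center ∨ j = center)) :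
    G.neighborFinset center = Finset.univ.erase center ∧
    (∀ i, i ≠ center → G.neighborFinset i = {center}) ∧ G.edgeFinset.card + 1 = m := by
  have h1 : G.neighborFinset center = Finset.univ.erase center := by
    ext j; simp [hstar, eq_comm]
  have h2 : ∀ i, i ≠ center → G.neighborFinset i = {center} := by
    intro i hi
    ext j
    simp only [SimpleGraph.mem_neighborFinset, hstar, Finset.mem_singleton]
    constructor
    · rintro ⟨_, h | h⟩
      · exact absurd h hi
      · exact h
    · rintro rfl
      exact ⟨hi, Or.inr rfl⟩
  refine ⟨h1, h2, ?_⟩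
  have h3 := G.sum_degrees_eq_twice_card_edges
  have hm : 0 < m := center.pos
  rw [← Finset.add_sum_erase _ _ (Finset.mem_univ center)] at h3
  have h4 : ∑ i ∈ Finset.univ.erase center, G.degree i = ∑ i ∈ Finset.univ.erase center, 1 := by
    refine Finset.sum_congr rfl fun i hi => ?_
    rw [← SimpleGraph.card_neighborFinset_eq_degree, h2 i (Finset.ne_of_mem_erase hi)]
    simp
  rw [h4, ← SimpleGraph.card_neighborFinset_eq_degree, h1] at h3
  simp [Finset.card_erase_of_mem] at h3
  omega

namespace GraphUrn

/-- Almost every path of the star urn satisfies the hypotheses of the deterministic analysis. -/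
lemma star_path {m : ℕ} (hm : 3 ≤ m) {G : SimpleGraph (Fin m)} [DecidableRel G.Adj]
    (center : Fin m)
    (hstar : ∀ i j, G.Adj i j ↔ i ≠ j ∧ (i = center ∨ j = center))
    {α : ℝ} (hα0 : 0 < α) (hα1 : α ≤ 1) (P : GraphUrn m G α) (ω : P.Ω)
    (hω : ∀ v, ∃ w, Tendsto (fun n => Real.log (P.B n v ω) - ∑ s ∈ Finset.range n,
      (∑ j ∈ G.neighborFinset v, (P.B s v ω : ℝ) ^ α /
        ((P.B s v ω : ℝ) ^ α + (P.B s j ω : ℝ) ^ α)) / (P.B s v ω : ℝ)) atTop (𝓝 w)) :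
    ∃ T0 T, UrnPath {i : Fin m // i ≠ center} α ((m : ℝ) - 1) T0 (fun i n => P.x n ω i)
      (fun n => P.x n ω center) T := by
  obtain ⟨hnc, hnl, hedge⟩ := star_edges center hstar
  have hNe : (G.edgeFinset.card : ℝ) = (m : ℝ) - 1 := by
    rw [eq_sub_iff_add_eq]; exact_mod_cast hedge
  have hm' : (3 : ℝ) ≤ m := by exact_mod_cast hm
  set T0 : ℝ := ∑ j, (P.B 0 j ω : ℝ) with hT0
  set T : ℕ → ℝ := fun n => T0 + n * ((m : ℝ) - 1) with hT
  have hx : ∀ n i, P.x n ω i = (P.B n i ω : ℝ) / T n := by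
    intro n i
    simp only [GraphUrn.x, hT, hT0]
    push_cast
    rw [hNe]
  have hleaf : ∀ n i, i ≠ center → P.B (n + 1) i ω = P.B n i ω + P.δ (n + 1) i center ω := by
    intro n i hi
    rw [P.B_succ, hnl i hi, Finset.sum_singleton]
  have hB1 : ∀ n i, 1 ≤ P.B n i ω := by
    intro n i
    induction n with
    | zero => exact P.B0_pos i ω
    | succ n ih => rw [P.B_succ]; omega
  have hB1' : ∀ n i, (1 : ℝ) ≤ P.B n i ω := fun n i => by exact_mod_cast hB1 n i
  have hδ : ∀ n i, i ≠ center → P.δ n i center ω + P.δ n center i ω = 1 := fun n i hi =>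
    P.δ_sum n i center ((hstar _ _).2 ⟨hi, Or.inr rfl⟩) ω
  have hsumB : ∀ n, ∑ i, (P.B n i ω : ℝ) = T n := by
    intro n
    induction n with
    | zero => simp [hT, hT0]
    | succ n ih =>
      have e : T (n + 1) = T n + ((m : ℝ) - 1) := by
        simp only [hT]; push_cast; ring
      rw [e, ← ih, ← Finset.add_sum_erase _ _ (Finset.mem_univ center),
        ← Finset.add_sum_erase _ (fun i => (P.B n i ω : ℝ)) (Finset.mem_univ center)]
      have e1 : ∑ i ∈ Finset.univ.erase center, (P.B (n + 1) i ω : ℝ) =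
          ∑ i ∈ Finset.univ.erase center, (P.B n i ω : ℝ) +
          ∑ i ∈ Finset.univ.erase center, (P.δ (n + 1) i center ω : ℝ) := by
        rw [← Finset.sum_add_distrib]
        refine Finset.sum_congr rfl fun i hi => ?_
        rw [hleaf n i (Finset.ne_of_mem_erase hi)]
        push_cast; rfl
      have e2 : ∑ i ∈ Finset.univ.erase center, (P.δ (n + 1) i center ω : ℝ) +
          ∑ i ∈ Finset.univ.erase center, (P.δ (n + 1) center i ω : ℝ) = (m : ℝ) - 1 := by
        rw [← Finset.sum_add_distrib]
        rw [Finset.sum_congr rfl (g := fun _ => (1 : ℝ)) fun i hi => by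
          exact_mod_cast hδ (n + 1) i (Finset.ne_of_mem_erase hi)]
        rw [Finset.sum_const, Finset.card_erase_of_mem (Finset.mem_univ _), Finset.card_univ,
          Fintype.card_fin, nsmul_eq_mul, Nat.cast_sub (by omega)]
        simp
      rw [e1, P.B_succ n center ω, hnc]
      push_cast
      linarith
  have hT01 : 1 ≤ T0 := (hB1' 0 center).trans
    (Finset.single_le_sum (f := fun j => (P.B 0 j ω : ℝ)) (fun j _ => Nat.cast_nonneg _)
      (Finset.mem_univ center))
  have hTpos : ∀ n, 0 < T n := by
    intro n
    have : 0 ≤ (n : ℝ) * ((m : ℝ) - 1) := mul_nonneg (Nat.cast_nonneg _) (by linarith)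
    simp only [hT]; linarith
  have hTx : ∀ n i, T n * P.x n ω i = P.B n i ω := by
    intro n i
    rw [hx, mul_div_cancel₀ _ (hTpos n).ne']
  obtain ⟨_, _, wT, hwT⟩ := urn_log_sum T (fun _ => (m : ℝ) - 1) ((m : ℝ) - 1)
    (by simpa [hT] using hT01) (fun n => by simp only [hT]; push_cast; ring)
    (fun _ => by linarith) (fun _ => le_rfl)
  have hconv : ∀ v, ∃ w, Tendsto (fun n => Real.log (P.x n ω v) - ∑ s ∈ Finset.range n,
      (∑ j ∈ G.neighborFinset v, 1 / urnQ α (P.x s ω v) (P.x s ω j) - ((m : ℝ) - 1)) / T s)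
      atTop (𝓝 w) := by
    intro v
    obtain ⟨w, hw⟩ := hω v
    refine ⟨w - wT, (hw.sub hwT).congr fun n => ?_⟩
    rw [hx, Real.log_div (by linarith [hB1' n v]) (hTpos n).ne']
    simp_rw [sub_div, Finset.sum_sub_distrib]
    have : ∀ s, (∑ j ∈ G.neighborFinset v, (P.B s v ω : ℝ) ^ α /
        ((P.B s v ω : ℝ) ^ α + (P.B s j ω : ℝ) ^ α)) / (P.B s v ω : ℝ) =
        (∑ j ∈ G.neighborFinset v, 1 / urnQ α (P.x s ω v) (P.x s ω j)) / T s := by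
      intro s
      rw [Finset.sum_div, Finset.sum_div]
      refine Finset.sum_congr rfl fun j _ => ?_
      rw [hx, hx]
      exact urn_drift_eq (by linarith [hB1' s v]) (by linarith [hB1' s j]) (hTpos s)
    simp_rw [this]
    ring
  refine ⟨T0, T, hα0, hα1, by linarith, ?_, hT01, fun n => rfl, ?_, ?_, ?_, ?_, ?_, ?_⟩
  · rw [Fintype.card_subtype_compl, Fintype.card_fin, Fintype.card_subtype_eq,
      Nat.cast_sub (by omega)]
    simp
  · intro n
    rw [← Fintype.sum_eq_add_sum_subtype_ne (fun i => P.x n ω i) center]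
    simp_rw [hx]
    rw [← Finset.sum_div, hsumB, div_self (hTpos n).ne']
  · intro i n
    rw [hTx]; exact hB1' n i
  · intro n
    rw [hTx]; exact hB1' n center
  · intro i n
    rw [hTx]
    have h1 : P.B n i ω ≤ n + P.B 0 i ω := by
      induction n with
      | zero => simp
      | succ n ih =>
        rw [hleaf n i i.2]
        have := hδ (n + 1) i i.2
        omega
    have h2 : (P.B 0 i ω : ℝ) ≤ T0 :=
      Finset.single_le_sum (f := fun j => (P.B 0 j ω : ℝ)) (fun j _ => Nat.cast_nonneg _)
        (Finset.mem_univ (i : Fin m))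
    have h3 : (P.B n i ω : ℝ) ≤ n + P.B 0 i ω := by exact_mod_cast h1
    linarith
  · intro i
    have := hconv i
    simpa only [hnl i i.2, Finset.sum_singleton] using this
  · obtain ⟨w, hw⟩ := hconv center
    refine ⟨w, hw.congr fun n => ?_⟩
    congr 1
    refine Finset.sum_congr rfl fun s _ => ?_
    congr 2
    rw [hnc]
    refine (Finset.sum_subtype _ (fun i => by simp) _)

end GraphUrn

/-- **Theorem 5(a).** For the star graph with `m ≥ 3` vertices (center `m`, i.e. the vertex
of highest degree) and `0 < α ≤ 1`, `x(n)` converges almost surely to the point whose leaf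
coordinates equal `1/(m - 1 + (m-1)^(1/(1-α)))` and whose center coordinate equals
`(m-1)^(1/(1-α))/(m - 1 + (m-1)^(1/(1-α)))`; for `α = 1` this point is `(0, …, 0, 1)`. -/
theorem polya_urn_star_alpha_le_one
    {m : ℕ} (hm : 3 ≤ m) {G : SimpleGraph (Fin m)} [DecidableRel G.Adj]
    (center : Fin m) (hcenter : (center : ℕ) = m - 1)
    (hstar : ∀ i j, G.Adj i j ↔ i ≠ j ∧ (i = center ∨ j = center))
    {α : ℝ} (hα0 : 0 < α) (hα1 : α ≤ 1) (P : GraphUrn m G α) :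
    ∀ᵐ ω ∂P.μ, Tendsto (fun n => P.x n ω) atTop (𝓝 (fun i =>
      if α = 1 then (if i = center then (1 : ℝ) else 0)
      else if i = center then
        ((m : ℝ) - 1) ^ ((1 : ℝ) / (1 - α)) /
          (((m : ℝ) - 1) + ((m : ℝ) - 1) ^ ((1 : ℝ) / (1 - α)))
      else 1 / (((m : ℝ) - 1) + ((m : ℝ) - 1) ^ ((1 : ℝ) / (1 - α))))) := by
  have hall : ∀ᵐ ω ∂P.μ, ∀ v, ∃ w, Tendsto (fun n => Real.log (P.B n v ω) -
      ∑ s ∈ Finset.range n, (∑ j ∈ G.neighborFinset v, (P.B s v ω : ℝ) ^ α /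
        ((P.B s v ω : ℝ) ^ α + (P.B s j ω : ℝ) ^ α)) / (P.B s v ω : ℝ)) atTop (𝓝 w) :=
    ae_all_iff.2 fun v => P.vertex_conv v
  filter_upwards [hall] with ω hω
  obtain ⟨T0, T, hpath⟩ := P.star_path hm center hstar hα0 hα1 ω hω
  rw [tendsto_pi_nhds]
  intro i
  by_cases hα : α = 1
  · obtain ⟨h1, h2⟩ := hpath.limit_one hα
    by_cases hi : i = center
    · subst hi
      simpa [hα] using h1
    · simpa [hα, hi] using h2 ⟨i, hi⟩
  · obtain ⟨h1, h2⟩ := hpath.limit_lt (lt_of_le_of_ne hα1 hα)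
    by_cases hi : i = center
    · subst hi
      simpa only [if_neg hα, if_true] using h1
    · simpa only [if_neg hα, if_neg hi] using h2 ⟨i, hi⟩
end

section
/- Let G be the star graph with m ≥ 3 vertices, where vertices 1,…,m-1 are leaves each adjacent only to the center vertex m, and let α > 1. Then with positive probability x(n) converges to (0,…,0,1), and with positive probability x(n) converges to (1/(m-1),…,1/(m-1),0). -/
open MeasureTheory Filter Topology

open MeasureTheory Filter Topology

namespace GraphUrnAux

variable {m : ℕ} {G : SimpleGraph (Fin m)} [DecidableRel G.Adj] {α : ℝ}

/-- The event that the first `n` steps all follow the orientation `s`. -/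
def A (P : GraphUrn m G α) (s : Finset (Fin m × Fin m)) (n : ℕ) : Set P.Ω :=
  {ω | ∀ k < n, ∀ p ∈ s, P.δ (k + 1) p.1 p.2 ω = 1}

theorem A_meas (P : GraphUrn m G α) (s : Finset (Fin m × Fin m)) (n : ℕ) :
    MeasurableSet[P.ℱ n] (A P s n) := by
  have : A P s n = ⋂ k ∈ Finset.range n, ⋂ p ∈ s, (P.δ (k + 1) p.1 p.2) ⁻¹' {1} := by
    ext ω; simp [A]
  rw [this]
  refine Finset.measurableSet_biInter _ fun k hk => Finset.measurableSet_biInter _ fun p _ => ?_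
  have hk' : k + 1 ≤ n := by simpa using hk
  exact P.ℱ.mono hk' _ (P.δ_adapted (k + 1) p.1 p.2 (measurableSet_singleton 1))

theorem A_succ_eq (P : GraphUrn m G α) (s : Finset (Fin m × Fin m)) (n : ℕ) :
    A P s (n + 1) = A P s n ∩ {ω | ∀ p ∈ s, P.δ (n + 1) p.1 p.2 ω = 1} := by
  ext ω
  simp only [A, Set.mem_setOf_eq, Set.mem_inter_iff]
  constructor
  · intro h
    exact ⟨fun k hk => h k (by omega), h n (by omega)⟩
  · rintro ⟨h1, h2⟩ k hk
    rcases Nat.lt_succ_iff_lt_or_eq.mp hk with h | h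
    · exact h1 k h
    · subst h; exact h2

theorem factor_bound (hα : 1 < α) (n a b C : ℕ) (ha : n + 1 ≤ a) (hb : b ≤ C) :
    Real.exp (-((C : ℝ) ^ α * ((n + 1 : ℕ) : ℝ) ^ (-α))) ≤
      (a : ℝ) ^ α / ((a : ℝ) ^ α + (b : ℝ) ^ α) := by
  have hn : (0 : ℝ) < ((n + 1 : ℕ) : ℝ) := by positivity
  have ha0 : (0 : ℝ) < (a : ℝ) := by exact_mod_cast (by omega : 0 < a)
  have h1 : ((n + 1 : ℕ) : ℝ) ^ α ≤ (a : ℝ) ^ α :=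
    Real.rpow_le_rpow hn.le (by exact_mod_cast ha) (by linarith)
  have h2 : (b : ℝ) ^ α ≤ (C : ℝ) ^ α :=
    Real.rpow_le_rpow (Nat.cast_nonneg _) (by exact_mod_cast hb) (by linarith)
  have hN : 0 < ((n + 1 : ℕ) : ℝ) ^ α := Real.rpow_pos_of_pos hn _
  have hA : 0 < (a : ℝ) ^ α := Real.rpow_pos_of_pos ha0 _
  have hB : 0 ≤ (b : ℝ) ^ α := Real.rpow_nonneg (Nat.cast_nonneg _) _
  rw [Real.rpow_neg hn.le, Real.exp_neg, ← div_eq_mul_inv]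
  have h3 : (b : ℝ) ^ α / (a : ℝ) ^ α ≤ (C : ℝ) ^ α / ((n + 1 : ℕ) : ℝ) ^ α := by
    gcongr
  have h4 : (a : ℝ) ^ α / ((a : ℝ) ^ α + (b : ℝ) ^ α) = (1 + (b : ℝ) ^ α / (a : ℝ) ^ α)⁻¹ := by
    field_simp
  rw [h4]
  have h5 : 0 ≤ (b : ℝ) ^ α / (a : ℝ) ^ α := by positivity
  apply inv_anti₀ (by positivity)
  have := Real.add_one_le_exp ((C : ℝ) ^ α / ((n + 1 : ℕ) : ℝ) ^ α)
  linarith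

theorem step (hα : 1 < α) (P : GraphUrn m G α) (s : Finset (Fin m × Fin m))
    (hs : ∀ p ∈ s, G.Adj p.1 p.2)
    (hs2 : ∀ p ∈ s, ∀ q ∈ s, p ≠ q → (s(p.1, p.2) : Sym2 (Fin m)) ≠ s(q.1, q.2))
    (C n : ℕ)
    (hB : ∀ ω ∈ A P s n, ∀ p ∈ s, n + 1 ≤ P.B n p.1 ω ∧ P.B n p.2 ω ≤ C) :
    Real.exp (-(s.card * ((C : ℝ) ^ α * ((n + 1 : ℕ) : ℝ) ^ (-α)))) * P.μ.real (A P s n) ≤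
      P.μ.real (A P s (n + 1)) := by
  letI := P.mΩ
  haveI := P.isProb
  set q := Real.exp (-(s.card * ((C : ℝ) ^ α * ((n + 1 : ℕ) : ℝ) ^ (-α)))) with hq
  set f : P.Ω → ℝ := fun ω => ∏ p ∈ s, (P.δ (n + 1) p.1 p.2 ω : ℝ) with hf
  set D : Set P.Ω := {ω | ∀ p ∈ s, P.δ (n + 1) p.1 p.2 ω = 1} with hD
  have hDm : MeasurableSet D := by
    have : D = ⋂ p ∈ s, (P.δ (n + 1) p.1 p.2) ⁻¹' {1} := by
      ext ω; simp [hD]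
    rw [this]
    refine Finset.measurableSet_biInter _ fun p _ => ?_
    exact P.ℱ.le (n + 1) _ (P.δ_adapted (n + 1) p.1 p.2 (measurableSet_singleton 1))
  have hfD : f = D.indicator 1 := by
    ext ω
    by_cases h : ω ∈ D
    · rw [Set.indicator_of_mem h]
      simp only [hf, Pi.one_apply]
      exact Finset.prod_eq_one fun p hp => by rw [h p hp]; simp
    · rw [Set.indicator_of_notMem h]
      simp only [hD, Set.mem_setOf_eq, not_forall] at h
      obtain ⟨p, hp, hne⟩ := h
      refine Finset.prod_eq_zero hp ?_
      have := P.δ_sum (n + 1) p.1 p.2 (hs p hp) ω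
      have h0 : P.δ (n + 1) p.1 p.2 ω = 0 := by omega
      simp [h0]
  have hAm := A_meas P s n
  have hAm' : MeasurableSet (A P s n) := P.ℱ.le n _ hAm
  have hfi : Integrable f P.μ := by
    rw [hfD]; exact (integrable_const (1 : ℝ)).indicator hDm
  have e1 : ∫ ω in A P s n, (P.μ[f | P.ℱ n]) ω ∂P.μ = P.μ.real (A P s (n + 1)) := by
    rw [setIntegral_condExp (P.ℱ.le n) hfi hAm, hfD, integral_indicator_one hDm,
      A_succ_eq, measureReal_restrict_apply hDm, Set.inter_comm]
  rw [← e1]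
  have e2 : q * P.μ.real (A P s n) = ∫ ω in A P s n, q ∂P.μ := by
    simp [mul_comm]
  rw [e2]
  have hlaw : ∀ᵐ ω ∂P.μ, ∀ p ∈ s, (P.μ[fun ω => (P.δ (n + 1) p.1 p.2 ω : ℝ) | P.ℱ n]) ω =
      (P.B n p.1 ω : ℝ) ^ α / ((P.B n p.1 ω : ℝ) ^ α + (P.B n p.2 ω : ℝ) ^ α) := by
    have := (Finset.eventually_all s (l := ae P.μ)
      (p := fun p ω => (P.μ[fun ω => (P.δ (n + 1) p.1 p.2 ω : ℝ) | P.ℱ n]) ω =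
      (P.B n p.1 ω : ℝ) ^ α / ((P.B n p.1 ω : ℝ) ^ α + (P.B n p.2 ω : ℝ) ^ α))).2
      (fun p hp => P.cond_law n p.1 p.2 (hs p hp))
    exact this
  refine setIntegral_mono_on_ae (integrable_const q).integrableOn integrable_condExp.integrableOn
    hAm' ?_
  filter_upwards [P.cond_indep n s hs hs2, hlaw] with ω h1 h2 hω
  rw [h1, Finset.prod_congr rfl h2]
  have : q = ∏ p ∈ s, Real.exp (-((C : ℝ) ^ α * ((n + 1 : ℕ) : ℝ) ^ (-α))) := by
    rw [Finset.prod_const, ← Real.exp_nat_mul, hq]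
    congr 1; ring
  rw [this]
  exact Finset.prod_le_prod (fun _ _ => (Real.exp_pos _).le)
    fun p hp => factor_bound hα n _ _ C (hB ω hω p hp).1 (hB ω hω p hp).2

theorem main (hα : 1 < α) (P : GraphUrn m G α) (s : Finset (Fin m × Fin m))
    (hs : ∀ p ∈ s, G.Adj p.1 p.2)
    (hs2 : ∀ p ∈ s, ∀ q ∈ s, p ≠ q → (s(p.1, p.2) : Sym2 (Fin m)) ≠ s(q.1, q.2))
    (C : ℕ)
    (hB : ∀ n, ∀ ω ∈ A P s n, ∀ p ∈ s, n + 1 ≤ P.B n p.1 ω ∧ P.B n p.2 ω ≤ C) :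
    0 < P.μ (⋂ n, A P s n) := by
  letI := P.mΩ
  haveI := P.isProb
  set τ : ℕ → ℝ := fun n => s.card * ((C : ℝ) ^ α * ((n + 1 : ℕ) : ℝ) ^ (-α)) with hτ
  have hτ0 : ∀ n, 0 ≤ τ n := fun n => by simp only [hτ]; positivity
  have hsum : Summable τ := by
    apply Summable.mul_left
    apply Summable.mul_left
    exact (summable_nat_add_iff 1 (f := fun n : ℕ => (n : ℝ) ^ (-α))).2
      (Real.summable_nat_rpow.2 (by linarith))
  have hlow : ∀ n, Real.exp (-∑ k ∈ Finset.range n, τ k) ≤ P.μ.real (A P s n) := by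
    intro n
    induction n with
    | zero =>
      have : A P s 0 = Set.univ := by ext; simp [A]
      simp [this]
    | succ n ih =>
      refine le_trans ?_ (step hα P s hs hs2 C n (hB n))
      rw [Finset.sum_range_succ, neg_add, Real.exp_add, mul_comm]
      exact mul_le_mul_of_nonneg_left ih (Real.exp_pos _).le
  have hlow2 : ∀ n, Real.exp (-∑' k, τ k) ≤ P.μ.real (A P s n) := fun n =>
    le_trans (Real.exp_le_exp.2 (neg_le_neg (hsum.sum_le_tsum _ fun k _ => hτ0 k))) (hlow n)
  have hanti : Antitone (A P s) := fun a b hab ω h k hk => h k (by omega)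
  have hlim := tendsto_measure_iInter_atTop (μ := P.μ) (s := A P s)
    (fun n => (P.ℱ.le n _ (A_meas P s n)).nullMeasurableSet) hanti ⟨0, measure_ne_top _ _⟩
  have : ENNReal.ofReal (Real.exp (-∑' k, τ k)) ≤ P.μ (⋂ n, A P s n) := by
    refine ge_of_tendsto' hlim fun n => ?_
    exact ENNReal.ofReal_le_of_le_toReal (hlow2 n)
  exact lt_of_lt_of_le (ENNReal.ofReal_pos.2 (Real.exp_pos _)) this

theorem card_edges (hm : 3 ≤ m) (center : Fin m)
    (hstar : ∀ i j, G.Adj i j ↔ i ≠ j ∧ (i = center ∨ j = center)) :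
    G.edgeFinset.card = m - 1 := by
  have : G.edgeFinset = (Finset.univ.erase center).image (fun i => s(center, i)) := by
    ext e
    induction e using Sym2.ind with
    | _ a b =>
      simp only [SimpleGraph.mem_edgeFinset, SimpleGraph.mem_edgeSet, hstar, Finset.mem_image,
        Finset.mem_erase, Finset.mem_univ, and_true, Sym2.eq_iff]
      constructor
      · rintro ⟨h, rfl | rfl⟩
        · exact ⟨b, h.symm, Or.inl ⟨rfl, rfl⟩⟩
        · exact ⟨a, h, Or.inr ⟨rfl, rfl⟩⟩
      · rintro ⟨i, hi, ⟨rfl, rfl⟩ | ⟨rfl, rfl⟩⟩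
        · exact ⟨hi.symm, Or.inl rfl⟩
        · exact ⟨hi, Or.inr rfl⟩
  rw [this, Finset.card_image_of_injective]
  · simp
  · intro a b h
    have h' : a = b ∨ center = b ∧ a = center := by simpa using h
    rcases h' with h' | ⟨h1, h2⟩
    · exact h'
    · rw [h2, h1]

theorem nbr_center (center : Fin m)
    (hstar : ∀ i j, G.Adj i j ↔ i ≠ j ∧ (i = center ∨ j = center)) :
    G.neighborFinset center = Finset.univ.erase center := by
  ext j
  simp [hstar, eq_comm]

theorem nbr_leaf (center i : Fin m) (hi : i ≠ center)
    (hstar : ∀ i j, G.Adj i j ↔ i ≠ j ∧ (i = center ∨ j = center)) :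
    G.neighborFinset i = {center} := by
  ext j
  simp only [SimpleGraph.mem_neighborFinset, hstar, Finset.mem_singleton]
  constructor
  · rintro ⟨_, h | h⟩
    · exact absurd h hi
    · exact h
  · rintro rfl
    exact ⟨hi, Or.inr rfl⟩

theorem tendsto_ratio (a b c d : ℝ) (hd : 0 < d) :
    Tendsto (fun n : ℕ => (a + n * c) / (b + n * d)) atTop (𝓝 (c / d)) := by
  have h0 : Tendsto (fun n : ℕ => (n : ℝ)⁻¹) atTop (𝓝 0) := tendsto_inv_atTop_nhds_zero_nat
  have h : Tendsto (fun n : ℕ => (a * (n : ℝ)⁻¹ + c) / (b * (n : ℝ)⁻¹ + d)) atTop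
      (𝓝 ((a * 0 + c) / (b * 0 + d))) :=
    ((h0.const_mul a).add_const c).div ((h0.const_mul b).add_const d) (by simpa using hd.ne')
  simp only [mul_zero, zero_add] at h
  refine h.congr' ?_
  filter_upwards [eventually_gt_atTop 0] with n hn
  have hn' : (n : ℝ) ≠ 0 := by exact_mod_cast hn.ne'
  rw [← mul_div_mul_right _ (b * (n : ℝ)⁻¹ + d) hn']
  congr 1 <;> field_simp

/-- Behaviour of the proportions when each bin grows linearly. -/
theorem tendsto_x (hm : 3 ≤ m) (center : Fin m)
    (hstar : ∀ i j, G.Adj i j ↔ i ≠ j ∧ (i = center ∨ j = center))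
    (P : GraphUrn m G α) (ω : P.Ω) (c : Fin m → ℕ)
    (h : ∀ n i, P.B n i ω = P.B 0 i ω + n * c i) :
    Tendsto (fun n => P.x n ω) atTop (𝓝 (fun i => (c i : ℝ) / ((m : ℝ) - 1))) := by
  rw [tendsto_pi_nhds]
  intro i
  have hm' : (0 : ℝ) < (m : ℝ) - 1 := by
    have : (3 : ℝ) ≤ m := by exact_mod_cast hm
    linarith
  refine (tendsto_ratio (P.B 0 i ω) ((∑ j, P.B 0 j ω : ℕ) : ℝ) (c i) _ hm').congr fun n => ?_
  simp only [GraphUrn.x, card_edges hm center hstar, h n i]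
  rw [Nat.cast_add, Nat.cast_add, Nat.cast_mul, Nat.cast_mul, Nat.cast_sub (by omega),
    Nat.cast_one]

end GraphUrnAux

/-- **Theorem 5(b).** For the star graph with `m ≥ 3` vertices (center `m`) and `α > 1`,
with positive probability `x(n)` converges to `(0, …, 0, 1)`, and with positive probability
`x(n)` converges to `(1/(m-1), …, 1/(m-1), 0)`. -/
theorem polya_urn_star_alpha_gt_one
    {m : ℕ} (hm : 3 ≤ m) {G : SimpleGraph (Fin m)} [DecidableRel G.Adj]
    (center : Fin m) (hcenter : (center : ℕ) = m - 1)
    (hstar : ∀ i j, G.Adj i j ↔ i ≠ j ∧ (i = center ∨ j = center))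
    {α : ℝ} (hα : 1 < α) (P : GraphUrn m G α) :
    0 < P.μ {ω | Tendsto (fun n => P.x n ω) atTop
        (𝓝 (fun i => if i = center then (1 : ℝ) else 0))} ∧
    0 < P.μ {ω | Tendsto (fun n => P.x n ω) atTop
        (𝓝 (fun i => if i = center then (0 : ℝ) else 1 / ((m : ℝ) - 1)))} := by
  letI := P.mΩ
  haveI := P.isProb
  obtain ⟨ω₀⟩ : Nonempty P.Ω := nonempty_of_isProbabilityMeasure P.μ
  have hm' : (m : ℝ) - 1 ≠ 0 := by
    have : (3 : ℝ) ≤ m := by exact_mod_cast hm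
    linarith
  have hle : ∀ i ω, P.B 0 i ω ≤ ∑ j, P.B 0 j ω₀ := fun i ω => by
    rw [P.B0_det i ω ω₀]
    exact Finset.single_le_sum (f := fun j => P.B 0 j ω₀) (fun _ _ => Nat.zero_le _)
      (Finset.mem_univ i)
  constructor
  · set s : Finset (Fin m × Fin m) := (Finset.univ.erase center).image (fun i => (center, i))
      with hs
    have hmem : ∀ i, i ≠ center → (center, i) ∈ s := fun i hi => by
      simp [hs, hi]
    have hgrow : ∀ n, ∀ ω ∈ GraphUrnAux.A P s n, ∀ i,
        P.B n i ω = P.B 0 i ω + n * (if i = center then m - 1 else 0) := by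
      intro n
      induction n with
      | zero => simp
      | succ n ih =>
        intro ω hω i
        rw [GraphUrnAux.A_succ_eq] at hω
        rw [P.B_succ, ih ω hω.1 i]
        by_cases hi : i = center
        · subst hi
          rw [GraphUrnAux.nbr_center i hstar, Finset.sum_congr rfl (g := fun _ => 1)]
          · simp; ring
          · intro j hj
            exact hω.2 _ (hmem j (Finset.ne_of_mem_erase hj))
        · rw [GraphUrnAux.nbr_leaf center i hi hstar]
          have h1 := hω.2 _ (hmem i hi)
          have h2 := P.δ_sum (n + 1) center i ((hstar _ _).2 ⟨Ne.symm hi, Or.inl rfl⟩) ω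
          simp only at h1
          simp [hi]
          omega
    refine lt_of_lt_of_le (GraphUrnAux.main hα P s ?_ ?_ (∑ j, P.B 0 j ω₀) ?_)
      (measure_mono fun ω hω => ?_)
    · intro p hp
      simp only [hs, Finset.mem_image, Finset.mem_erase] at hp
      obtain ⟨i, ⟨hi, -⟩, rfl⟩ := hp
      exact (hstar _ _).2 ⟨Ne.symm hi, Or.inl rfl⟩
    · intro p hp q hq hpq h
      simp only [hs, Finset.mem_image, Finset.mem_erase] at hp hq
      obtain ⟨i, ⟨hi, -⟩, rfl⟩ := hp
      obtain ⟨j, ⟨hj, -⟩, rfl⟩ := hq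
      apply hpq
      have h' : i = j ∨ center = j ∧ i = center := by simpa using h
      rcases h' with h' | h'
      · rw [h']
      · exact absurd h'.2 hi
    · intro n ω hω p hp
      simp only [hs, Finset.mem_image, Finset.mem_erase] at hp
      obtain ⟨i, ⟨hi, -⟩, rfl⟩ := hp
      rw [hgrow n ω hω, hgrow n ω hω]
      simp only [hi, if_true, if_false, mul_zero, add_zero]
      refine ⟨?_, hle i ω⟩
      have := P.B0_pos center ω
      have : n * 1 ≤ n * (m - 1) := Nat.mul_le_mul_left n (by omega)
      omega
    · have := GraphUrnAux.tendsto_x hm center hstar P ω _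
        (fun n i => hgrow n ω (Set.mem_iInter.1 hω n) i)
      refine this.trans (le_of_eq ?_)
      congr 1
      ext i
      by_cases hi : i = center
      · simp only [hi, if_true]
        rw [Nat.cast_sub (by omega), Nat.cast_one, div_self hm']
      · simp [hi]
  · set s : Finset (Fin m × Fin m) := (Finset.univ.erase center).image (fun i => (i, center))
      with hs
    have hmem : ∀ i, i ≠ center → (i, center) ∈ s := fun i hi => by
      simp [hs, hi]
    have hgrow : ∀ n, ∀ ω ∈ GraphUrnAux.A P s n, ∀ i,
        P.B n i ω = P.B 0 i ω + n * (if i = center then 0 else 1) := by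
      intro n
      induction n with
      | zero => simp
      | succ n ih =>
        intro ω hω i
        rw [GraphUrnAux.A_succ_eq] at hω
        rw [P.B_succ, ih ω hω.1 i]
        by_cases hi : i = center
        · subst hi
          rw [GraphUrnAux.nbr_center i hstar, Finset.sum_congr rfl (g := fun _ => 0)]
          · simp
          · intro j hj
            have hj := Finset.ne_of_mem_erase hj
            have h1 := hω.2 _ (hmem j hj)
            have h2 := P.δ_sum (n + 1) j i ((hstar _ _).2 ⟨hj, Or.inr rfl⟩) ω
            simp only at h1
            omega
        · rw [GraphUrnAux.nbr_leaf center i hi hstar]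
          have h1 := hω.2 _ (hmem i hi)
          simp only at h1
          simp [hi]
          omega
    refine lt_of_lt_of_le (GraphUrnAux.main hα P s ?_ ?_ (∑ j, P.B 0 j ω₀) ?_)
      (measure_mono fun ω hω => ?_)
    · intro p hp
      simp only [hs, Finset.mem_image, Finset.mem_erase] at hp
      obtain ⟨i, ⟨hi, -⟩, rfl⟩ := hp
      exact (hstar _ _).2 ⟨hi, Or.inr rfl⟩
    · intro p hp q hq hpq h
      simp only [hs, Finset.mem_image, Finset.mem_erase] at hp hq
      obtain ⟨i, ⟨hi, -⟩, rfl⟩ := hp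
      obtain ⟨j, ⟨hj, -⟩, rfl⟩ := hq
      apply hpq
      have h' : i = j ∨ i = center ∧ center = j := by simpa using h
      rcases h' with h' | h'
      · rw [h']
      · exact absurd h'.1 hi
    · intro n ω hω p hp
      simp only [hs, Finset.mem_image, Finset.mem_erase] at hp
      obtain ⟨i, ⟨hi, -⟩, rfl⟩ := hp
      rw [hgrow n ω hω, hgrow n ω hω]
      simp only [hi, if_true, if_false, mul_zero, add_zero]
      refine ⟨?_, hle center ω⟩
      have := P.B0_pos i ω
      omega
    · have := GraphUrnAux.tendsto_x hm center hstar P ω _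
        (fun n i => hgrow n ω (Set.mem_iInter.1 hω n) i)
      refine this.trans (le_of_eq ?_)
      congr 1
      ext i
      by_cases hi : i = center
      · simp [hi]
      · simp [hi]
end

section
/- The image L(Λ) ⊂ ℝ of the equilibria set Λ under the Lyapunov function L has zero Lebesgue measure; in particular L(Λ) has empty interior. -/
open MeasureTheory Filter Topology

/-- The domain `Δ`: nonnegative vectors summing to `1` whose coordinates sum to at least `c`
on every edge of `G`. -/
def simplexDomain (m : ℕ) (G : SimpleGraph (Fin m)) (c : ℝ) : Set (Fin m → ℝ) :=
  {x | (∀ i, 0 ≤ x i) ∧ (∑ i, x i) = 1 ∧ ∀ i j, G.Adj i j → c ≤ x i + x j}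

/-- The vector field `F` of the urn process:
`F_i(x) = -x_i + (1/N) ∑_{j ∼ i} x_i^α / (x_i^α + x_j^α)`. -/
noncomputable def urnField (m : ℕ) (G : SimpleGraph (Fin m)) [DecidableRel G.Adj] (α : ℝ)
    (x : Fin m → ℝ) : Fin m → ℝ :=
  fun i => -x i + (1 / (G.edgeFinset.card : ℝ)) *
    ∑ j ∈ G.neighborFinset i, x i ^ α / (x i ^ α + x j ^ α)

/-- The equilibria set `Λ` of the vector field `F` on `Δ`. -/
def equilibria (m : ℕ) (G : SimpleGraph (Fin m)) [DecidableRel G.Adj] (α c : ℝ) :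
    Set (Fin m → ℝ) :=
  {x ∈ simplexDomain m G c | urnField m G α x = 0}

/-- The strict Lyapunov function
`L(v) = -∑ i, v i + (1/(αN)) ∑_{{i,j} ∈ E} log (v_i^α + v_j^α)`. -/
noncomputable def lyap (m : ℕ) (G : SimpleGraph (Fin m)) [DecidableRel G.Adj] (α : ℝ)
    (v : Fin m → ℝ) : ℝ :=
  -∑ i, v i + (1 / (α * (G.edgeFinset.card : ℝ))) *
    ∑ e ∈ G.edgeFinset,
      Sym2.lift ⟨fun i j => Real.log (v i ^ α + v j ^ α), fun _ _ => congrArg Real.log (add_comm _ _)⟩ e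

open scoped ContDiff

namespace LyapSard

/-- Taylor-type bound at a point where the derivatives of orders `1..n` vanish. -/
theorem taylor_bound {E : Type} [NormedAddCommGroup E] [NormedSpace ℝ E] (a : E) (r M : ℝ)
    (x : E) (hx : x ∈ Metric.ball a r) (n : ℕ) :
    ∀ (F : Type) [NormedAddCommGroup F] [NormedSpace ℝ F] (g : E → F),
      (∀ y ∈ Metric.ball a r, ContDiffAt ℝ (n + 1 : ℕ) g y) →
      (∀ k, 1 ≤ k → k ≤ n → iteratedFDeriv ℝ k g x = 0) →
      (∀ y ∈ Metric.ball a r, ‖iteratedFDeriv ℝ (n + 1) g y‖ ≤ M) →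
      ∀ y ∈ Metric.ball a r, ‖g y - g x‖ ≤ M * ‖y - x‖ ^ (n + 1) := by
  induction n with
  | zero =>
    intro F _ _ g hg h0 hM y hy
    have := (convex_ball a r).norm_image_sub_le_of_norm_fderiv_le (𝕜 := ℝ) (f := g) (C := M)
      (fun z hz => (hg z hz).differentiableAt (by simp)) (fun z hz => by
        have := hM z hz
        rwa [zero_add, norm_iteratedFDeriv_one] at this) hx hy
    simpa using this
  | succ n ih =>
    intro F _ _ g hg h0 hM y hy
    have key := ih (E →L[ℝ] F) (fderiv ℝ g)
      (fun y hy => (hg y hy).fderiv_right (by norm_cast))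
      (fun k hk hk' => by
        rw [← norm_eq_zero, norm_iteratedFDeriv_fderiv, h0 (k + 1) (by lia) (by lia), norm_zero])
      (fun y hy => by rw [norm_iteratedFDeriv_fderiv]; exact hM y hy)
    have hx0 : fderiv ℝ g x = 0 := by
      rw [← norm_eq_zero, ← norm_iteratedFDeriv_one, h0 1 le_rfl (by lia), norm_zero]
    have hM0 : 0 ≤ M := (norm_nonneg _).trans (hM x hx)
    have hseg : segment ℝ x y ⊆ Metric.ball a r := (convex_ball a r).segment_subset hx hy
    have := (convex_segment x y).norm_image_sub_le_of_norm_fderiv_le (𝕜 := ℝ) (f := g)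
      (C := M * ‖y - x‖ ^ (n + 1))
      (fun z hz => (hg z (hseg hz)).differentiableAt (by simp)) (fun z hz => by
        have h1 := key z (hseg hz)
        rw [hx0, sub_zero] at h1
        refine h1.trans ?_
        gcongr
        obtain ⟨t, ht, rfl⟩ := (segment_eq_image' ℝ x y ▸ hz)
        simp only [add_sub_cancel_left, norm_smul, Real.norm_eq_abs, abs_of_nonneg ht.1]
        exact mul_le_of_le_one_left (norm_nonneg _) ht.2)
      (left_mem_segment ℝ x y) (right_mem_segment ℝ x y)
    rw [pow_succ, ← mul_assoc]
    exact this

theorem null_of_local {E : Type} [TopologicalSpace E] [SecondCountableTopology E]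
    (f : E → ℝ) (A : Set E) (h : ∀ x ∈ A, ∃ V ∈ 𝓝 x, volume (f '' (A ∩ V)) = 0) :
    volume (f '' A) = 0 := by
  have := measure_null_of_locally_null (μ := OuterMeasure.comap f (volume : Measure ℝ).toOuterMeasure)
    A (fun x hx => by
      obtain ⟨V, hV, h0⟩ := h x hx
      exact ⟨A ∩ V, inter_mem_nhdsWithin A hV, by simpa using h0⟩)
  simpa using this

/-- The flat part. -/
theorem flat_null {E : Type} [NormedAddCommGroup E] [NormedSpace ℝ E] [FiniteDimensional ℝ E]
    (f : E → ℝ) (A : Set E)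
    (hA : ∀ x ∈ A, ContDiffAt ℝ ω f x)
    (h0 : ∀ x ∈ A, ∀ k, 1 ≤ k → k ≤ Module.finrank ℝ E → iteratedFDeriv ℝ k f x = 0) :
    volume (f '' A) = 0 := by
  set n := Module.finrank ℝ E with hn
  have hd : dimH (f '' A) ≤ dimH A / ((n + 1 : ℕ) : NNReal) := by
    refine dimH_image_le_of_locally_holder_on (by positivity) fun x hx => ?_
    have hc : ContDiffAt ℝ ω (iteratedFDeriv ℝ (n + 1) f) x :=
      (hA x hx).iteratedFDeriv_right (by simp)
    have hM : ∀ᶠ y in 𝓝 x, ‖iteratedFDeriv ℝ (n + 1) f y‖ < ‖iteratedFDeriv ℝ (n + 1) f x‖ + 1 :=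
      hc.continuousAt.norm.eventually_lt_const (by simp)
    obtain ⟨r, hr, hball⟩ := Metric.eventually_nhds_iff_ball.1
      (hM.and ((hA x hx).eventually (by simp)))
    refine ⟨‖iteratedFDeriv ℝ (n + 1) f x‖₊ + 1, A ∩ Metric.ball x r,
      inter_mem_nhdsWithin A (Metric.ball_mem_nhds x hr), ?_⟩
    intro y hy z hz
    have := taylor_bound x r (‖iteratedFDeriv ℝ (n + 1) f x‖ + 1) z hz.2 n ℝ f
      (fun u hu => (hball u hu).2.of_le le_top) (h0 z hz.1) (fun u hu => (hball u hu).1.le) y hy.2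
    rw [edist_nndist, edist_nndist, ← ENNReal.coe_rpow_of_nonneg _ (by positivity),
      ← ENNReal.coe_mul, ENNReal.coe_le_coe, ← NNReal.coe_le_coe]
    push_cast
    rw [← Nat.cast_succ, Real.rpow_natCast, dist_eq_norm, dist_eq_norm]
    exact this
  have hlt : dimH (f '' A) < ((1 : NNReal) : ENNReal) := by
    refine hd.trans_lt ?_
    have h1 : dimH A ≤ n := by
      rw [hn, ← Real.dimH_univ_eq_finrank E]; exact dimH_mono (Set.subset_univ _)
    refine (ENNReal.div_le_div_right h1 _).trans_lt ?_
    rw [ENNReal.div_lt_iff (by simp) (by simp)]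
    simp only [ENNReal.coe_one, one_mul]
    norm_cast
    lia
  have := hausdorffMeasure_of_dimH_lt hlt
  simpa [hausdorffMeasure_real] using this

/-- The claim of Sard's theorem in dimension `n`. -/
def SardIn (n : ℕ) : Prop :=
  ∀ (E : Type) [NormedAddCommGroup E] [NormedSpace ℝ E] [FiniteDimensional ℝ E],
    Module.finrank ℝ E = n → ∀ (f : E → ℝ) (A : Set E),
      (∀ x ∈ A, ContDiffAt ℝ ω f x) → (∀ x ∈ A, fderiv ℝ f x = 0) → volume (f '' A) = 0

theorem hypersurface_null {n : ℕ} (ih : SardIn n) {E : Type} [NormedAddCommGroup E]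
    [NormedSpace ℝ E] [FiniteDimensional ℝ E] (hE : Module.finrank ℝ E = n + 1)
    (f : E → ℝ) (A : Set E)
    (hA : ∀ x ∈ A, ContDiffAt ℝ ω f x) (hA' : ∀ x ∈ A, fderiv ℝ f x = 0)
    (w : E → ℝ) (x : E) (hw : ContDiffAt ℝ ω w x) (hw' : fderiv ℝ w x ≠ 0)
    (hw0 : ∀ y ∈ A, w y = w x) :
    ∃ V ∈ 𝓝 x, volume (f '' (A ∩ V)) = 0 := by
  have : CompleteSpace E := FiniteDimensional.complete ℝ E
  have hs : HasStrictFDerivAt w (fderiv ℝ w x) x := hw.hasStrictFDerivAt (by simp)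
  have hr : (fderiv ℝ w x).range = ⊤ := by
    refine LinearMap.range_eq_top.2 (LinearMap.surjective ?_)
    intro h
    exact hw' (by ext v; exact congrArg (fun l : E →ₗ[ℝ] ℝ => l v) h)
  have hk : (fderiv ℝ w x).ker.ClosedComplemented :=
    (fderiv ℝ w x).ker_closedComplemented_of_finiteDimensional_range
  let φ := hs.implicitFunctionDataOfComplemented w (fderiv ℝ w x) hr hk
  have hrc : ContDiff ℝ ω φ.rightFun := by
    change ContDiff ℝ ω (fun y => Classical.choose hk (y - x))
    fun_prop
  have hg := φ.contDiffAt_implicitFunction (n := ω) hw hrc.contDiffAt (by simp)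
  let g : (fderiv ℝ w x).ker → E := φ.implicitFunction (w x)
  have hg' : ContDiffAt ℝ ω g (φ.rightFun x) := by
    have : ContDiffAt ℝ ω (fun z : (fderiv ℝ w x).ker => (w x, z)) (φ.rightFun x) := by fun_prop
    exact ContDiffAt.comp (g := Function.uncurry φ.implicitFunction) (φ.rightFun x) hg this
  have hgev := hrc.continuous.continuousAt.eventually (hg'.eventually (by simp))
  refine ⟨_, Filter.inter_mem hgev φ.leftFun_eq_iff_implicitFunction, ?_⟩
  set V := ({y | ContDiffAt ℝ ω g (φ.rightFun y)} ∩ {y | φ.leftFun y = φ.leftFun φ.pt ↔ φ.implicitFunction (φ.leftFun φ.pt) (φ.rightFun y) = y}) with hV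
  have hVg : ∀ y ∈ A ∩ V, g (φ.rightFun y) = y := fun y hy => hy.2.2.1 (hw0 y hy.1)
  have hfin : Module.finrank ℝ (fderiv ℝ w x).ker = n := by
    have h1 := LinearMap.finrank_range_add_finrank_ker (fderiv ℝ w x : E →ₗ[ℝ] ℝ)
    have h2 : LinearMap.range (fderiv ℝ w x : E →ₗ[ℝ] ℝ) = ⊤ := hr
    rw [h2, finrank_top, Module.finrank_self, hE] at h1
    exact Nat.add_left_cancel (h1.trans (add_comm _ _))
  have := ih (fderiv ℝ w x).ker hfin (f ∘ g) (φ.rightFun '' (A ∩ V))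
    (by
      rintro _ ⟨y, hy, rfl⟩
      refine ContDiffAt.comp _ ?_ hy.2.1
      rw [hVg y hy]; exact hA y hy.1)
    (by
      rintro _ ⟨y, hy, rfl⟩
      have hy1 : ContDiffAt ℝ ω f (g (φ.rightFun y)) := by rw [hVg y hy]; exact hA y hy.1
      have hy2 : ContDiffAt ℝ ω g (φ.rightFun y) := hy.2.1
      rw [fderiv_comp _ (hy1.differentiableAt (by simp)) (hy2.differentiableAt (by simp)),
        hVg y hy, hA' y hy.1, ContinuousLinearMap.zero_comp])
  refine measure_mono_null ?_ this
  rintro _ ⟨y, hy, rfl⟩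
  exact ⟨φ.rightFun y, ⟨y, hy, rfl⟩, by simp [hVg y hy]⟩

theorem sardIn (n : ℕ) : SardIn n := by
  induction n with
  | zero =>
    intro E _ _ _ hE f A hA hA'
    exact flat_null f A hA (fun x _ k h1 h2 => by lia)
  | succ n ih =>
    intro E _ _ _ hE f A hA hA'
    let B : ℕ → Set E := fun j => {x ∈ A | iteratedFDeriv ℝ j f x = 0 ∧ iteratedFDeriv ℝ (j + 1) f x ≠ 0}
    let C : Set E := {x ∈ A | ∀ k, 1 ≤ k → iteratedFDeriv ℝ k f x = 0}
    have hcov : A ⊆ C ∪ ⋃ j, B j := by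
      intro x hx
      by_cases h : ∃ j, x ∈ B j
      · exact Or.inr (Set.mem_iUnion.2 h)
      · refine Or.inl ⟨hx, fun k hk => ?_⟩
        induction k, hk using Nat.le_induction with
        | base => rw [← norm_eq_zero, norm_iteratedFDeriv_one, hA' x hx, norm_zero]
        | succ k hk ihk =>
          by_contra hne
          exact h ⟨k, hx, ihk, hne⟩
    refine measure_mono_null (Set.image_mono hcov) ?_
    rw [Set.image_union, Set.image_iUnion]
    refine measure_union_null ?_ (measure_iUnion_null fun j => ?_)
    · exact flat_null f C (fun x hx => hA x hx.1) (fun x hx k hk _ => hx.2 k hk)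
    · refine null_of_local f (B j) fun x hx => ?_
      have hc : ContDiffAt ℝ ω (iteratedFDeriv ℝ j f) x :=
        (hA x hx.1).iteratedFDeriv_right (by simp)
      obtain ⟨m, hm⟩ : ∃ m, iteratedFDeriv ℝ (j + 1) f x m ≠ 0 := by
        by_contra hcon
        push Not at hcon
        exact hx.2.2 (by ext m; simpa using hcon m)
      refine hypersurface_null ih hE f (B j) (fun y hy => hA y hy.1) (fun y hy => hA' y hy.1)
        (fun y => iteratedFDeriv ℝ j f y (Fin.tail m)) x ?_ ?_ ?_
      · exact (ContinuousMultilinearMap.apply ℝ (fun _ : Fin j => E) ℝ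
          (Fin.tail m)).contDiff.contDiffAt.comp x hc
      · intro h0
        apply hm
        rw [(hc.differentiableAt (by simp)).iteratedFDeriv_succ_apply_left', h0]
        simp
      · intro y hy
        simp only [hy.2.1, hx.2.1]

theorem sum_edges {m : ℕ} (G : SimpleGraph (Fin m)) [DecidableRel G.Adj] (φ : Fin m → Fin m → ℝ)
    (hφ : ∀ i j, φ i j = φ j i) :
    ∑ e ∈ G.edgeFinset, Sym2.lift ⟨φ, hφ⟩ e
      = (1 / 2) * ∑ i, ∑ j ∈ G.neighborFinset i, φ i j := by
  have h1 : ∑ d : G.Dart, φ d.fst d.snd = 2 * ∑ e ∈ G.edgeFinset, Sym2.lift ⟨φ, hφ⟩ e := by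
    rw [← Finset.sum_fiberwise_of_maps_to (s := Finset.univ) (t := G.edgeFinset)
      (g := fun d : G.Dart => d.edge) (fun d _ => by
        rw [SimpleGraph.mem_edgeFinset]; exact d.edge_mem), Finset.mul_sum]
    refine Finset.sum_congr rfl fun e he => ?_
    have h2 : ∀ d ∈ (Finset.univ.filter fun d : G.Dart => d.edge = e),
        φ d.fst d.snd = Sym2.lift ⟨φ, hφ⟩ e := by
      intro d hd
      rw [← (Finset.mem_filter.1 hd).2]
      rfl
    rw [Finset.sum_congr rfl h2, Finset.sum_const,
      G.dart_edge_fiber_card e (SimpleGraph.mem_edgeFinset.1 he)]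
    simp
  have h3 : ∑ d : G.Dart, φ d.fst d.snd = ∑ i, ∑ j ∈ G.neighborFinset i, φ i j := by
    rw [Finset.sum_sigma']
    refine Finset.sum_bij' (fun d _ => (⟨d.fst, d.snd⟩ : (_ : Fin m) × Fin m))
      (fun p hp => ⟨(p.1, p.2), by simpa using hp⟩) ?_ ?_ ?_ ?_ ?_
    · intro d _; simpa using d.adj
    · intros; simp
    · intros; rfl
    · intros; rfl
    · intros; rfl
  rw [← h3, h1]; ring

/-- `v_i ^ α` on the support `S`, and `0` off it. -/
noncomputable def powOn {m : ℕ} (α : ℝ) (S : Finset (Fin m)) (i : Fin m) (v : Fin m → ℝ) : ℝ :=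
  if i ∈ S then v i ^ α else 0

/-- The Lyapunov function on the face with support `S`. -/
noncomputable def faceLyap {m : ℕ} (G : SimpleGraph (Fin m)) [DecidableRel G.Adj] (α : ℝ)
    (S : Finset (Fin m)) (v : Fin m → ℝ) : ℝ :=
  -∑ i, (if i ∈ S then v i else 0) + (1 / (α * (G.edgeFinset.card : ℝ))) *
    ((1 / 2) * ∑ i, ∑ j ∈ G.neighborFinset i, Real.log (powOn α S i v + powOn α S j v))

/-- Equilibria with support `S`. -/
def faceEq {m : ℕ} (G : SimpleGraph (Fin m)) [DecidableRel G.Adj] (α c : ℝ)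
    (S : Finset (Fin m)) : Set (Fin m → ℝ) :=
  {x ∈ equilibria m G α c | ∀ i, i ∈ S ↔ x i ≠ 0}

section face
variable {m : ℕ} {G : SimpleGraph (Fin m)} [DecidableRel G.Adj] {α c : ℝ}
  {S : Finset (Fin m)} {x : Fin m → ℝ}

theorem powOn_eq (hα : 0 < α) (hx : x ∈ faceEq G α c S) (i : Fin m) :
    powOn α S i x = x i ^ α := by
  unfold powOn
  split_ifs with h
  · rfl
  · have : x i = 0 := by simpa [hx.2 i] using h
    rw [this, Real.zero_rpow hα.ne']

theorem powOn_pos (hα : 0 < α) (hc : 0 < c) (hx : x ∈ faceEq G α c S) {i j : Fin m}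
    (hij : G.Adj i j) : 0 < powOn α S i x + powOn α S j x := by
  rw [powOn_eq hα hx, powOn_eq hα hx]
  obtain ⟨h0, -, h2⟩ := hx.1.1
  have := h2 i j hij
  rcases (h0 i).lt_or_eq with h | h
  · exact add_pos_of_pos_of_nonneg (Real.rpow_pos_of_pos h _) (Real.rpow_nonneg (h0 j) _)
  · exact add_pos_of_nonneg_of_pos (Real.rpow_nonneg (h0 i) _)
      (Real.rpow_pos_of_pos (by linarith) _)

theorem faceLyap_eq (hα : 0 < α) (hx : x ∈ faceEq G α c S) :
    faceLyap G α S x = lyap m G α x := by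
  unfold faceLyap lyap
  rw [sum_edges]
  simp only [powOn_eq hα hx]
  congr 2
  refine Finset.sum_congr rfl fun i _ => ?_
  split_ifs with h
  · rfl
  · have : x i = 0 := by simpa [hx.2 i] using h
    exact this.symm

theorem powOn_contDiffAt (hx : x ∈ faceEq G α c S) (i : Fin m) :
    ContDiffAt ℝ ω (powOn α S i) x := by
  by_cases h : i ∈ S
  · have : powOn α S i = fun v => v i ^ α := by funext v; simp [powOn, h]
    rw [this]
    exact ContDiffAt.rpow_const_of_ne (by fun_prop) ((hx.2 i).1 h)
  · have : powOn α S i = fun v => 0 := by funext v; simp [powOn, h]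
    rw [this]
    exact contDiffAt_const

/-- derivative of `powOn`. -/
noncomputable def powD (α : ℝ) (S : Finset (Fin m)) (x : Fin m → ℝ) (i : Fin m) :
    (Fin m → ℝ) →L[ℝ] ℝ :=
  if i ∈ S then (α * x i ^ (α - 1)) • ContinuousLinearMap.proj i else 0

theorem powOn_hasFDerivAt (hx : x ∈ faceEq G α c S) (i : Fin m) :
    HasFDerivAt (powOn α S i) (powD α S x i) x := by
  by_cases h : i ∈ S
  · have : powOn α S i = fun v => v i ^ α := by funext v; simp [powOn, h]
    rw [this]
    simp only [powD, h, if_true]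
    exact (hasFDerivAt_apply i x).rpow_const (Or.inl ((hx.2 i).1 h))
  · have : powOn α S i = fun v => 0 := by funext v; simp [powOn, h]
    rw [this]
    simp only [powD, h, if_false]
    exact hasFDerivAt_const _ _

theorem faceLyap_contDiffAt (hα : 0 < α) (hc : 0 < c) (hx : x ∈ faceEq G α c S) :
    ContDiffAt ℝ ω (faceLyap G α S) x := by
  unfold faceLyap
  refine ContDiffAt.add (ContDiffAt.neg (ContDiffAt.sum fun i _ => ?_))
    (contDiffAt_const.mul (contDiffAt_const.mul (ContDiffAt.sum fun i _ =>
      ContDiffAt.sum fun j hj => ?_)))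
  · split_ifs
    · fun_prop
    · exact contDiffAt_const
  · exact ((powOn_contDiffAt hx i).add (powOn_contDiffAt hx j)).log
      (powOn_pos hα hc hx (by simpa using hj)).ne'

/-- derivative of the coordinate on the face. -/
noncomputable def coordD (S : Finset (Fin m)) (i : Fin m) : (Fin m → ℝ) →L[ℝ] ℝ :=
  if i ∈ S then ContinuousLinearMap.proj i else 0

theorem faceLyap_fderiv (hα : 0 < α) (hc : 0 < c) (hx : x ∈ faceEq G α c S) :
    fderiv ℝ (faceLyap G α S) x = 0 := by
  have hd : HasFDerivAt (faceLyap G α S)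
      (-∑ i, coordD S i + (1 / (α * (G.edgeFinset.card : ℝ))) •
        ((1 / 2 : ℝ) • ∑ i, ∑ j ∈ G.neighborFinset i,
          (powOn α S i x + powOn α S j x)⁻¹ • (powD α S x i + powD α S x j))) x := by
    unfold faceLyap
    refine HasFDerivAt.add (HasFDerivAt.neg (HasFDerivAt.fun_sum fun i _ => ?_))
      (HasFDerivAt.const_mul (HasFDerivAt.const_mul (HasFDerivAt.fun_sum fun i _ =>
      HasFDerivAt.fun_sum fun j hj => ?_) _) _)
    · unfold coordD
      split_ifs
      · exact hasFDerivAt_apply i x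
      · exact hasFDerivAt_const _ _
    · exact ((powOn_hasFDerivAt hx i).add (powOn_hasFDerivAt hx j)).log
        (powOn_pos hα hc hx (by simpa using hj)).ne'
  rw [hd.fderiv]
  have hsymm : ∑ i, ∑ j ∈ G.neighborFinset i,
        (powOn α S i x + powOn α S j x)⁻¹ • powD α S x j =
      ∑ i, ∑ j ∈ G.neighborFinset i, (powOn α S i x + powOn α S j x)⁻¹ • powD α S x i := by
    rw [Finset.sum_comm' (t' := Finset.univ) (s' := fun i => G.neighborFinset i)
      (by intro i j; simp [G.adj_comm])]
    simp only [add_comm]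
  simp only [smul_add, Finset.sum_add_distrib, hsymm]
  rw [← smul_add, ← two_smul ℝ, smul_smul (2 : ℝ),
    show (2 : ℝ) * (1 / 2) = 1 by norm_num, one_smul, one_div]
  rw [Finset.smul_sum, ← Finset.sum_neg_distrib, ← Finset.sum_add_distrib]
  refine Finset.sum_eq_zero fun i _ => ?_
  by_cases h : i ∈ S
  · have hi : x i ≠ 0 := (hx.2 i).1 h
    have hi0 : 0 < x i := lt_of_le_of_ne (hx.1.1.1 i) hi.symm
    have hF : urnField m G α x i = 0 := by rw [hx.1.2]; rfl
    unfold urnField at hF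
    simp only [coordD, powD, h, if_true, powOn_eq hα hx]
    rw [← Finset.sum_smul, smul_smul, smul_smul]
    have h1 : (α * (G.edgeFinset.card : ℝ))⁻¹ *
        ((∑ j ∈ G.neighborFinset i, (x i ^ α + x j ^ α)⁻¹) * (α * x i ^ (α - 1))) = 1 := by
      have h2 : ∑ j ∈ G.neighborFinset i, x i ^ α / (x i ^ α + x j ^ α)
          = (x i ^ (α - 1) * x i) * ∑ j ∈ G.neighborFinset i, (x i ^ α + x j ^ α)⁻¹ := by
        rw [Finset.mul_sum]
        refine Finset.sum_congr rfl fun j _ => ?_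
        rw [← Real.rpow_add_one hi, sub_add_cancel, div_eq_mul_inv]
      rw [h2] at hF
      apply mul_right_cancel₀ hi
      rw [mul_inv]
      have hα' : α⁻¹ * α = 1 := inv_mul_cancel₀ hα.ne'
      linear_combination hF + (G.edgeFinset.card : ℝ)⁻¹ *
        (∑ j ∈ G.neighborFinset i, (x i ^ α + x j ^ α)⁻¹) * x i ^ (α - 1) * x i * hα'
    rw [mul_assoc, h1, one_smul, neg_add_cancel]
  · simp [coordD, powD, h]

end face

end LyapSard

/-- The image `L(Λ)` of the equilibria set under the Lyapunov function has zero Lebesgue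
measure; in particular it has empty interior. -/
theorem lyap_image_equilibria_null
    {m : ℕ} {G : SimpleGraph (Fin m)} [DecidableRel G.Adj] {α c : ℝ}
    (hα : 0 < α) (hc : 0 < c) (hcN : c < 1 / (G.edgeFinset.card : ℝ)) :
    MeasureTheory.volume (lyap m G α '' equilibria m G α c) = 0 ∧
    interior (lyap m G α '' equilibria m G α c) = ∅ := by
  have h0 : MeasureTheory.volume (lyap m G α '' equilibria m G α c) = 0 := by
    have hsub : lyap m G α '' equilibria m G α c ⊆
        ⋃ S : Finset (Fin m), LyapSard.faceLyap G α S '' LyapSard.faceEq G α c S := by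
      rintro _ ⟨x, hx, rfl⟩
      have hxS : x ∈ LyapSard.faceEq G α c (Finset.univ.filter fun i => x i ≠ 0) :=
        ⟨hx, fun i => by simp⟩
      exact Set.mem_iUnion.2 ⟨_, x, hxS, LyapSard.faceLyap_eq hα hxS⟩
    refine measure_mono_null hsub (measure_iUnion_null fun S => ?_)
    exact LyapSard.sardIn _ (Fin m → ℝ) rfl _ _
      (fun x hx => LyapSard.faceLyap_contDiffAt hα hc hx)
      (fun x hx => LyapSard.faceLyap_fderiv hα hc hx)
  exact ⟨h0, Measure.interior_eq_empty_of_null h0⟩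
end

section
/- Let G be a finite connected graph, let 0 < α ≤ 1, and let v be an equilibrium of F with v_1 = 0 such that ∂L/∂v_1(v) = -1 + (1/N) Σ_{j ∼ 1} v_1^{α-1}/(v_1^α + v_j^α) is strictly positive (this quantity being interpreted as +∞, hence positive, when α < 1 and v_1 = 0). Then the probability that x(n) converges to v is zero. -/
open MeasureTheory Filter Topology

open MeasureTheory Filter Topology

/-- The partial derivative `∂L/∂v_i (v) = -1 + (1/N) ∑_{j ∼ i} v_i^(α-1) / (v_i^α + v_j^α)`
of the Lyapunov function `L`. -/
noncomputable def lyapGrad (m : ℕ) (G : SimpleGraph (Fin m)) [DecidableRel G.Adj] (α : ℝ)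
    (v : Fin m → ℝ) (i : Fin m) : ℝ :=
  -1 + (1 / (G.edgeFinset.card : ℝ)) *
    ∑ j ∈ G.neighborFinset i, v i ^ (α - 1) / (v i ^ α + v j ^ α)

lemma urn_core {Ω : Type*} {m0 : MeasurableSpace Ω} (μ : Measure Ω) [IsProbabilityMeasure μ]
    (ℱ : Filtration ℕ m0) (b : ℕ → Ω → ℝ) (D p : ℕ → Ω → ℝ) (T : ℕ → ℝ) (d N : ℝ)
    (hb : ∀ n, Measurable[ℱ n] (b n)) (hb1 : ∀ n ω, 1 ≤ b n ω)
    (hD : ∀ n, Measurable (D n)) (hD0 : ∀ n ω, 0 ≤ D n ω) (hDd : ∀ n ω, D n ω ≤ d)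
    (hbs : ∀ n ω, b (n + 1) ω = b n ω + D n ω)
    (hp : ∀ n, Measurable[ℱ n] (p n)) (hcond : ∀ n, μ[D n | ℱ n] =ᵐ[μ] p n)
    (hd : 0 ≤ d) (hN : 0 ≤ N) (hT : ∀ n, 0 < T n) (hTs : ∀ n, T (n + 1) = T n + N) :
    μ {ω | (∀ᶠ n in atTop, N * (b n ω + d) / T n ≤ p n ω) ∧
      Tendsto (fun n => T n / b n ω) atTop atTop} = 0 := by
  have hb' : ∀ n, Measurable (b n) := fun n => (hb n).mono (ℱ.le n) le_rfl
  have hbpos : ∀ n ω, 0 < b n ω := fun n ω => lt_of_lt_of_le one_pos (hb1 n ω)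
  have hf0 : ∀ n ω, 0 ≤ T n / b n ω := fun n ω => (div_pos (hT n) (hbpos n ω)).le
  have hfT : ∀ n ω, T n / b n ω ≤ T n := fun n ω => div_le_self (hT n).le (hb1 n ω)
  have hfm : ∀ n, Measurable (fun ω => T n / b n ω) := fun n => measurable_const.div (hb' n)
  have hfi : ∀ n, Integrable (fun ω => T n / b n ω) μ := fun n =>
    Integrable.of_bound (hfm n).aestronglyMeasurable (T n)
      (Eventually.of_forall fun ω => by rw [Real.norm_of_nonneg (hf0 n ω)]; exact hfT n ω)
  have hDi : ∀ n, Integrable (D n) μ := fun n =>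
    Integrable.of_bound (hD n).aestronglyMeasurable d
      (Eventually.of_forall fun ω => by rw [Real.norm_of_nonneg (hD0 n ω)]; exact hDd n ω)
  -- one step inequality
  have step : ∀ n (S : Set Ω), MeasurableSet[ℱ n] S →
      (∀ ω ∈ S, N * (b n ω + d) / T n ≤ p n ω) →
      ∫ ω in S, T (n + 1) / b (n + 1) ω ∂μ ≤ ∫ ω in S, T n / b n ω ∂μ := by
    intro n S hS hgood
    have hS' := ℱ.le n S hS
    set g : Ω → ℝ := fun ω => T (n + 1) / (b n ω * (b n ω + d)) with hg
    have hgm : Measurable[ℱ n] g := measurable_const.div ((hb n).mul ((hb n).add_const d))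
    have hg0 : ∀ ω, 0 ≤ g ω := fun ω => by
      have := hbpos n ω; have := hT (n+1); positivity
    have hgT : ∀ ω, g ω ≤ T (n + 1) := fun ω => by
      refine div_le_self (hT _).le ?_
      nlinarith [hb1 n ω]
    have hgb : ∀ ω, ‖g ω‖ ≤ T (n + 1) := fun ω => by
      rw [Real.norm_of_nonneg (hg0 ω)]; exact hgT ω
    have hgDi : Integrable (fun ω => g ω * D n ω) μ :=
      (hDi n).bdd_mul (c := T (n+1)) (hgm.mono (ℱ.le n) le_rfl).aestronglyMeasurable
        (Eventually.of_forall hgb)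
    have hpi : Integrable (p n) μ := (integrable_condExp (m := ℱ n) (f := D n)).congr (hcond n)
    have hgpi : Integrable (fun ω => g ω * p n ω) μ :=
      hpi.bdd_mul (c := T (n+1)) (hgm.mono (ℱ.le n) le_rfl).aestronglyMeasurable
        (Eventually.of_forall hgb)
    have e1 : ∫ ω in S, g ω * D n ω ∂μ = ∫ ω in S, g ω * p n ω ∂μ := by
      rw [← setIntegral_condExp (ℱ.le n) hgDi hS]
      refine setIntegral_congr_ae hS' ?_
      have := condExp_mul_of_stronglyMeasurable_left (μ := μ) (m := ℱ n)
        hgm.stronglyMeasurable hgDi (hDi n)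
      filter_upwards [this, hcond n] with ω h1 h2 _
      have h3 : (μ[fun ω => g ω * D n ω | ℱ n]) ω = g ω * (μ[D n | ℱ n]) ω := h1
      rw [h3, h2]
    have hh : Integrable (fun ω => T (n + 1) / b n ω) μ := by
      have : (fun ω => T (n + 1) / b n ω) = fun ω => (T (n+1) / T n) * (T n / b n ω) := by
        funext ω
        have := hT n
        field_simp
      rw [this]; exact (hfi n).const_mul _
    calc ∫ ω in S, T (n + 1) / b (n + 1) ω ∂μ
        ≤ ∫ ω in S, (T (n + 1) / b n ω - g ω * D n ω) ∂μ := by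
          refine setIntegral_mono (hfi _).integrableOn (hh.sub hgDi).integrableOn fun ω => ?_
          have h1 := hbpos n ω
          have h2 := hD0 n ω
          have h3 := hDd n ω
          have h4 := hT (n+1)
          simp only [hbs n ω, hg]
          have : T (n+1) / (b n ω) - T (n+1) / (b n ω * (b n ω + d)) * D n ω
            - T (n+1) / (b n ω + D n ω) = T (n+1) * D n ω * (d - D n ω) /
              (b n ω * (b n ω + d) * (b n ω + D n ω)) := by
            field_simp
            ring
          have h5 : 0 ≤ T (n+1) * D n ω * (d - D n ω) /
              (b n ω * (b n ω + d) * (b n ω + D n ω)) := by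
            have : 0 ≤ d - D n ω := by linarith
            positivity
          linarith
      _ = ∫ ω in S, (T (n + 1) / b n ω - g ω * p n ω) ∂μ := by
          rw [integral_sub hh.integrableOn hgDi.integrableOn,
            integral_sub hh.integrableOn hgpi.integrableOn, e1]
      _ ≤ ∫ ω in S, T n / b n ω ∂μ := by
          refine setIntegral_mono_on (hh.sub hgpi).integrableOn (hfi n).integrableOn hS' ?_
          intro ω hω
          have h1 := hbpos n ω
          have h4 := hT n
          have h5 := mul_le_mul_of_nonneg_left (hgood ω hω) (hg0 ω)
          have h6 : T (n+1) / b n ω - g ω * (N * (b n ω + d) / T n)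
             = T n / b n ω - N ^ 2 / (T n * b n ω) := by
            simp only [hg, hTs]
            field_simp
            ring
          have h7 : 0 ≤ N ^ 2 / (T n * b n ω) := by positivity
          linarith
  -- the event with a fixed starting time
  have key : ∀ n0 : ℕ, μ {ω | (∀ n ≥ n0, N * (b n ω + d) / T n ≤ p n ω) ∧
      Tendsto (fun n => T n / b n ω) atTop atTop} = 0 := by
    intro n0
    set A : ℕ → Set Ω := fun k => {ω | ∀ n, n0 ≤ n → n < n0 + k → N * (b n ω + d) / T n ≤ p n ω}
      with hA
    have hAm : ∀ k, MeasurableSet[ℱ (n0 + k)] (A (k + 1)) := by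
      intro k
      have : A (k + 1) = ⋂ n, ⋂ (_ : n0 ≤ n), ⋂ (_ : n < n0 + (k + 1)),
          {ω | N * (b n ω + d) / T n ≤ p n ω} := by
        ext ω; simp [hA]
      rw [this]
      refine MeasurableSet.iInter fun n => MeasurableSet.iInter fun _ =>
        MeasurableSet.iInter fun h => ?_
      have hle : ℱ n ≤ ℱ (n0 + k) := ℱ.mono (by omega)
      exact hle _ (measurableSet_le ((((hb n).add_const d).const_mul N).div_const _) (hp n))
    have hAm' : ∀ k, MeasurableSet (A k) := by
      intro k
      rcases k with _ | k
      · have : A 0 = Set.univ := by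
          ext ω; simp only [hA, Set.mem_setOf_eq, Set.mem_univ, iff_true]; intro n; omega
        rw [this]; exact MeasurableSet.univ
      · exact ℱ.le _ _ (hAm k)
    have hAanti : ∀ k, A (k + 1) ⊆ A k := fun k ω h n h1 h2 => h n h1 (by omega)
    have bound : ∀ k, ∫ ω in A k, T (n0 + k) / b (n0 + k) ω ∂μ ≤ T n0 := by
      intro k
      induction k with
      | zero =>
        calc ∫ ω in A 0, T (n0 + 0) / b (n0 + 0) ω ∂μ ≤ ∫ ω, T n0 / b n0 ω ∂μ :=
              setIntegral_le_integral (hfi n0) (Eventually.of_forall (hf0 n0))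
          _ ≤ ∫ ω, T n0 ∂μ := integral_mono (hfi n0) (integrable_const _) (hfT n0)
          _ = T n0 := by simp
      | succ k ih =>
        refine (step (n0 + k) (A (k+1)) (hAm k) ?_).trans (le_trans ?_ ih)
        · intro ω hω; exact hω _ (by omega) (by omega)
        · exact setIntegral_mono_set (hfi _).integrableOn (Eventually.of_forall (hf0 _))
            (Eventually.of_forall (hAanti k))
    set U : ℕ → Ω → ENNReal := fun k =>
      (A k).indicator (fun ω => ENNReal.ofReal (T (n0 + k) / b (n0 + k) ω)) with hU
    have hUm : ∀ k, Measurable (U k) := fun k => ((hfm _).ennreal_ofReal).indicator (hAm' k)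
    have hUb : ∀ k, ∫⁻ ω, U k ω ∂μ ≤ ENNReal.ofReal (T n0) := by
      intro k
      rw [hU, lintegral_indicator (hAm' k),
        ← ofReal_integral_eq_lintegral_ofReal (hfi _).integrableOn
          (Eventually.of_forall (hf0 _))]
      exact ENNReal.ofReal_le_ofReal (bound k)
    have hfat : ∫⁻ ω, liminf (fun k => U k ω) atTop ∂μ ≤ ENNReal.ofReal (T n0) :=
      (lintegral_liminf_le hUm).trans
        (liminf_le_of_le (h := fun b hb => by
          obtain ⟨k, hk⟩ := hb.exists
          exact hk.trans (hUb k)))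
    have hfin : ∀ᵐ ω ∂μ, liminf (fun k => U k ω) atTop < ⊤ :=
      ae_lt_top (Measurable.liminf hUm) (hfat.trans_lt ENNReal.ofReal_lt_top).ne
    refine measure_mono_null ?_ hfin
    rintro ω ⟨h1, h2⟩
    simp only [Set.mem_compl_iff, Set.mem_setOf_eq, not_lt, top_le_iff]
    have : Tendsto (fun k => U k ω) atTop (𝓝 ⊤) := by
      have e : (fun k => U k ω) = fun k => ENNReal.ofReal (T (n0 + k) / b (n0 + k) ω) := by
        funext k
        simp only [hU]
        rw [Set.indicator_of_mem]
        intro n hn _; exact h1 n hn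
      rw [e]
      refine ENNReal.tendsto_ofReal_atTop.comp (h2.comp ?_)
      exact tendsto_atTop_mono (fun k => Nat.le_add_left k n0) tendsto_id
    exact this.liminf_eq
  refine measure_mono_null ?_ (measure_iUnion_null key)
  rintro ω ⟨h1, h2⟩
  obtain ⟨n0, h⟩ := eventually_atTop.1 h1
  exact Set.mem_iUnion.2 ⟨n0, h, h2⟩

lemma urn_recurrent {Ω : Type*} {m0 : MeasurableSpace Ω} (μ : Measure Ω) [IsProbabilityMeasure μ]
    (ℱ : Filtration ℕ m0) (b : ℕ → Ω → ℝ) (s : ℕ → Set Ω) (q : ℕ → Ω → ℝ) (K : ℝ) (hK : 0 < K)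
    (hs : ∀ n, MeasurableSet[ℱ n] (s n)) (hb0 : ∀ ω, 0 ≤ b 0 ω)
    (hbs : ∀ n ω, b n ω + (s (n + 1)).indicator 1 ω ≤ b (n + 1) ω)
    (hcond : ∀ n, μ[(s (n + 1)).indicator 1 | ℱ n] =ᵐ[μ] q n)
    (hq : ∀ n ω, 1 / (K * (n + 1)) ≤ q n ω) :
    ∀ᵐ ω ∂μ, Tendsto (fun n => b n ω) atTop atTop := by
  have h := tendsto_sum_indicator_atTop_iff' (μ := μ) hs
  filter_upwards [h, ae_all_iff.2 hcond] with ω h1 h2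
  have h3 : Tendsto (fun n => ∑ k ∈ Finset.range n,
      (μ[(s (k + 1)).indicator (1 : Ω → ℝ) | ℱ k]) ω) atTop atTop := by
    have h4 : Tendsto (fun n : ℕ => K⁻¹ * ∑ i ∈ Finset.range n, 1 / ((i : ℝ) + 1)) atTop atTop :=
      Real.tendsto_sum_range_one_div_nat_succ_atTop.const_mul_atTop (inv_pos.2 hK)
    refine tendsto_atTop_mono (fun n => ?_) h4
    rw [Finset.mul_sum]
    refine Finset.sum_le_sum fun k _ => ?_
    rw [h2 k]
    refine le_trans (le_of_eq ?_) (hq k ω)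
    field_simp
  refine tendsto_atTop_mono (fun n => ?_) (h1.2 h3)
  induction n with
  | zero => simpa using hb0 ω
  | succ n ih =>
    rw [Finset.sum_range_succ]
    linarith [hbs n ω]

lemma urn_drift_s15 {m : ℕ} {G : SimpleGraph (Fin m)} [DecidableRel G.Adj] {α c : ℝ}
    (hα0 : 0 < α) (hα1 : α ≤ 1) (hc : 0 < c) (hN : 0 < (G.edgeFinset.card : ℝ))
    (v : Fin m → ℝ) (hv : v ∈ simplexDomain m G c) (i₀ j₀ : Fin m) (hj : G.Adj i₀ j₀)
    (hzero : v i₀ = 0) (hpos : α < 1 ∨ 0 < lyapGrad m G α v i₀)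
    (x : ℕ → Fin m → ℝ) (hx : ∀ n i, 0 < x n i) (hlim : Tendsto x atTop (𝓝 v))
    (e : ℕ → ℝ) (he : Tendsto e atTop (𝓝 0)) :
    ∀ᶠ n in atTop, (G.edgeFinset.card : ℝ) * (x n i₀ * (1 + e n)) ≤
      ∑ j ∈ G.neighborFinset i₀, x n i₀ ^ α / (x n i₀ ^ α + x n j ^ α) := by
  set N : ℝ := (G.edgeFinset.card : ℝ) with hNdef
  have hxi : ∀ i, Tendsto (fun n => x n i) atTop (𝓝 (v i)) := fun i =>
    (tendsto_pi_nhds.1 hlim) i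
  have hvj : ∀ j, G.Adj i₀ j → 0 < v j := fun j hj => by
    have := hv.2.2 i₀ j hj
    rw [hzero] at this
    linarith
  have hxa : ∀ i, Tendsto (fun n => x n i ^ α) atTop (𝓝 (v i ^ α)) := fun i =>
    (hxi i).rpow_const (Or.inr hα0.le)
  have hR : Tendsto (fun n => N * (1 + e n)) atTop (𝓝 N) := by
    simpa using (he.const_add 1).const_mul N
  have main : ∀ᶠ n in atTop, N * (1 + e n) ≤
      ∑ j ∈ G.neighborFinset i₀, x n i₀ ^ (α - 1) / (x n i₀ ^ α + x n j ^ α) := by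
    rcases hα1.lt_or_eq with h1 | h1
    · have hvi : Tendsto (fun n => x n i₀) atTop (𝓝[>] 0) := by
        refine tendsto_nhdsWithin_iff.2 ⟨hzero ▸ hxi i₀, Eventually.of_forall fun n => hx n i₀⟩
      have hA : Tendsto (fun n => x n i₀ ^ (α - 1)) atTop atTop :=
        (tendsto_rpow_neg_nhdsGT_zero (by linarith)).comp hvi
      have hB : Tendsto (fun n => (x n i₀ ^ α + x n j₀ ^ α)⁻¹) atTop (𝓝 ((v j₀ ^ α)⁻¹)) := by
        have := (hxa i₀).add (hxa j₀)
        rw [hzero, Real.zero_rpow hα0.ne', zero_add] at this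
        exact this.inv₀ (Real.rpow_pos_of_pos (hvj j₀ hj) _).ne'
      have hC := hA.atTop_mul_pos (inv_pos.2 (Real.rpow_pos_of_pos (hvj j₀ hj) α)) hB
      filter_upwards [hC.eventually_ge_atTop (N + 1), hR.eventually_le_const (lt_add_one N)]
        with n hn1 hn2
      refine hn2.trans (hn1.trans ?_)
      rw [← div_eq_mul_inv]
      refine Finset.single_le_sum
        (f := fun j => x n i₀ ^ (α - 1) / (x n i₀ ^ α + x n j ^ α)) (fun j _ => ?_) (by simpa using hj)
      have h1 := hx n i₀
      have h2 := hx n j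
      positivity
    · have hg : 0 < lyapGrad m G α v i₀ := hpos.resolve_left (by linarith)
      subst h1
      have hS : N < ∑ j ∈ G.neighborFinset i₀, 1 / (v i₀ + v j) := by
        simp only [lyapGrad, sub_self, Real.rpow_zero, Real.rpow_one] at hg
        rw [← hNdef] at hg
        have h2 : 1 < (1 / N) * ∑ j ∈ G.neighborFinset i₀, 1 / (v i₀ + v j) := by linarith
        rw [one_div_mul_eq_div, lt_div_iff₀ hN] at h2
        linarith
      have hT : Tendsto (fun n => ∑ j ∈ G.neighborFinset i₀, 1 / (x n i₀ + x n j)) atTop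
          (𝓝 (∑ j ∈ G.neighborFinset i₀, 1 / (v i₀ + v j))) := by
        refine tendsto_finsetSum _ fun j hj => ?_
        have := hvj j (by simpa using hj)
        exact tendsto_const_nhds.div ((hxi i₀).add (hxi j)) (by rw [hzero]; linarith)
      filter_upwards [hR.eventually_lt hT hS] with n hn
      simpa using hn.le
  filter_upwards [main] with n hn
  have h0 := hx n i₀
  have := mul_le_mul_of_nonneg_left hn h0.le
  rw [Finset.mul_sum] at this
  calc N * (x n i₀ * (1 + e n)) = x n i₀ * (N * (1 + e n)) := by ring
    _ ≤ _ := this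
    _ = _ := Finset.sum_congr rfl fun j _ => by
      rw [← mul_div_assoc]
      congr 1
      rw [Real.rpow_sub_one h0.ne']
      field_simp

/-- **Lemma (non-convergence to unstable equilibria).** Let `0 < α ≤ 1` and let `v` be an
equilibrium of `F` with `v_{i₀} = 0` whose "partial derivative" `∂L/∂v_{i₀}(v)` is strictly
positive (when `α < 1` this quantity is `+∞`, hence positive). Then the probability that
`x(n)` converges to `v` is zero. -/
theorem polya_urn_no_convergence_to_unstable
    {m : ℕ} {G : SimpleGraph (Fin m)} [DecidableRel G.Adj] {α c : ℝ}
    (hconn : G.Connected) (hα0 : 0 < α) (hα1 : α ≤ 1)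
    (hc : 0 < c) (hcN : c < 1 / (G.edgeFinset.card : ℝ))
    (v : Fin m → ℝ) (hv : v ∈ simplexDomain m G c) (hequi : urnField m G α v = 0)
    (i₀ : Fin m) (hzero : v i₀ = 0)
    (hpos : α < 1 ∨ 0 < lyapGrad m G α v i₀)
    (P : GraphUrn m G α) :
    P.μ {ω | Tendsto (fun n => P.x n ω) atTop (𝓝 v)} = 0 := by
  letI := P.mΩ
  haveI := P.isProb
  have hN : 0 < (G.edgeFinset.card : ℝ) := by
    rcases (Nat.cast_nonneg (α := ℝ) G.edgeFinset.card).lt_or_eq with h | h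
    · exact h
    · rw [← h] at hcN; simp at hcN; linarith
  obtain ⟨j₀, hj⟩ : ∃ j, G.Adj i₀ j := by
    have hNn : 0 < G.edgeFinset.card := by exact_mod_cast hN
    obtain ⟨ed, hed⟩ := Finset.card_pos.1 hNn
    induction ed using Sym2.ind with
    | _ a b =>
      have hab : G.Adj a b := by simpa using hed
      haveI : Nontrivial (Fin m) := ⟨a, b, hab.ne⟩
      exact hconn.preconnected.exists_adj_of_nontrivial i₀
  set N : ℝ := (G.edgeFinset.card : ℝ) with hNdef
  obtain ⟨ω₀⟩ : Nonempty P.Ω := P.μ.nonempty_of_neZero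
  set N₀ : ℕ := ∑ j, P.B 0 j ω₀ with hN₀
  set T : ℕ → ℝ := fun n => (N₀ : ℝ) + n * N with hTdef
  have hN₀pos : 1 ≤ N₀ := (P.B0_pos i₀ ω₀).trans
    (Finset.single_le_sum (f := fun j => P.B 0 j ω₀) (fun _ _ => Nat.zero_le _) (Finset.mem_univ i₀))
  have hT : ∀ n, 0 < T n := fun n => by
    have : (1 : ℝ) ≤ N₀ := by exact_mod_cast hN₀pos
    have : 0 ≤ (n : ℝ) * N := by positivity
    simp only [hTdef]; linarith
  have hTs : ∀ n, T (n + 1) = T n + N := fun n => by simp only [hTdef]; push_cast; ring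
  have hxT : ∀ n ω i, P.x n ω i = (P.B n i ω : ℝ) / T n := fun n ω i => by
    simp only [GraphUrn.x, hTdef, hN₀, hNdef]
    rw [Finset.sum_congr rfl fun j _ => P.B0_det j ω ω₀]
    push_cast; rfl
  have hB1 : ∀ n i ω, 1 ≤ P.B n i ω := fun n i ω => by
    induction n with
    | zero => exact P.B0_pos i ω
    | succ n ih => rw [P.B_succ]; omega
  have hδ1 : ∀ n i j, G.Adj i j → ∀ ω, P.δ n i j ω ≤ 1 := fun n i j h ω => by
    have := P.δ_sum n i j h ω; omega
  have hBle : ∀ n i ω, P.B n i ω ≤ P.B 0 i ω₀ + n * m := fun n i ω => by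
    induction n with
    | zero => rw [P.B0_det i ω ω₀]; simp
    | succ n ih =>
      rw [P.B_succ]
      have h1 : ∑ j ∈ G.neighborFinset i, P.δ (n + 1) i j ω ≤ ∑ j ∈ G.neighborFinset i, 1 :=
        Finset.sum_le_sum fun j hj => hδ1 _ _ _ (by simpa using hj) ω
      have h2 : ∑ j ∈ G.neighborFinset i, 1 ≤ m := by
        simpa using Finset.card_le_univ (G.neighborFinset i)
      nlinarith
  have hδm : ∀ n i j, Measurable (P.δ n i j) := fun n i j =>
    (P.δ_adapted n i j).mono (P.ℱ.le n) le_rfl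
  have hδR : ∀ n i j, Measurable (fun ω => (P.δ n i j ω : ℝ)) := fun n i j =>
    measurable_from_top.comp (hδm n i j)
  have hBR : ∀ n i, Measurable[P.ℱ n] (fun ω => (P.B n i ω : ℝ)) := fun n i =>
    measurable_from_top.comp (P.B_adapted n i)
  have hδi : ∀ n i j, G.Adj i j → Integrable (fun ω => (P.δ n i j ω : ℝ)) P.μ := fun n i j h =>
    Integrable.of_bound (hδR n i j).aestronglyMeasurable 1 (Eventually.of_forall fun ω => by
      rw [Real.norm_of_nonneg (Nat.cast_nonneg _)]
      exact_mod_cast hδ1 n i j h ω)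
  set p : ℕ → P.Ω → ℝ := fun n ω => ∑ j ∈ G.neighborFinset i₀,
    (P.B n i₀ ω : ℝ) ^ α / ((P.B n i₀ ω : ℝ) ^ α + (P.B n j ω : ℝ) ^ α) with hp
  set D : ℕ → P.Ω → ℝ := fun n ω => ∑ j ∈ G.neighborFinset i₀, (P.δ (n + 1) i₀ j ω : ℝ) with hD
  have hcore := urn_core P.μ P.ℱ (fun n ω => (P.B n i₀ ω : ℝ)) D p T
    ((G.neighborFinset i₀).card : ℝ) N (fun n => hBR n i₀)
    (fun n ω => by exact_mod_cast hB1 n i₀ ω)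
    (fun n => Finset.measurable_fun_sum _ fun j _ => hδR _ _ _)
    (fun n ω => Finset.sum_nonneg fun _ _ => Nat.cast_nonneg _)
    (fun n ω => by
      have : D n ω ≤ ∑ j ∈ G.neighborFinset i₀, (1 : ℝ) := Finset.sum_le_sum fun j hj => by
        exact_mod_cast hδ1 _ _ _ (by simpa using hj) ω
      simpa using this)
    (fun n ω => by simp only [hD]; rw [P.B_succ]; push_cast; rfl)
    (fun n => Finset.measurable_fun_sum _ fun j _ =>
      ((hBR n i₀).pow_const α).div (((hBR n i₀).pow_const α).add ((hBR n j).pow_const α)))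
    (fun n => by
      have h1 := condExp_finsetSum (μ := P.μ) (s := G.neighborFinset i₀)
        (f := fun j ω => (P.δ (n + 1) i₀ j ω : ℝ))
        (fun j hj => hδi _ _ _ (by simpa using hj)) (P.ℱ n)
      have h2 : D n = ∑ j ∈ G.neighborFinset i₀, fun ω => (P.δ (n + 1) i₀ j ω : ℝ) := by
        funext ω; simp [hD]
      have h3 : ∀ᵐ ω ∂P.μ, ∀ j ∈ G.neighborFinset i₀,
          (P.μ[fun ω => (P.δ (n + 1) i₀ j ω : ℝ) | P.ℱ n]) ω =
          (P.B n i₀ ω : ℝ) ^ α / ((P.B n i₀ ω : ℝ) ^ α + (P.B n j ω : ℝ) ^ α) :=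
        (Finset.eventually_all _).2 fun j hj => P.cond_law n i₀ j (by simpa using hj)
      rw [h2]
      filter_upwards [h1, h3] with ω h4 h5
      rw [h4, Finset.sum_apply]
      exact Finset.sum_congr rfl fun j hj => h5 j hj)
    (Nat.cast_nonneg _) hN.le hT hTs
  have hind : ∀ n ω, ({ω | P.δ n i₀ j₀ ω = 1} : Set P.Ω).indicator (1 : P.Ω → ℝ) ω
      = (P.δ n i₀ j₀ ω : ℝ) := fun n ω => by
    have := hδ1 n i₀ j₀ hj ω
    by_cases h : P.δ n i₀ j₀ ω = 1
    · rw [Set.indicator_of_mem (by exact h), h]; simp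
    · rw [Set.indicator_of_notMem (by exact h), show P.δ n i₀ j₀ ω = 0 by omega]; simp
  have hrec := urn_recurrent P.μ P.ℱ (fun n ω => (P.B n i₀ ω : ℝ))
    (fun n => {ω | P.δ n i₀ j₀ ω = 1})
    (fun n ω => (P.B n i₀ ω : ℝ) ^ α / ((P.B n i₀ ω : ℝ) ^ α + (P.B n j₀ ω : ℝ) ^ α))
    (1 + P.B 0 j₀ ω₀ + m) (by positivity)
    (fun n => P.δ_adapted n i₀ j₀ (measurableSet_singleton 1))
    (fun ω => Nat.cast_nonneg _)
    (fun n ω => by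
      rw [hind, P.B_succ]
      have : P.δ (n + 1) i₀ j₀ ω ≤ ∑ j ∈ G.neighborFinset i₀, P.δ (n + 1) i₀ j ω :=
        Finset.single_le_sum (f := fun j => P.δ (n + 1) i₀ j ω) (fun _ _ => Nat.zero_le _)
          (by simpa using hj)
      exact_mod_cast Nat.add_le_add_left this _)
    (fun n => by
      rw [show ({ω | P.δ (n + 1) i₀ j₀ ω = 1} : Set P.Ω).indicator (1 : P.Ω → ℝ)
        = fun ω => (P.δ (n + 1) i₀ j₀ ω : ℝ) from funext (hind (n + 1))]
      exact P.cond_law n i₀ j₀ hj)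
    (fun n ω => by
      have a1 : (1 : ℝ) ≤ P.B n i₀ ω := by exact_mod_cast hB1 n i₀ ω
      have a2 : (1 : ℝ) ≤ P.B n j₀ ω := by exact_mod_cast hB1 n j₀ ω
      have a3 : (P.B n j₀ ω : ℝ) ≤ P.B 0 j₀ ω₀ + n * m := by exact_mod_cast hBle n j₀ ω
      have a4 : (1 : ℝ) ≤ (P.B n i₀ ω : ℝ) ^ α := Real.one_le_rpow a1 hα0.le
      have a5 : (P.B n j₀ ω : ℝ) ^ α ≤ P.B n j₀ ω := by
        simpa using Real.rpow_le_rpow_of_exponent_le a2 hα1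
      have a6 : (0 : ℝ) < (P.B n j₀ ω : ℝ) ^ α := by positivity
      have a7 : (0 : ℝ) ≤ n := Nat.cast_nonneg _
      have a8 : (0 : ℝ) ≤ P.B 0 j₀ ω₀ := Nat.cast_nonneg _
      have a9 : (0 : ℝ) ≤ m := Nat.cast_nonneg _
      have b1 : 1 + (P.B n j₀ ω : ℝ) ^ α ≤ (1 + P.B 0 j₀ ω₀ + m) * (n + 1) := by
        nlinarith [mul_nonneg a8 a7, mul_nonneg a9 a7]
      generalize (P.B n i₀ ω : ℝ) ^ α = u at *
      generalize (P.B n j₀ ω : ℝ) ^ α = w at *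
      refine (one_div_le_one_div_of_le (by linarith) b1).trans ?_
      rw [div_le_div_iff₀ (by linarith) (by linarith)]
      nlinarith)
  refine measure_mono_null (t := {ω | (∀ᶠ n in atTop,
      N * ((P.B n i₀ ω : ℝ) + ((G.neighborFinset i₀).card : ℝ)) / T n ≤ p n ω) ∧
      Tendsto (fun n => T n / (P.B n i₀ ω : ℝ)) atTop atTop} ∪
      {ω | ¬ Tendsto (fun n => (P.B n i₀ ω : ℝ)) atTop atTop}) ?_
    (measure_union_null hcore hrec)
  intro ω hω
  have hω' : Tendsto (fun n => P.x n ω) atTop (𝓝 v) := hω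
  by_cases hBt : Tendsto (fun n => (P.B n i₀ ω : ℝ)) atTop atTop
  swap
  · exact Or.inr hBt
  refine Or.inl ⟨?_, ?_⟩
  · have hBpos : ∀ n i, (0 : ℝ) < P.B n i ω := fun n i => by exact_mod_cast hB1 n i ω
    have := urn_drift_s15 hα0 hα1 hc hN v hv i₀ j₀ hj hzero hpos (fun n => P.x n ω)
      (fun n i => by rw [hxT]; exact div_pos (hBpos n i) (hT n)) hω'
      (fun n => ((G.neighborFinset i₀).card : ℝ) / (P.B n i₀ ω : ℝ))
      (tendsto_const_nhds.div_atTop hBt)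
    filter_upwards [this] with n hn
    have e1 : N * ((P.B n i₀ ω : ℝ) + ((G.neighborFinset i₀).card : ℝ)) / T n =
        N * (P.x n ω i₀ * (1 + ((G.neighborFinset i₀).card : ℝ) / (P.B n i₀ ω : ℝ))) := by
      rw [hxT]
      have h1 := hBpos n i₀
      have h2 := hT n
      field_simp
    rw [e1]
    refine hn.trans (le_of_eq ?_)
    refine Finset.sum_congr rfl fun j _ => ?_
    rw [hxT, hxT, Real.div_rpow (hBpos n i₀).le (hT n).le, Real.div_rpow (hBpos n j).le (hT n).le]
    have h1 := Real.rpow_pos_of_pos (hT n) α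
    rw [← add_div, div_div_div_cancel_right₀ h1.ne']
  · have h1 : Tendsto (fun n => P.x n ω i₀) atTop (𝓝[>] 0) := by
      refine tendsto_nhdsWithin_iff.2 ⟨hzero ▸ (tendsto_pi_nhds.1 hω') i₀,
        Eventually.of_forall fun n => ?_⟩
      rw [hxT]
      exact div_pos (by exact_mod_cast hB1 n i₀ ω) (hT n)
    refine (tendsto_inv_nhdsGT_zero.comp h1).congr fun n => ?_
    simp [hxT]
end
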